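/- The set of subfields K of ℂ that are finite abelian Galois extensions of ℚ satisfying log|d_K| = r₁(K)·π/2 + n·(log(8π) + γ), where n = [K:ℚ], is finite, and every such field has degree n < 46369. (This is the second part of Theorem 5: there are at most finitely many abelian number fields K with ζ_K'(1/2) = 0 but ζ_K(1/2) ≠ 0, and all of them have degree less than 46369.) -/

import Mathlib

/-- For a finite-dimensional subfield `K` of `ℂ`, the condition
`log|d_K| = r₁(K)·π/2 + n·(log(8π) + γ)` where `n = [K:ℚ]`
(vanishing of the factor `A_K'(1/2)`). -/
def CriticalDiscr (K : IntermediateField ℚ ℂ) [FiniteDimensional ℚ K] : Prop :=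
  letI : NumberField K := ⟨⟩
  Real.log |(NumberField.discr K : ℝ)| =
    (NumberField.InfinitePlace.nrRealPlaces K : ℝ) * (Real.pi / 2) +
      (Module.finrank ℚ K : ℝ) * (Real.log (8 * Real.pi) + Real.eulerMascheroniConstant)

section generic
variable {S : Type*} [CommRing S] {G : Type*} [Group G] [MulSemiringAction G S]

lemma kw_mem_inertia {P : Ideal S} {σ : G} : σ ∈ P.inertia G ↔ ∀ x, σ • x - x ∈ P := Iff.rfl

/-- inertia fixes roots of unity of order prime to the residue characteristic -/
lemma kw_inertia_fix_root [IsDomain S] {P : Ideal S} [P.IsPrime] {σ : G} (hσ : σ ∈ P.inertia G)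
    {η : S} {r : ℕ} (hη : η ^ r = 1) (hr : (r : S) ∉ P) : σ • η = η := by
  by_contra hne
  have h1 : (σ • η) ^ r = 1 := by rw [← smul_pow', hη, smul_one]
  have hg := Commute.geom_sum₂_mul (Commute.all (σ • η) η) r
  rw [h1, hη, sub_self] at hg
  have h0 : ∑ i ∈ Finset.range r, (σ • η) ^ i * η ^ (r - 1 - i) = 0 := by
    rcases mul_eq_zero.1 hg with h | h
    · exact h
    · exact absurd (sub_eq_zero.1 h) hne
  have hmod : Ideal.Quotient.mk P (σ • η) = Ideal.Quotient.mk P η :=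
    Ideal.Quotient.eq.2 (hσ η)
  have h2 : Ideal.Quotient.mk P (r * η ^ (r - 1)) = 0 := by
    rw [← map_zero (Ideal.Quotient.mk P), ← h0, map_sum, map_mul, map_natCast, map_pow]
    have : ∀ i ∈ Finset.range r, Ideal.Quotient.mk P ((σ • η) ^ i * η ^ (r - 1 - i)) =
        Ideal.Quotient.mk P η ^ (r-1) := by
      intro i hi
      rw [map_mul, map_pow, map_pow, hmod, ← pow_add]
      congr 1
      have := Finset.mem_range.1 hi
      omega
    rw [Finset.sum_congr rfl this]
    simp
  rw [Ideal.Quotient.eq_zero_iff_mem] at h2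
  have hu : IsUnit (η ^ (r-1)) := by
    have hr0 : r ≠ 0 := by rintro rfl; simp at hr
    exact (IsUnit.of_pow_eq_one hη hr0).pow _
  exact hr ((Ideal.mul_unit_mem_iff_mem P hu).1 h2)

lemma kw_smul_sub_mem_pow {P : Ideal S} {σ : G} (hσ : σ ∈ (P ^ 2).inertia G) (j : ℕ) :
    ∀ y ∈ P ^ j, σ • y - y ∈ P ^ (j + 1) := by
  have hP : ∀ y, σ • y - y ∈ P ^ 2 := hσ
  have hle : P ^ 2 ≤ P := Ideal.pow_le_self two_ne_zero
  induction j with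
  | zero => intro y _; simpa using hle (hP y)
  | succ j ih =>
    intro y hy
    rw [pow_succ] at hy
    refine Submodule.mul_induction_on hy ?_ ?_
    · intro a ha b hb
      have : σ • (a * b) - a * b = (σ • a - a) * (b + (σ • b - b)) + a * (σ • b - b) := by
        rw [smul_mul']; ring
      rw [this]
      refine Ideal.add_mem _ ?_ ?_
      · rw [pow_succ P (j+1)]
        exact Ideal.mul_mem_mul (ih a ha) (Ideal.add_mem _ hb (hle (hP b)))
      · have : P ^ (j + 1 + 1) = P ^ j * P ^ 2 := by rw [← pow_add]
        rw [this]
        exact Ideal.mul_mem_mul ha (hP b)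
    · intro a b ha hb
      have : σ • (a + b) - (a + b) = (σ • a - a) + (σ • b - b) := by rw [smul_add]; ring
      rw [this]; exact Ideal.add_mem _ ha hb

lemma kw_cancel_mem_pow {P : Ideal S} [P.IsMaximal] {n y : S} (hn : n ∉ P) {j : ℕ}
    (hy : y ∈ P ^ j) (h : n * y ∈ P ^ (j + 1)) : y ∈ P ^ (j + 1) := by
  obtain ⟨u, w, hw, huw⟩ := Ideal.IsMaximal.exists_inv ‹P.IsMaximal› hn
  have : y = u * (n * y) + y * w := by linear_combination (-y) * huw
  rw [this]
  refine Ideal.add_mem _ (Ideal.mul_mem_left _ _ h) ?_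
  rw [pow_succ]
  exact Ideal.mul_mem_mul hy hw

lemma kw_wild_trivial [IsDomain S] [IsNoetherianRing S] [FaithfulSMul G S]
    {P : Ideal S} [P.IsMaximal] {σ : G} (hσ : σ ∈ (P ^ 2).inertia G) {n : ℕ} (hn : (n : S) ∉ P)
    (h1 : σ ^ n = 1) : σ = 1 := by
  have key : ∀ j, ∀ x, σ • x - x ∈ P ^ j := by
    intro j
    induction j with
    | zero => simp
    | succ j ih =>
      intro x
      refine kw_cancel_mem_pow hn (ih x) ?_
      have : ∀ k : ℕ, σ ^ k • x - x - k * (σ • x - x) ∈ P ^ (j + 1) := by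
        intro k
        induction k with
        | zero => simp
        | succ k ihk =>
          have h2 := kw_smul_sub_mem_pow (pow_mem hσ k) j _ (ih x)
          have : σ ^ (k+1) • x - x - ((k + 1 : ℕ) : S) * (σ • x - x) =
            (σ ^ k • x - x - k * (σ • x - x)) + (σ ^ k • (σ • x - x) - (σ • x - x)) := by
            rw [smul_sub, smul_smul, ← pow_succ]; push_cast; ring
          rw [this]
          exact Ideal.add_mem _ ihk h2
      have h3 := this n
      rw [h1, one_smul, sub_self, zero_sub] at h3
      simpa using h3
  apply FaithfulSMul.eq_of_smul_eq_smul (α := S)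
  intro x
  rw [one_smul, ← sub_eq_zero, ← Submodule.mem_bot (R := S), ← Ideal.iInf_pow_eq_bot_of_isDomain P
    (Ideal.IsPrime.ne_top')]
  simp only [Submodule.mem_iInf]
  intro j; exact key j x

end generic

section generic2
variable {S : Type*} [CommRing S] {G : Type*} [Group G] [MulSemiringAction G S]

lemma kw_smul_mem_of_inertia {P : Ideal S} {σ : G} (hσ : σ ∈ P.inertia G) {y : S} (hy : y ∈ P) :
    σ • y ∈ P := by
  have := Ideal.add_mem _ (hσ y) hy
  simpa using this

lemma kw_smul_mem_sq {P : Ideal S} {σ : G} (hσ : ∀ y ∈ P, σ • y ∈ P) {y : S} (hy : y ∈ P ^ 2) :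
    σ • y ∈ P ^ 2 := by
  rw [pow_two] at hy
  refine Submodule.mul_induction_on hy ?_ ?_
  · intro a ha b hb
    rw [smul_mul', pow_two]; exact Ideal.mul_mem_mul (hσ a ha) (hσ b hb)
  · intro a b ha hb
    rw [smul_add]; exact Ideal.add_mem _ ha hb

variable [IsDedekindDomain S]

/-- an inertia element fixing a uniformizer mod `P^2` is wild -/
lemma kw_wild_of_uniformizer {P : Ideal S} [P.IsMaximal] (hP0 : P ≠ ⊥) [Finite (S ⧸ P)]
    {π : S} (hπ : π ∈ P) (hπ2 : π ∉ P ^ 2) {σ : G} (hσ : σ ∈ P.inertia G)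
    (h : σ • π - π ∈ P ^ 2) : σ ∈ (P ^ 2).inertia G := by
  have hy : ∀ y ∈ P, σ • y - y ∈ P ^ 2 := by
    intro y hy
    obtain ⟨d, e, he, hde⟩ := Ideal.exists_mul_add_mem_pow_succ hP0 (i := 1) π y
      (by simpa using hπ) (by simpa using hπ2) (by simpa using hy)
    have : σ • y - y = (σ • π - π) * (σ • d) + π * (σ • d - d) + (σ • e - e) := by
      rw [← hde, smul_add, smul_mul']; ring
    rw [this]
    refine Ideal.add_mem _ (Ideal.add_mem _ (Ideal.mul_mem_right _ _ h) ?_) ?_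
    · rw [pow_two]; exact Ideal.mul_mem_mul hπ (hσ d)
    · refine Ideal.sub_mem _ (kw_smul_mem_sq (fun y hy => kw_smul_mem_of_inertia hσ hy) he) he
  rw [kw_mem_inertia]
  intro x
  let := Ideal.Quotient.field P
  let := Fintype.ofFinite (S ⧸ P)
  set q := Fintype.card (S ⧸ P) with hq
  have hqP : (q : S) ∈ P := by
    rw [← Ideal.Quotient.eq_zero_iff_mem, map_natCast, hq]
    exact Nat.cast_card_eq_zero (S ⧸ P)
  have hxq : x - x ^ q ∈ P := by
    rw [← Ideal.Quotient.eq, map_pow, FiniteField.pow_card]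
  have h1 := hy _ hxq
  have h2 : (σ • x) ^ q - x ^ q ∈ P ^ 2 := by
    rw [← Commute.geom_sum₂_mul (Commute.all (σ • x) x) q, pow_two]
    refine Ideal.mul_mem_mul ?_ (hσ x)
    rw [← Ideal.Quotient.eq_zero_iff_mem, map_sum]
    have hmod : Ideal.Quotient.mk P (σ • x) = Ideal.Quotient.mk P x := Ideal.Quotient.eq.2 (hσ x)
    have : ∀ i ∈ Finset.range q, Ideal.Quotient.mk P ((σ • x) ^ i * x ^ (q - 1 - i)) =
        Ideal.Quotient.mk P x ^ (q-1) := by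
      intro i hi
      rw [map_mul, map_pow, map_pow, hmod, ← pow_add]
      congr 1
      have := Finset.mem_range.1 hi
      omega
    rw [Finset.sum_congr rfl this, Finset.sum_const, Finset.card_range, nsmul_eq_mul,
      ← map_natCast (Ideal.Quotient.mk P), Ideal.Quotient.eq_zero_iff_mem.2 hqP, zero_mul]
  have : σ • x - x = (σ • (x - x ^ q) - (x - x ^ q)) + ((σ • x) ^ q - x ^ q) := by
    rw [smul_sub, smul_pow']; ring
  rw [this]; exact Ideal.add_mem _ h1 h2

/-- tame quotient has order at most `p-1` when the inertia group commutes with Frobenius -/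
lemma kw_tame_index {P : Ideal S} [P.IsMaximal] (hP0 : P ≠ ⊥) [Finite (S ⧸ P)]
    {p : ℕ} (hp : 1 < p) (φ : G) (hφ : ∀ x : S, φ • x - x ^ p ∈ P)
    (hcomm : ∀ σ ∈ P.inertia G, σ * φ = φ * σ) :
    ((P ^ 2).inertia G).relIndex (P.inertia G) ≤ p - 1 := by
  obtain ⟨π, hπ, hπ2⟩ : ∃ π ∈ P, π ∉ P ^ 2 := by
    obtain ⟨x, h1, h2⟩ := Ideal.exists_mem_pow_notMem_pow_succ P hP0 (Ideal.IsPrime.ne_top') 1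
    exact ⟨x, by simpa using h1, by simpa using h2⟩
  have hφP : ∀ y ∈ P, φ • y ∈ P := by
    intro y hy
    have := Ideal.add_mem _ (hφ y) (Ideal.pow_mem_of_mem P hy p (by omega))
    simpa using this
  have hrep : ∀ y ∈ P, ∃ d, y - d * π ∈ P ^ 2 := by
    intro y hy
    obtain ⟨d, e, he, hde⟩ := Ideal.exists_mul_add_mem_pow_succ hP0 (i := 1) π y
      (by simpa using hπ) (by simpa using hπ2) (by simpa using hy)
    refine ⟨d, ?_⟩
    have : y - d * π = e := by rw [← hde]; ring
    rw [this]; exact he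
  have hcan : ∀ a, a * π ∈ P ^ 2 → a ∈ P := by
    intro a ha
    refine Ideal.mem_prime_of_mul_mem_pow hP0 (i := 1) (a := π) (by simpa using hπ2) ?_
    rw [mul_comm]; exact ha
  have hφP' : ∀ y ∈ P, φ⁻¹ • y ∈ P := by
    have hle : P ≤ P.comap (MulSemiringAction.toRingHom G S φ) := fun y hy => hφP y hy
    have heq := Ideal.IsMaximal.eq_of_le ‹P.IsMaximal›
      (Ideal.comap_ne_top _ Ideal.IsPrime.ne_top') hle
    intro y hy
    rw [heq, Ideal.mem_comap]
    simpa using hy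
  obtain ⟨b, hb⟩ := hrep _ (hφP π hπ)
  have hbP : b ∉ P := by
    intro hbP
    have h1 : φ • π ∈ P ^ 2 := by
      have := Ideal.add_mem _ hb (show b * π ∈ P ^ 2 by rw [pow_two]; exact Ideal.mul_mem_mul hbP hπ)
      simpa using this
    have := kw_smul_mem_sq hφP' h1
    rw [inv_smul_smul] at this
    exact hπ2 this
  choose! a ha using fun (σ : G) (hσ : σ ∈ P.inertia G) => hrep _ (kw_smul_mem_of_inertia hσ hπ)
  have haP : ∀ σ ∈ P.inertia G, a σ ∉ P := by
    intro σ hσ hbP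
    have h1 : σ • π ∈ P ^ 2 := by
      have := Ideal.add_mem _ (ha σ hσ) (show a σ * π ∈ P ^ 2 by
        rw [pow_two]; exact Ideal.mul_mem_mul hbP hπ)
      simpa using this
    have := kw_smul_mem_sq (fun y hy => kw_smul_mem_of_inertia (inv_mem hσ) hy) h1
    rw [inv_smul_smul] at this
    exact hπ2 this
  have hap : ∀ σ ∈ P.inertia G, a σ ^ p - a σ ∈ P := by
    intro σ hσ
    have h1 : σ • (φ • π) - b * a σ * π ∈ P ^ 2 := by
      have e1 := kw_smul_mem_sq (fun y hy => kw_smul_mem_of_inertia hσ hy) hb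
      have e2 : (σ • b - b) * (σ • π) ∈ P ^ 2 := by
        rw [pow_two]; exact Ideal.mul_mem_mul (hσ b) (kw_smul_mem_of_inertia hσ hπ)
      have e3 := Ideal.mul_mem_left _ b (ha σ hσ)
      have := Ideal.add_mem _ (Ideal.add_mem _ e1 e2) e3
      rw [smul_sub, smul_mul'] at this
      convert this using 1; ring
    have h2 : φ • (σ • π) - b * a σ ^ p * π ∈ P ^ 2 := by
      have e1 := kw_smul_mem_sq hφP (ha σ hσ)
      have e2 : (φ • a σ - a σ ^ p) * (φ • π) ∈ P ^ 2 := by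
        rw [pow_two]; exact Ideal.mul_mem_mul (hφ _) (hφP π hπ)
      have e3 := Ideal.mul_mem_left _ (a σ ^ p) hb
      have := Ideal.add_mem _ (Ideal.add_mem _ e1 e2) e3
      rw [smul_sub, smul_mul'] at this
      convert this using 1; ring
    rw [smul_smul, hcomm σ hσ] at h1
    rw [smul_smul] at h2
    have h3 := Ideal.sub_mem _ h1 h2
    have h4 := hcan (b * (a σ ^ p - a σ)) (by convert h3 using 1; ring)
    exact (Ideal.IsPrime.mem_or_mem inferInstance h4).resolve_left hbP
  let := Ideal.Quotient.field P
  classical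
  let R : Finset (S ⧸ P) := Polynomial.nthRootsFinset (p-1) (1 : S ⧸ P)
  have hR : R.card ≤ p - 1 := by
    refine (Multiset.toFinset_card_le _).trans (Polynomial.card_nthRoots (p-1) (1 : S ⧸ P))
  have hmemR : ∀ σ ∈ P.inertia G, Ideal.Quotient.mk P (a σ) ∈ R := by
    intro σ hσ
    rw [Polynomial.mem_nthRootsFinset (by omega)]
    have h0 : Ideal.Quotient.mk P (a σ) ≠ 0 := by
      rw [Ne, Ideal.Quotient.eq_zero_iff_mem]; exact haP σ hσ
    have h1 : Ideal.Quotient.mk P (a σ) ^ p = Ideal.Quotient.mk P (a σ) := by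
      rw [← map_pow, Ideal.Quotient.eq]; exact hap σ hσ
    have h2 : Ideal.Quotient.mk P (a σ) ^ (p - 1) * Ideal.Quotient.mk P (a σ) =
      1 * Ideal.Quotient.mk P (a σ) := by
      rw [← pow_succ, show p - 1 + 1 = p by omega, h1, one_mul]
    exact mul_right_cancel₀ h0 h2
  have hinj : ∀ σ ∈ P.inertia G, ∀ τ ∈ P.inertia G, a σ - a τ ∈ P →
      σ⁻¹ * τ ∈ (P ^ 2).inertia G := by
    intro σ hσ τ hτ h
    refine kw_wild_of_uniformizer hP0 hπ hπ2 (mul_mem (inv_mem hσ) hτ) ?_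
    have h1 : τ • π - σ • π ∈ P ^ 2 := by
      have e1 : (a σ - a τ) * π ∈ P ^ 2 := by rw [pow_two]; exact Ideal.mul_mem_mul h hπ
      have := Ideal.sub_mem _ (Ideal.sub_mem _ (ha τ hτ) (ha σ hσ)) e1
      convert this using 1; ring
    have := kw_smul_mem_sq (fun y hy => kw_smul_mem_of_inertia (inv_mem hσ) hy) h1
    rwa [smul_sub, inv_smul_smul, smul_smul] at this
  rw [Subgroup.relIndex, Subgroup.index]
  let f : (P.inertia G ⧸ ((P ^ 2).inertia G).subgroupOf (P.inertia G)) → R :=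
    fun x => ⟨Ideal.Quotient.mk P (a (x.out : G)), hmemR _ x.out.2⟩
  have hf : Function.Injective f := by
    intro x y hxy
    have h1 : Ideal.Quotient.mk P (a (x.out : G)) = Ideal.Quotient.mk P (a (y.out : G)) :=
      congrArg Subtype.val hxy
    rw [Ideal.Quotient.eq] at h1
    have h2 := hinj _ x.out.2 _ y.out.2 h1
    rw [← x.out_eq', ← y.out_eq']
    refine QuotientGroup.eq.2 ?_
    rw [Subgroup.mem_subgroupOf]
    simpa using h2
  have := Nat.card_le_card_of_injective f hf
  simp only [Nat.card_eq_fintype_card, Fintype.card_coe] at this ⊢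
  exact this.trans hR

end generic2

open NumberField

set_option linter.unusedSectionVars false
set_option linter.unusedVariables false

lemma kw_finite_quot {L : Type*} [Field L] [NumberField L] (P : Ideal (𝓞 L)) (hP : P ≠ ⊥) :
    Finite (𝓞 L ⧸ P) :=
  Ideal.finiteQuotientOfFreeOfNeBot P hP

section nf
variable {L : Type*} [Field L] [NumberField L] [IsGalois ℚ L]

lemma kw_card_inertia_int (P : Ideal (𝓞 L)) [P.IsPrime] (hP : P ≠ ⊥) :
    Nat.card (P.inertia Gal(L/ℚ)) = P.ramificationIdx ℤ := by
  have : Finite (𝓞 L ⧸ P) := kw_finite_quot P hP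
  rw [Ideal.card_inertia_eq_ramificationIdxIn (G := Gal(L/ℚ)) (P.under ℤ) P,
    Ideal.ramificationIdxIn_eq_ramificationIdx (P.under ℤ) P Gal(L/ℚ)]

lemma kw_card_inertia_rel (F : IntermediateField ℚ L) (P : Ideal (𝓞 L)) [P.IsPrime] (hP : P ≠ ⊥) :
    Nat.card (P.inertia Gal(L/F)) = P.ramificationIdx (𝓞 F) := by
  have : Finite (𝓞 L ⧸ P) := kw_finite_quot P hP
  have h0 : P.under (𝓞 F) ≠ ⊥ := mt Ideal.eq_bot_of_comap_eq_bot hP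
  rw [Ideal.card_inertia_eq_ramificationIdxIn (G := Gal(L/F)) (P.under (𝓞 F)) P,
    Ideal.ramificationIdxIn_eq_ramificationIdx (P.under (𝓞 F)) P Gal(L/F)]

lemma kw_card_inertia_inter (F : IntermediateField ℚ L) (P : Ideal (𝓞 L)) :
    Nat.card (P.inertia Gal(L/F)) =
      Nat.card (P.inertia Gal(L/ℚ) ⊓ F.fixingSubgroup : Subgroup Gal(L/ℚ)) := by
  refine Nat.card_congr ?_
  refine
    { toFun := fun σ => ⟨((IntermediateField.fixingSubgroupEquiv F).symm σ.1).1, ?_,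
        ((IntermediateField.fixingSubgroupEquiv F).symm σ.1).2⟩
      invFun := fun σ => ⟨IntermediateField.fixingSubgroupEquiv F ⟨σ.1, σ.2.2⟩, ?_⟩
      left_inv := ?_
      right_inv := ?_ }
  · exact fun x => σ.2 x
  · exact fun x => σ.2.1 x
  · intro σ; rfl
  · intro σ; rfl

lemma kw_card_inertia_tower (F : IntermediateField ℚ L) (P : Ideal (𝓞 L)) [P.IsPrime] (hP : P ≠ ⊥) :
    Nat.card (P.inertia Gal(L/ℚ)) = (P.under (𝓞 F)).ramificationIdx ℤ *
      Nat.card (P.inertia Gal(L/ℚ) ⊓ F.fixingSubgroup : Subgroup Gal(L/ℚ)) := by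
  rw [← kw_card_inertia_inter, kw_card_inertia_int P hP, kw_card_inertia_rel F P hP]
  exact Ideal.ramificationIdx_tower (P.under (𝓞 F)) P

lemma kw_ramIdx_one (F : IntermediateField ℚ L) (P : Ideal (𝓞 L)) [P.IsPrime] (hP : P ≠ ⊥)
    (h : P.inertia Gal(L/ℚ) ≤ F.fixingSubgroup) : (P.under (𝓞 F)).ramificationIdx ℤ = 1 := by
  have h1 := kw_card_inertia_tower F P hP
  rw [inf_eq_left.2 h] at h1
  have : 0 < Nat.card (P.inertia Gal(L/ℚ)) := Nat.card_pos
  nlinarith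

lemma kw_inertia_le_of_ramIdx_one (F : IntermediateField ℚ L) (P : Ideal (𝓞 L)) [P.IsPrime]
    (hP : P ≠ ⊥) (h : (P.under (𝓞 F)).ramificationIdx ℤ = 1) :
    P.inertia Gal(L/ℚ) ≤ F.fixingSubgroup := by
  have h1 := kw_card_inertia_tower F P hP
  rw [h, one_mul] at h1
  have := Subgroup.eq_of_le_of_card_ge (inf_le_left : P.inertia Gal(L/ℚ) ⊓ F.fixingSubgroup ≤ _)
    h1.le
  exact inf_eq_left.1 this

lemma kw_exists_prime_over (F : IntermediateField ℚ L) (q : Ideal (𝓞 F)) [q.IsPrime] (hq : q ≠ ⊥) :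
    ∃ P : Ideal (𝓞 L), P.IsPrime ∧ P ≠ ⊥ ∧ P.under (𝓞 F) = q := by
  obtain ⟨P, hP, hPq⟩ := Ideal.exists_ideal_over_prime_of_isIntegral_of_isDomain (S := 𝓞 L) q
    (by rw [(RingHom.injective_iff_ker_eq_bot _).1 (FaithfulSMul.algebraMap_injective (𝓞 F) (𝓞 L))]
        exact bot_le)
  refine ⟨P, hP, ?_, hPq⟩
  rintro rfl
  apply hq
  rw [← hPq, ← RingHom.ker_eq_comap_bot]
  exact (RingHom.injective_iff_ker_eq_bot _).1 (FaithfulSMul.algebraMap_injective (𝓞 F) (𝓞 L))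

/-- Minkowski: the inertia groups generate the Galois group. -/
lemma kw_inertia_generate (N : Subgroup Gal(L/ℚ))
    (h : ∀ P : Ideal (𝓞 L), P.IsPrime → P ≠ ⊥ → P.inertia Gal(L/ℚ) ≤ N) : N = ⊤ := by
  by_contra hN
  let F := IntermediateField.fixedField N
  have hF : F.fixingSubgroup = N := IntermediateField.fixingSubgroup_fixedField N
  have hdeg : 1 < Module.finrank ℚ F := by
    by_contra hle
    have h1 : Module.finrank ℚ F = 1 := by
      have : 0 < Module.finrank ℚ F := Module.finrank_pos
      omega
    have h2 : F = ⊥ := IntermediateField.finrank_eq_one_iff.1 h1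
    apply hN
    rw [← hF, h2, IntermediateField.fixingSubgroup_bot]
  obtain ⟨q, hq, hnot⟩ := NumberField.exists_not_isUnramifiedAt_int (K := F) (𝒪 := 𝓞 F) hdeg.ne'
  have hq0 : q ≠ ⊥ := Ring.ne_bot_of_isMaximal_of_not_isField hq (RingOfIntegers.not_isField F)
  obtain ⟨P, hP, hP0, rfl⟩ := kw_exists_prime_over F q hq0
  apply hnot
  have : Finite (𝓞 F ⧸ P.under (𝓞 F)) := kw_finite_quot _ hq0
  rw [← Ideal.ramificationIdx_eq_one_iff]
  exact kw_ramIdx_one F P hP0 (hF ▸ h P hP hP0)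

/-- if `p ∤ disc F`, inertia groups above `p` fix `F` -/
lemma kw_inertia_le_of_not_dvd_discr (F : IntermediateField ℚ L) (P : Ideal (𝓞 L)) [P.IsPrime]
    (hP : P ≠ ⊥) {p : ℕ} (hp : p.Prime) (hpP : (p : 𝓞 L) ∈ P)
    (h : ¬ (p : ℤ) ∣ NumberField.discr F) : P.inertia Gal(L/ℚ) ≤ F.fixingSubgroup := by
  apply kw_inertia_le_of_ramIdx_one F P hP
  have h0 : P.under (𝓞 F) ≠ ⊥ := mt Ideal.eq_bot_of_comap_eq_bot hP
  have : Finite (𝓞 F ⧸ P.under (𝓞 F)) := kw_finite_quot _ h0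
  rw [Ideal.ramificationIdx_eq_one_iff]
  have := (NumberField.not_dvd_discr_iff_forall_mem (K := F) (𝒪 := 𝓞 F) (p := p)
    (Nat.prime_iff_prime_int.1 hp)).1 h
  refine this (P.under (𝓞 F)) inferInstance ?_
  simpa [Ideal.mem_comap] using hpP

lemma kw_tame_index_nf (hcomm : ∀ σ τ : Gal(L/ℚ), σ * τ = τ * σ)
    (P : Ideal (𝓞 L)) [P.IsPrime] (hP : P ≠ ⊥) {p : ℕ} (hp : p.Prime) (hpP : (p : 𝓞 L) ∈ P) :
    ((P ^ 2).inertia Gal(L/ℚ)).relIndex (P.inertia Gal(L/ℚ)) ≤ p - 1 := by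
  have : P.IsMaximal := Ideal.IsPrime.isMaximal inferInstance hP
  have : Finite (𝓞 L ⧸ P) := kw_finite_quot _ hP
  obtain ⟨φ, hφ⟩ := IsArithFrobAt.exists_of_isInvariant ℤ Gal(L/ℚ) P
  have hcard : Nat.card (ℤ ⧸ P.under ℤ) = p := by
    have hu : P.under ℤ = Ideal.span {(p : ℤ)} := by
      symm
      refine Ideal.IsMaximal.eq_of_le ?_ (Ideal.IsPrime.ne_top inferInstance) ?_
      · exact PrincipalIdealRing.isMaximal_of_irreducible (Nat.prime_iff_prime_int.1 hp).irreducible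
      · rw [Ideal.span_singleton_le_iff_mem]
        simpa [Ideal.mem_comap] using hpP
    rw [hu, Nat.card_congr (Int.quotientSpanNatEquivZMod p).toEquiv]
    exact Nat.card_zmod p
  refine kw_tame_index hP hp.one_lt φ ?_ (fun σ _ => hcomm σ φ)
  intro x
  have := hφ x
  rw [hcard] at this
  exact this

/-- wild inertia elements of order prime to p are trivial -/
lemma kw_wild_trivial_nf (P : Ideal (𝓞 L)) [P.IsPrime] (hP : P ≠ ⊥) {p : ℕ} (hp : p.Prime)
    (hpP : (p : 𝓞 L) ∈ P) {σ : Gal(L/ℚ)} (hσ : σ ∈ (P ^ 2).inertia Gal(L/ℚ)) {n : ℕ}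
    (hn : n.Coprime p) (h : σ ^ n = 1) : σ = 1 := by
  have : P.IsMaximal := Ideal.IsPrime.isMaximal inferInstance hP
  have : FaithfulSMul Gal(L/ℚ) (𝓞 L) := IsGaloisGroup.faithful ℤ
  refine kw_wild_trivial hσ ?_ h
  intro hnP
  apply Ideal.IsPrime.ne_top (I := P) inferInstance
  rw [Ideal.eq_top_iff_one]
  have hb := (Int.isCoprime_iff_gcd_eq_one (m := (n : ℤ)) (n := p)).2 (by simpa using hn)
  obtain ⟨u, v, huv⟩ := hb
  have : (1 : 𝓞 L) = u * n + v * p := by exact_mod_cast huv.symm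
  rw [this]
  exact Ideal.add_mem _ (Ideal.mul_mem_left _ _ hnP) (Ideal.mul_mem_left _ _ hpP)

/-- abelian: the inertia group depends only on the prime below -/
lemma kw_inertia_eq (hcomm : ∀ σ τ : Gal(L/ℚ), σ * τ = τ * σ)
    (P Q : Ideal (𝓞 L)) [P.IsPrime] [Q.IsPrime] (hP : P ≠ ⊥) (hQ : Q ≠ ⊥) {p : ℕ} (hp : p.Prime)
    (hpP : (p : 𝓞 L) ∈ P) (hpQ : (p : 𝓞 L) ∈ Q) : P.inertia Gal(L/ℚ) ≤ Q.inertia Gal(L/ℚ) := by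
  have hu : ∀ P : Ideal (𝓞 L), P.IsPrime → (p : 𝓞 L) ∈ P → P.under ℤ = Ideal.span {(p : ℤ)} := by
    intro P hP hpP
    symm
    refine Ideal.IsMaximal.eq_of_le ?_ (Ideal.IsPrime.ne_top inferInstance) ?_
    · exact PrincipalIdealRing.isMaximal_of_irreducible (Nat.prime_iff_prime_int.1 hp).irreducible
    · rw [Ideal.span_singleton_le_iff_mem]
      simpa [Ideal.mem_comap] using hpP
  obtain ⟨g, hg⟩ := Algebra.IsInvariant.exists_smul_of_under_eq ℤ (𝓞 L) Gal(L/ℚ) P Q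
    ((hu P inferInstance hpP).trans (hu Q inferInstance hpQ).symm)
  intro σ hσ x
  have h1 := hσ (g⁻¹ • x)
  have h2 : g • (σ • g⁻¹ • x - g⁻¹ • x) ∈ Q := by
    rw [hg]; exact Ideal.smul_mem_pointwise_smul g _ P h1
  rw [smul_sub, smul_inv_smul, smul_smul, ← hcomm σ g, ← smul_smul, smul_inv_smul] at h2
  exact h2

end nf

open NumberField

section wval
variable {S : Type*} [CommRing S] [IsDedekindDomain S]

/-- `P`-adic order -/
noncomputable def kwV (P : Ideal S) (x : S) : ℕ∞ := emultiplicity P (Ideal.span {x})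

lemma kwV_ge {P : Ideal S} {k : ℕ} {x : S} : (k : ℕ∞) ≤ kwV P x ↔ x ∈ P ^ k := by
  rw [kwV, ← pow_dvd_iff_le_emultiplicity, Ideal.dvd_span_singleton]

lemma kwV_mul {P : Ideal S} [P.IsPrime] (hP : P ≠ ⊥) (x y : S) :
    kwV P (x * y) = kwV P x + kwV P y := by
  rw [kwV, ← Ideal.span_singleton_mul_span_singleton,
    emultiplicity_mul (Ideal.prime_of_isPrime hP inferInstance)]; rfl

lemma kwV_pow {P : Ideal S} [P.IsPrime] (hP : P ≠ ⊥) (x : S) (n : ℕ) :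
    kwV P (x ^ n) = n * kwV P x := by
  rw [kwV, ← Ideal.span_singleton_pow,
    emultiplicity_pow (Ideal.prime_of_isPrime hP inferInstance)]; rfl

lemma kwV_eq {P : Ideal S} {k : ℕ} {x : S} (h1 : x ∈ P ^ k) (h2 : x ∉ P ^ (k+1)) :
    kwV P x = k := by
  rw [← kwV_ge] at h1 h2
  refine le_antisymm ?_ h1
  rw [not_le] at h2
  push_cast at h2
  exact Order.le_of_lt_add_one h2

lemma kwV_ne_top {P : Ideal S} [P.IsPrime] (hP : P ≠ ⊥) {x : S} (hx : x ≠ 0) : kwV P x ≠ ⊤ := by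
  rw [kwV, ← finiteMultiplicity_iff_emultiplicity_ne_top]
  refine FiniteMultiplicity.of_prime_left (Ideal.prime_of_isPrime hP inferInstance) ?_
  simpa using hx

lemma kwV_zero {P : Ideal S} : kwV P (0 : S) = ⊤ := by
  simp [kwV]

lemma kwV_prod {P : Ideal S} [P.IsPrime] (hP : P ≠ ⊥) {ι : Type*} (s : Finset ι) (t : ι → S) :
    kwV P (∏ i ∈ s, t i) = ∑ i ∈ s, kwV P (t i) := by
  classical
  induction s using Finset.induction_on with
  | empty =>
    simp only [Finset.prod_empty, Finset.sum_empty]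
    refine kwV_eq (k := 0) (by simp) ?_
    have := Ideal.IsPrime.ne_top (I := P) inferInstance
    rw [Ne, Ideal.eq_top_iff_one] at this
    simpa using this
  | insert i s hi ih => rw [Finset.prod_insert hi, kwV_mul hP, ih, Finset.sum_insert hi]

lemma kwV_distinct {P : Ideal S} {ι : Type*} (s : Finset ι) (t : ι → S)
    (hd : ∀ i ∈ s, ∀ j ∈ s, i ≠ j → kwV P (t i) = kwV P (t j) → kwV P (t i) = ⊤)
    {m : ℕ} (hm : ∑ i ∈ s, t i ∈ P ^ m) : ∀ i ∈ s, t i ∈ P ^ m := by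
  classical
  by_contra hcon
  push Not at hcon
  obtain ⟨i₁, hi₁, h1⟩ := hcon
  obtain ⟨i, hi, hmin⟩ := Finset.exists_min_image s (fun i => kwV P (t i)) ⟨i₁, hi₁⟩
  have hlt : kwV P (t i) < m := by
    refine lt_of_le_of_lt (hmin i₁ hi₁) ?_
    rw [← not_le, kwV_ge]; exact h1
  obtain ⟨k, hk⟩ := ENat.ne_top_iff_exists.1 (ne_top_of_lt hlt)
  rw [← hk] at hlt
  have hkm : k + 1 ≤ m := by exact_mod_cast hlt
  have h2 : t i ∈ P ^ (k + 1) := by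
    have : t i = ∑ i ∈ s, t i - ∑ j ∈ s.erase i, t j := by
      rw [← Finset.add_sum_erase s t hi]; ring
    rw [this]
    refine Ideal.sub_mem _ (Ideal.pow_le_pow_right hkm hm) (Ideal.sum_mem _ ?_)
    intro j hj
    rw [← kwV_ge]
    obtain ⟨hji, hj⟩ := Finset.mem_erase.1 hj
    have h3 : kwV P (t i) < kwV P (t j) := by
      refine lt_of_le_of_ne (hmin j hj) ?_
      intro he
      have := hd i hi j hj (Ne.symm hji) he
      rw [← hk] at this
      exact ENat.natCast_ne_top k this
    rw [← hk] at h3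
    push_cast
    exact Order.add_one_le_of_lt h3
  rw [← kwV_ge, ← hk] at h2
  have : k + 1 ≤ k := by exact_mod_cast h2
  omega

end wval

open NumberField Polynomial

section totram
variable {M : Type*} [Field M] [NumberField M] [IsGalois ℚ M]

lemma kw_under_eq (P : Ideal (𝓞 M)) [P.IsPrime] {p : ℕ} (hp : p.Prime) (hpP : (p : 𝓞 M) ∈ P) :
    P.under ℤ = Ideal.span {(p : ℤ)} := by
  symm
  refine Ideal.IsMaximal.eq_of_le ?_ (Ideal.IsPrime.ne_top inferInstance) ?_
  · exact PrincipalIdealRing.isMaximal_of_irreducible (Nat.prime_iff_prime_int.1 hp).irreducible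
  · rw [Ideal.span_singleton_le_iff_mem]
    simpa [Ideal.mem_comap] using hpP

lemma kw_int_mem (P : Ideal (𝓞 M)) [P.IsPrime] {p : ℕ} (hp : p.Prime) (hpP : (p : 𝓞 M) ∈ P)
    (d : ℤ) : (d : 𝓞 M) ∈ P ↔ (p : ℤ) ∣ d := by
  rw [← Ideal.mem_span_singleton, ← kw_under_eq P hp hpP, Ideal.mem_comap]
  simp

lemma kw_tr1 (P : Ideal (𝓞 M)) [P.IsPrime] (hP : P ≠ ⊥) {p : ℕ} (hp : p.Prime)
    (hpP : (p : 𝓞 M) ∈ P) (hI : P.inertia Gal(M/ℚ) = ⊤) :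
    kwV P (p : 𝓞 M) = Nat.card Gal(M/ℚ) := by
  have h1 := kw_card_inertia_int P hP
  rw [hI, Subgroup.card_top] at h1
  have hmap : Ideal.map (algebraMap ℤ (𝓞 M)) (Ideal.span {(p : ℤ)}) = Ideal.span {(p : 𝓞 M)} := by
    rw [Ideal.map_span]; simp
  have hp0 : (p : 𝓞 M) ≠ 0 := by exact_mod_cast hp.ne_zero
  have : P.LiesOver (Ideal.span {(p : ℤ)}) := ⟨(kw_under_eq P hp hpP).symm⟩
  rw [Ideal.IsDedekindDomain.ramificationIdx_eq_multiplicity (Ideal.span {(p : ℤ)}) P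
    (by rw [hmap]; simpa using hp0), hmap] at h1
  rw [h1, kwV]
  refine FiniteMultiplicity.emultiplicity_eq_multiplicity ?_
  refine FiniteMultiplicity.of_prime_left (Ideal.prime_of_isPrime hP inferInstance) ?_
  simpa using hp0

lemma kw_tr2 (P : Ideal (𝓞 M)) [P.IsPrime] (hP : P ≠ ⊥) {p : ℕ} (hp : p.Prime)
    (hpP : (p : 𝓞 M) ∈ P) (hI : P.inertia Gal(M/ℚ) = ⊤) (d : ℤ) :
    kwV P (d : 𝓞 M) = Nat.card Gal(M/ℚ) * emultiplicity (p : ℤ) d := by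
  by_cases hd : d = 0
  · subst hd
    have : (Nat.card Gal(M/ℚ) : ℕ∞) ≠ 0 := by exact_mod_cast Nat.card_pos.ne'
    simp [kwV_zero, this]
  have hfin : FiniteMultiplicity (p : ℤ) d :=
    FiniteMultiplicity.of_prime_left (Nat.prime_iff_prime_int.1 hp) hd
  obtain ⟨c, hc, hnd⟩ := hfin.exists_eq_pow_mul_and_not_dvd
  rw [hfin.emultiplicity_eq_multiplicity]
  set a := multiplicity (p : ℤ) d
  have h0 : kwV P (c : 𝓞 M) = 0 := by
    refine kwV_eq (k := 0) (by simp) ?_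
    rw [zero_add, pow_one, kw_int_mem P hp hpP]; exact hnd
  rw [hc]
  push_cast
  rw [kwV_mul hP, kwV_pow hP, kw_tr1 P hP hp hpP hI, h0, add_zero, mul_comm]

lemma kw_tr3 (P : Ideal (𝓞 M)) [P.IsPrime] (hP : P ≠ ⊥) (hI : P.inertia Gal(M/ℚ) = ⊤)
    (σ : Gal(M/ℚ)) (x : 𝓞 M) : kwV P (σ • x) = kwV P x := by
  have key : ∀ (σ : Gal(M/ℚ)) (x : 𝓞 M) (k : ℕ), x ∈ P ^ k → σ • x ∈ P ^ k := by
    intro σ x k hx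
    have h1 : P.map (MulSemiringAction.toRingHom Gal(M/ℚ) (𝓞 M) σ) ≤ P := by
      rw [Ideal.map_le_iff_le_comap]
      intro y hy
      exact kw_smul_mem_of_inertia (hI ▸ Subgroup.mem_top σ) hy
    have h2 := Ideal.mem_map_of_mem (MulSemiringAction.toRingHom Gal(M/ℚ) (𝓞 M) σ) hx
    rw [Ideal.map_pow] at h2
    exact Ideal.pow_right_mono h1 k h2
  have hle : ∀ (σ : Gal(M/ℚ)) (x : 𝓞 M), kwV P x ≤ kwV P (σ • x) := by
    intro σ x
    refine ENat.forall_natCast_le_iff_le.1 ?_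
    intro k hk
    rw [kwV_ge] at hk ⊢
    exact key σ x k hk
  refine le_antisymm ?_ (hle σ x)
  have := hle σ⁻¹ (σ • x)
  rwa [inv_smul_smul] at this

/-- independence of terms `d_i x^i` -/
lemma kw_tr_terms (P : Ideal (𝓞 M)) [P.IsPrime] (hP : P ≠ ⊥) {p : ℕ} (hp : p.Prime)
    (hpP : (p : 𝓞 M) ∈ P) (hI : P.inertia Gal(M/ℚ) = ⊤) {x : 𝓞 M} {c N : ℕ} (hc : 0 < c)
    (hx : kwV P x = c) (hN : c * N = Nat.card Gal(M/ℚ)) (d : ℕ → ℤ) {m : ℕ}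
    (h : ∑ i ∈ Finset.range N, (d i : 𝓞 M) * x ^ i ∈ P ^ m) :
    ∀ i < N, (d i : 𝓞 M) * x ^ i ∈ P ^ m := by
  have hv : ∀ i, kwV P ((d i : 𝓞 M) * x ^ i) =
      Nat.card Gal(M/ℚ) * emultiplicity (p : ℤ) (d i) + i * c := by
    intro i
    rw [kwV_mul hP, kwV_pow hP, hx, kw_tr2 P hP hp hpP hI]
  have := kwV_distinct (P := P) (Finset.range N) (fun i => (d i : 𝓞 M) * x ^ i) ?_ h
  · intro i hi; exact this i (Finset.mem_range.2 hi)
  intro i hi j hj hij heq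
  simp only [hv] at heq ⊢
  have hi := Finset.mem_range.1 hi
  have hj := Finset.mem_range.1 hj
  have hn : (Nat.card Gal(M/ℚ) : ℕ∞) ≠ 0 := by exact_mod_cast Nat.card_pos.ne'
  by_cases h1 : emultiplicity (p : ℤ) (d i) = ⊤
  · rw [h1]; simp [hn]
  exfalso
  by_cases h2 : emultiplicity (p : ℤ) (d j) = ⊤
  · rw [h2, ENat.mul_top hn, top_add] at heq
    obtain ⟨a, ha⟩ := ENat.ne_top_iff_exists.1 h1
    rw [← ha] at heq
    exact ENat.natCast_ne_top (Nat.card Gal(M/ℚ) * a + i * c) (by exact_mod_cast heq)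
  obtain ⟨a, ha⟩ := ENat.ne_top_iff_exists.1 h1
  obtain ⟨b, hb⟩ := ENat.ne_top_iff_exists.1 h2
  rw [← ha, ← hb, ← hN] at heq
  have e : c * N * a + i * c = c * N * b + j * c := by exact_mod_cast heq
  have e2 : N * a + i = N * b + j := by
    apply Nat.eq_of_mul_eq_mul_left hc
    linarith
  have e3 := congrArg (· % N) e2
  simp only [Nat.mul_add_mod, Nat.mod_eq_of_lt hi, Nat.mod_eq_of_lt hj] at e3
  exact hij e3
end totram

open NumberField Polynomial

section totram2
variable {M : Type*} [Field M] [NumberField M] [IsGalois ℚ M]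

lemma kw_tr4 (P : Ideal (𝓞 M)) [P.IsPrime] (hP : P ≠ ⊥) {p : ℕ} (hp : p.Prime)
    (hpP : (p : 𝓞 M) ∈ P) (hI : P.inertia Gal(M/ℚ) = ⊤) {π : 𝓞 M} (hπ : kwV P π = 1) (x : 𝓞 M) :
    ∃ s : ℤ, ¬ (p : ℤ) ∣ s ∧ ∃ g : ℤ[X], (s : 𝓞 M) * x = aeval π g := by
  set n := Nat.card Gal(M/ℚ) with hn
  have hpos : 0 < n := Nat.card_pos
  have hπ0 : π ≠ 0 := by
    rintro rfl
    rw [kwV_zero] at hπ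
    exact absurd hπ (by simp)
  have hli : LinearIndependent ℤ (fun i : Fin n => π ^ (i : ℕ)) := by
    rw [Fintype.linearIndependent_iff]
    intro g hg i
    let d : ℕ → ℤ := fun j => if h : j < n then g ⟨j, h⟩ else 0
    have hd : ∀ i : Fin n, d i = g i := fun i => by simp [d]
    have hsum : ∑ i ∈ Finset.range n, (d i : 𝓞 M) * π ^ i = 0 := by
      rw [Finset.sum_range, ← hg]
      refine Finset.sum_congr rfl fun i _ => ?_
      rw [hd, zsmul_eq_mul]
    have hall : ∀ m, (d i : 𝓞 M) * π ^ (i : ℕ) ∈ P ^ m := by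
      intro m
      refine kw_tr_terms P hP hp hpP hI one_pos (by simpa using hπ) (one_mul n) d ?_ i i.2
      rw [hsum]; exact zero_mem _
    have h0 : (d i : 𝓞 M) * π ^ (i : ℕ) = 0 := by
      by_contra hne
      obtain ⟨k, hk⟩ := ENat.ne_top_iff_exists.1 (kwV_ne_top hP hne)
      have := hall (k+1)
      rw [← kwV_ge, ← hk] at this
      have : k + 1 ≤ k := by exact_mod_cast this
      omega
    have := (mul_eq_zero.1 h0).resolve_right (pow_ne_zero _ hπ0)
    rw [← hd]; exact_mod_cast this
  have hli2 : LinearIndependent ℚ (fun i : Fin n => (π : M) ^ (i : ℕ)) := by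
    rw [← LinearIndependent.iff_fractionRing ℤ ℚ]
    have := hli.map' ((Algebra.linearMap (𝓞 M) M).restrictScalars ℤ)
      (LinearMap.ker_eq_bot.2 RingOfIntegers.coe_injective)
    exact this
  have hspan := hli2.span_eq_top_of_card_eq_finrank' (by
    rw [Fintype.card_fin, hn]; exact IsGaloisGroup.card_eq_finrank Gal(M/ℚ) ℚ M)
  have hx : (x : M) ∈ Submodule.span ℚ (Set.range fun i : Fin n => (π : M) ^ (i : ℕ)) := by
    rw [hspan]; trivial
  obtain ⟨q, hq⟩ := (Submodule.mem_span_range_iff_exists_fun ℚ).1 hx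
  obtain ⟨b, hb⟩ := IsLocalization.exist_integer_multiples_of_finite (nonZeroDivisors ℤ) q
  choose e he using hb
  have hb0 : (b : ℤ) ≠ 0 := nonZeroDivisors.ne_zero b.2
  have hfin : FiniteMultiplicity (p : ℤ) (b : ℤ) :=
    FiniteMultiplicity.of_prime_left (Nat.prime_iff_prime_int.1 hp) hb0
  obtain ⟨s, hs, hsnd⟩ := hfin.exists_eq_pow_mul_and_not_dvd
  set a := multiplicity (p : ℤ) (b : ℤ)
  let d : ℕ → ℤ := fun j => if h : j < n then e ⟨j, h⟩ else 0
  have hd : ∀ i : Fin n, d i = e i := fun i => by simp [d]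
  have hsum : ∑ i ∈ Finset.range n, (d i : 𝓞 M) * π ^ i = ((b : ℤ) : 𝓞 M) * x := by
    apply RingOfIntegers.coe_injective
    rw [Finset.sum_range]
    change algebraMap (𝓞 M) M _ = algebraMap (𝓞 M) M _
    simp only [map_sum, map_mul, map_pow, map_intCast]
    rw [show algebraMap (𝓞 M) M x = _ from hq.symm, Finset.mul_sum]
    refine Finset.sum_congr rfl fun i _ => ?_
    rw [hd]
    have h1 := congrArg (algebraMap ℚ M) (he i)
    rw [Algebra.smul_def, eq_intCast, map_intCast, map_mul, eq_intCast, map_intCast] at h1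
    rw [h1, Algebra.smul_def]
    ring
  have hdvd : ∀ i < n, ∃ c, d i = (p : ℤ) ^ a * c := by
    intro i hi
    have hmem : ∑ i ∈ Finset.range n, (d i : 𝓞 M) * π ^ i ∈ P ^ (n * a) := by
      rw [hsum]
      refine Ideal.mul_mem_right _ _ ?_
      rw [← kwV_ge, kw_tr2 P hP hp hpP hI, hfin.emultiplicity_eq_multiplicity]
      push_cast
      exact le_rfl
    have h1 := kw_tr_terms P hP hp hpP hI one_pos (by simpa using hπ) (one_mul n) d hmem i hi
    rw [← kwV_ge, kwV_mul hP, kwV_pow hP, hπ, kw_tr2 P hP hp hpP hI] at h1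
    have : (p : ℤ) ^ a ∣ d i := by
      rw [pow_dvd_iff_le_emultiplicity]
      by_cases htop : emultiplicity (p : ℤ) (d i) = ⊤
      · rw [htop]; exact le_top
      obtain ⟨c, hc⟩ := ENat.ne_top_iff_exists.1 htop
      rw [← hc] at h1 ⊢
      have h2 : n * a ≤ n * c + i * 1 := by exact_mod_cast h1
      have h3 : a ≤ c := by
        by_contra hlt
        push Not at hlt
        have : n * (c + 1) ≤ n * a := Nat.mul_le_mul_left _ hlt
        nlinarith
      exact_mod_cast h3
    exact this
  choose! c hc using hdvd
  refine ⟨s, hsnd, ∑ i ∈ Finset.range n, C (c i) * X ^ i, ?_⟩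
  have hp0 : ((p : ℤ) ^ a : 𝓞 M) ≠ 0 := by
    exact_mod_cast pow_ne_zero a hp.ne_zero
  apply mul_left_cancel₀ hp0
  rw [← mul_assoc]
  have h1 : ((p : ℤ) ^ a : 𝓞 M) * s = ((b : ℤ) : 𝓞 M) := by rw [hs]; push_cast; ring
  rw [h1, ← hsum, map_sum, Finset.mul_sum]
  refine Finset.sum_congr rfl fun i hi => ?_
  rw [hc i (Finset.mem_range.1 hi)]
  simp
  ring

lemma kw_tr5 (P : Ideal (𝓞 M)) [P.IsPrime] (hP : P ≠ ⊥) {p : ℕ} (hp : p.Prime)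
    (hpP : (p : 𝓞 M) ∈ P) (hI : P.inertia Gal(M/ℚ) = ⊤) : Nat.card (𝓞 M ⧸ P) ≤ p := by
  have : P.IsMaximal := Ideal.IsPrime.isMaximal inferInstance hP
  have : Finite (𝓞 M ⧸ P) := kw_finite_quot _ hP
  obtain ⟨φ, hφ⟩ := IsArithFrobAt.exists_of_isInvariant ℤ Gal(M/ℚ) P
  have hcard : Nat.card (ℤ ⧸ P.under ℤ) = p := by
    rw [kw_under_eq P hp hpP, Nat.card_congr (Int.quotientSpanNatEquivZMod p).toEquiv]
    exact Nat.card_zmod p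
  have hx : ∀ x : 𝓞 M, x ^ p - x ∈ P := by
    intro x
    have h1 := hφ x
    rw [hcard] at h1
    have h2 : φ • x - x ∈ P := (hI ▸ Subgroup.mem_top φ : φ ∈ P.inertia Gal(M/ℚ)) x
    have := Ideal.sub_mem _ h2 h1
    convert this using 1
    change _ = (φ • x - x) - (φ • x - x ^ p)
    ring
  let := Ideal.Quotient.field P
  let := Fintype.ofFinite (𝓞 M ⧸ P)
  classical
  have hne : (X ^ p - X : (𝓞 M ⧸ P)[X]) ≠ 0 := FiniteField.X_pow_card_sub_X_ne_zero _ hp.one_lt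
  have hsub : (Finset.univ : Finset (𝓞 M ⧸ P)) ⊆ (X ^ p - X : (𝓞 M ⧸ P)[X]).roots.toFinset := by
    intro y _
    obtain ⟨x, rfl⟩ := Ideal.Quotient.mk_surjective y
    rw [Multiset.mem_toFinset, mem_roots hne]
    simp only [IsRoot.def, eval_sub, eval_pow, eval_X]
    rw [← map_pow, ← map_sub, Ideal.Quotient.eq_zero_iff_mem]
    exact hx x
  rw [Nat.card_eq_fintype_card, ← Finset.card_univ]
  refine (Finset.card_le_card hsub).trans ((Multiset.toFinset_card_le _).trans
    ((card_roots' _).trans ?_))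
  rw [FiniteField.X_pow_card_sub_X_natDegree_eq _ hp.one_lt]

end totram2

open NumberField Polynomial

section totram3
variable {M : Type*} [Field M] [NumberField M] [IsGalois ℚ M]

lemma kw_prod_range_smul {G S : Type*} [Group G] [CommRing S] [MulSemiringAction G S] (h : G) (p : ℕ)
    (hh : h ^ p = 1) (y : S) :
    h • ∏ j ∈ Finset.range p, h ^ j • y = ∏ j ∈ Finset.range p, h ^ j • y := by
  rcases p with _ | p
  · simp
  rw [Finset.smul_prod', Finset.prod_range_succ, Finset.prod_range_succ', smul_smul, ← pow_succ', hh]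
  simp only [smul_smul, ← pow_succ', pow_zero]

lemma kw_w1 (P : Ideal (𝓞 M)) [P.IsPrime] (hP : P ≠ ⊥) {p : ℕ} (hp : p.Prime)
    (hpP : (p : 𝓞 M) ∈ P) (hI : P.inertia Gal(M/ℚ) = ⊤) (hW : (P ^ 2).inertia Gal(M/ℚ) = ⊤)
    {π : 𝓞 M} (hπ : kwV P π = 1)
    (hcomm : ∀ σ τ : Gal(M/ℚ), σ * τ = τ * σ) (h τ : Gal(M/ℚ)) (hh : orderOf h = p)
    (hτ : τ • π - π ∈ P ^ 3) :
    (∏ j ∈ Finset.range p, h ^ j • π) - τ • (∏ j ∈ Finset.range p, h ^ j • π) ∈ P ^ (2 * p + 1) := by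
  classical
  set ϖ := ∏ j ∈ Finset.range p, h ^ j • π with hϖ
  have hhϖ : ∀ j : ℕ, h ^ j • ϖ = ϖ := by
    intro j
    induction j with
    | zero => simp
    | succ j ih => rw [pow_succ, mul_smul, hϖ, kw_prod_range_smul h p (hh ▸ pow_orderOf_eq_one h), ← hϖ, ih]
  obtain ⟨s, hs, g, hg⟩ := kw_tr4 P hP hp hpP hI hπ ϖ
  -- faithfulness of `π`
  have hfaith : ∀ σ : Gal(M/ℚ), σ • π = π → σ = 1 := by
    intro σ hσ
    have : FaithfulSMul Gal(M/ℚ) (𝓞 M) := IsGaloisGroup.faithful ℤ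
    apply FaithfulSMul.eq_of_smul_eq_smul (α := 𝓞 M)
    intro x
    obtain ⟨t, ht, q, hq⟩ := kw_tr4 P hP hp hpP hI hπ x
    have ht0 : (t : 𝓞 M) ≠ 0 := by
      intro h0
      apply ht
      have : t = 0 := by exact_mod_cast h0
      rw [this]; exact dvd_zero _
    apply mul_left_cancel₀ ht0
    have h1 := congrArg (fun y => σ • y) hq
    simp only [smul_mul'] at h1
    have h2 : σ • (t : 𝓞 M) = t := by
      have := map_intCast (MulSemiringAction.toRingHom Gal(M/ℚ) (𝓞 M) σ) t
      exact this
    have h3 : σ • aeval π q = aeval (σ • π) q := by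
      have := Polynomial.aeval_algHom_apply (MulSemiringAction.toAlgHom ℤ (𝓞 M) σ) π q
      exact this.symm
    rw [h2, h3, hσ, ← hq] at h1
    rw [h1, one_smul]
  let G₀ : (𝓞 M)[X] := g.map (algebraMap ℤ (𝓞 M)) - C ((s : 𝓞 M) * ϖ)
  have hev : ∀ y, eval y (g.map (algebraMap ℤ (𝓞 M))) = aeval y g := by
    intro y; rw [eval_map_algebraMap]
  have hroot : ∀ j, eval (h ^ j • π) G₀ = 0 := by
    intro j
    simp only [G₀, eval_sub, eval_C, hev]
    have h3 : (h ^ j) • aeval π g = aeval (h ^ j • π) g := by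
      have := Polynomial.aeval_algHom_apply (MulSemiringAction.toAlgHom ℤ (𝓞 M) (h ^ j)) π g
      exact this.symm
    have h2 : (h ^ j) • (s : 𝓞 M) = s :=
      map_intCast (MulSemiringAction.toRingHom Gal(M/ℚ) (𝓞 M) (h ^ j)) s
    rw [← h3, ← hg, smul_mul', h2, hhϖ, sub_self]
  have hdvd : ∏ j ∈ Finset.range p, (X - C (h ^ j • π)) ∣ G₀ := by
    by_cases h0 : G₀ = 0
    · rw [h0]; exact dvd_zero _
    have h1 := (Multiset.prod_X_sub_C_dvd_iff_le_roots h0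
      ((Finset.range p).val.map (fun j => h ^ j • π))).2 ?_
    · rw [Multiset.map_map] at h1; exact h1
    · rw [Multiset.le_iff_subset]
      · intro y hy
        obtain ⟨j, _, rfl⟩ := Multiset.mem_map.1 hy
        rw [mem_roots h0]; exact hroot j
      · refine Multiset.Nodup.map_on ?_ (Finset.range p).nodup
        intro i hi j hj hij
        have hi : i < p := Finset.mem_range.1 hi
        have hj : j < p := Finset.mem_range.1 hj
        have : (h ^ j)⁻¹ * h ^ i = 1 := by
          apply hfaith; rw [mul_smul, hij, inv_smul_smul]
        have e : h ^ i = h ^ j := (inv_mul_eq_one.1 this).symm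
        exact pow_injOn_Iio_orderOf (by simpa [hh] using hi) (by simpa [hh] using hj) e
  obtain ⟨q, hq⟩ := hdvd
  have hmap := congrArg (fun F => eval π (F.map (MulSemiringAction.toRingHom Gal(M/ℚ) (𝓞 M) τ))) hq
  simp only [Polynomial.map_mul, eval_mul, Polynomial.map_prod, eval_prod, Polynomial.map_sub,
    Polynomial.map_X, Polynomial.map_C, eval_sub, eval_X, eval_C, G₀, Polynomial.map_map] at hmap
  have e1 : (MulSemiringAction.toRingHom Gal(M/ℚ) (𝓞 M) τ).comp (algebraMap ℤ (𝓞 M)) =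
    algebraMap ℤ (𝓞 M) := RingHom.ext_int _ _
  rw [e1, hev, ← hg, map_mul, map_intCast] at hmap
  have e2 : ∀ y, MulSemiringAction.toRingHom Gal(M/ℚ) (𝓞 M) τ y = τ • y := fun y => rfl
  simp only [e2] at hmap
  rw [← mul_sub] at hmap
  have hs0 : kwV P (s : 𝓞 M) = 0 := by
    refine kwV_eq (k := 0) (by simp) ?_
    rw [zero_add, pow_one, kw_int_mem P hp hpP]; exact hs
  have hfin : (s : 𝓞 M) * (ϖ - τ • ϖ) ∈ P ^ (2 * p + 1) := by
    rw [hmap]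
    refine Ideal.mul_mem_right _ _ ?_
    obtain ⟨k, rfl⟩ : ∃ k, p = k + 1 := ⟨p - 1, by have := hp.pos; omega⟩
    rw [Finset.prod_range_succ']
    have : P ^ (2 * (k + 1) + 1) = (P ^ 2) ^ k * P ^ 3 := by
      rw [← pow_mul, ← pow_add, show 2 * (k + 1) + 1 = 2 * k + 3 by ring]
    rw [this]
    refine Ideal.mul_mem_mul ?_ ?_
    · have := Ideal.prod_mem_prod (s := Finset.range k) (I := fun _ => P ^ 2)
        (x := fun j => π - τ • h ^ (j + 1) • π) ?_
      · simpa using this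
      · intro j _
        rw [smul_smul, ← neg_sub]
        refine neg_mem ?_
        exact (hW ▸ Subgroup.mem_top (τ * h ^ (j+1)) : τ * h ^ (j+1) ∈ (P ^ 2).inertia Gal(M/ℚ)) π
    · rw [pow_zero, one_smul, ← neg_sub]; exact neg_mem hτ
  rw [← kwV_ge, kwV_mul hP, hs0, zero_add] at hfin
  rw [← kwV_ge]; exact hfin

lemma kw_w2 (P : Ideal (𝓞 M)) [P.IsPrime] (hP : P ≠ ⊥) {p : ℕ} (hp : p.Prime)
    (hpP : (p : 𝓞 M) ∈ P) (hI : P.inertia Gal(M/ℚ) = ⊤)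
    (hcard : Nat.card Gal(M/ℚ) = p ^ 2) (hcomm : ∀ σ τ : Gal(M/ℚ), σ * τ = τ * σ)
    (h τ : Gal(M/ℚ)) (hgen : ∀ x : 𝓞 M, h • x = x → τ • x = x → ∀ σ : Gal(M/ℚ), σ • x = x)
    (hτ : τ ^ p = 1) {y : 𝓞 M} (hy : h • y = y) (hmem : y ∈ P ^ (2 * p + 1)) : y ∈ P ^ (3 * p) := by
  have hz : ∀ σ : Gal(M/ℚ), σ • (∏ j ∈ Finset.range p, τ ^ j • y) = ∏ j ∈ Finset.range p, τ ^ j • y := by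
    apply hgen
    · rw [Finset.smul_prod']
      refine Finset.prod_congr rfl fun j _ => ?_
      rw [smul_smul, hcomm, ← smul_smul, hy]
    · exact kw_prod_range_smul τ p hτ y
  obtain ⟨d, hd⟩ := Algebra.IsInvariant.isInvariant (A := ℤ) (G := Gal(M/ℚ)) _ hz
  have hv := congrArg (kwV P) hd
  rw [kwV_prod hP, Finset.sum_congr rfl (fun j _ => kw_tr3 P hP hI (τ ^ j) y), Finset.sum_const,
    Finset.card_range, eq_intCast, kw_tr2 P hP hp hpP hI, hcard, nsmul_eq_mul] at hv
  rw [← kwV_ge] at hmem ⊢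
  by_cases ht : kwV P y = ⊤
  · rw [ht]; exact le_top
  obtain ⟨b, hb⟩ := ENat.ne_top_iff_exists.1 ht
  rw [← hb] at hv hmem ⊢
  have hpos := hp.pos
  by_cases ht2 : emultiplicity (p : ℤ) d = ⊤
  · exfalso
    rw [ht2, ENat.mul_top (by exact_mod_cast pow_ne_zero 2 hp.ne_zero)] at hv
    exact ENat.natCast_ne_top (p * b) (by exact_mod_cast hv.symm)
  obtain ⟨a, ha⟩ := ENat.ne_top_iff_exists.1 ht2
  rw [← ha] at hv
  have e1 : p ^ 2 * a = p * b := by exact_mod_cast hv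
  have e2 : b = p * a := by
    apply Nat.eq_of_mul_eq_mul_left hpos; rw [← e1]; ring
  have e3 : 2 * p + 1 ≤ b := by exact_mod_cast hmem
  have e4 : 3 ≤ a := by
    by_contra hlt
    have : a ≤ 2 := by omega
    nlinarith
  have : 3 * p ≤ b := by nlinarith
  exact_mod_cast this

end totram3

open NumberField Polynomial

section totram4
variable {M : Type*} [Field M] [NumberField M] [IsGalois ℚ M]

/-- final numerical contradiction -/
lemma kw_w3 (P : Ideal (𝓞 M)) [P.IsPrime] (hP : P ≠ ⊥) {p : ℕ} (hp : p.Prime) (hp2 : 2 < p)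
    (hpP : (p : 𝓞 M) ∈ P) (hI : P.inertia Gal(M/ℚ) = ⊤)
    (hcard : Nat.card Gal(M/ℚ) = p ^ 2) (hcomm : ∀ σ τ : Gal(M/ℚ), σ * τ = τ * σ)
    (h τ : Gal(M/ℚ)) (hgen : ∀ x : 𝓞 M, h • x = x → τ • x = x → ∀ σ : Gal(M/ℚ), σ • x = x)
    (hτ : τ ^ p = 1) {ϖ : 𝓞 M} (hϖ : kwV P ϖ = p) (hy : h • ϖ = ϖ)
    (hmem : ∀ i, ϖ - τ ^ i • ϖ ∈ P ^ (3 * p)) : False := by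
  let F : (𝓞 M)[X] := ∏ i ∈ Finset.range p, (X - C (τ ^ i • ϖ))
  have hmon : F.Monic := monic_prod_of_monic _ _ (fun i _ => monic_X_sub_C _)
  have hdeg : F.natDegree = p := by
    simp only [F]
    rw [natDegree_prod_of_monic _ _ (fun i _ => monic_X_sub_C _)]
    simp
  have hF : ∀ σ : Gal(M/ℚ), σ • F = F := by
    have hall : ∀ (k : ℕ) (σ : Gal(M/ℚ)), σ • F.coeff k = F.coeff k := by
      intro k
      apply hgen
      · rw [← coeff_smul]
        congr 1
        simp only [F, Finset.smul_prod', smul_sub, smul_X, smul_C]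
        refine Finset.prod_congr rfl fun j _ => ?_
        rw [smul_smul, hcomm, ← smul_smul, hy]
      · rw [← coeff_smul]
        congr 1
        have := kw_prod_range_smul τ p hτ (X - C ϖ : (𝓞 M)[X])
        simpa only [F, Finset.smul_prod', smul_sub, smul_X, smul_C] using this
    intro σ
    ext k : 1
    rw [coeff_smul, hall]
  have hcoef : ∀ k, ∃ d : ℤ, (d : 𝓞 M) = F.coeff k := by
    intro k
    obtain ⟨d, hd⟩ := Algebra.IsInvariant.isInvariant (A := ℤ) (G := Gal(M/ℚ)) (F.coeff k)
      (fun σ => by rw [← coeff_smul, hF])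
    exact ⟨d, by simpa using hd⟩
  choose c hc using hcoef
  have hder : eval ϖ (derivative F) = ∑ i ∈ Finset.range p, (((c (i+1)) * (i + 1) : ℤ) : 𝓞 M) * ϖ ^ i := by
    rw [eval_eq_sum_range' (n := p)]
    · refine Finset.sum_congr rfl fun i _ => ?_
      rw [coeff_derivative, ← hc]
      push_cast
      ring
    · calc _ < F.natDegree := natDegree_derivative_lt (by rw [hdeg]; exact hp.ne_zero)
        _ = p := hdeg
  have hder2 : eval ϖ (derivative F) ∈ P ^ (3 * p * (p - 1)) := by
    obtain ⟨k, hk⟩ : ∃ k, p = k + 1 := ⟨p - 1, by have := hp.pos; omega⟩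
    have : F = (∏ i ∈ Finset.range k, (X - C (τ ^ (i+1) • ϖ))) * (X - C ϖ) := by
      simp only [F]
      rw [hk, Finset.prod_range_succ', pow_zero, one_smul]
    rw [this, derivative_mul]
    simp only [eval_add, eval_mul, eval_sub, eval_X, eval_C, sub_self, mul_zero, zero_add,
      derivative_sub, derivative_X, derivative_C, sub_zero, eval_one, mul_one, eval_prod]
    have h2 := Ideal.prod_mem_prod (s := Finset.range k) (I := fun _ => P ^ (3 * p))
        (x := fun j => ϖ - τ ^ (j + 1) • ϖ) (fun j _ => hmem (j+1))
    rw [Finset.prod_const, Finset.card_range, ← pow_mul] at h2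
    rw [show p - 1 = k by omega]
    exact h2
  rw [hder] at hder2
  have h3 := kw_tr_terms P hP hp hpP hI hp.pos hϖ (by rw [hcard]; ring)
    (fun i => (c (i+1)) * (i + 1)) hder2 (p - 1) (by have := hp.pos; omega)
  have hc1 : c (p - 1 + 1) = 1 := by
    rw [show p - 1 + 1 = p by have := hp.pos; omega]
    have h4 := hc p
    rw [← hdeg] at h4
    rw [show F.coeff F.natDegree = 1 from hmon] at h4
    rw [hdeg] at h4
    exact_mod_cast h4
  rw [hc1, ← kwV_ge, kwV_mul hP, kwV_pow hP, hϖ] at h3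
  have e : (((1 : ℤ) * (((p - 1 : ℕ) : ℤ) + 1) : ℤ) : 𝓞 M) = (p : 𝓞 M) := by
    have : ((p - 1 : ℕ) : ℤ) + 1 = p := by have := hp.pos; omega
    rw [this]; simp
  rw [e, kw_tr1 P hP hp hpP hI, hcard] at h3
  have h5 : 3 * p * (p - 1) ≤ p ^ 2 + (p - 1) * p := by exact_mod_cast h3
  obtain ⟨k, rfl⟩ : ∃ k, p = k + 1 := ⟨p - 1, by have := hp.pos; omega⟩
  simp only [Nat.add_sub_cancel] at h5
  nlinarith

theorem kw_W (P : Ideal (𝓞 M)) [P.IsPrime] (hP : P ≠ ⊥) {p : ℕ} (hp : p.Prime) (hp2 : 2 < p)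
    (hpP : (p : 𝓞 M) ∈ P) (hI : P.inertia Gal(M/ℚ) = ⊤)
    (hcard : Nat.card Gal(M/ℚ) = p ^ 2) (hcomm : ∀ σ τ : Gal(M/ℚ), σ * τ = τ * σ)
    (hexp : ∀ σ : Gal(M/ℚ), σ ^ p = 1) : False := by
  have hmax : P.IsMaximal := Ideal.IsPrime.isMaximal inferInstance hP
  have hfq : Finite (𝓞 M ⧸ P) := kw_finite_quot _ hP
  have hpfact : Fact p.Prime := ⟨hp⟩
  have hW : (P ^ 2).inertia Gal(M/ℚ) = ⊤ := by
    have h1 := kw_tame_index_nf hcomm P hP hp hpP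
    rw [hI, Subgroup.relIndex_top_right] at h1
    have h2 : ((P ^ 2).inertia Gal(M/ℚ)).index ∣ p ^ 2 := hcard ▸ Subgroup.index_dvd_card _
    obtain ⟨k, _, hk⟩ := (Nat.dvd_prime_pow hp).1 h2
    rcases k with _ | k
    · exact Subgroup.index_eq_one.1 (by simpa using hk)
    · exfalso
      have : p ∣ ((P ^ 2).inertia Gal(M/ℚ)).index := by rw [hk, pow_succ]; exact dvd_mul_left _ _
      have hne : ((P ^ 2).inertia Gal(M/ℚ)).index ≠ 0 := Subgroup.index_ne_zero_of_finite
      have := Nat.le_of_dvd (Nat.pos_of_ne_zero hne) this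
      have := hp.pos
      omega
  obtain ⟨π, hπ1, hπ2⟩ := Ideal.exists_mem_pow_notMem_pow_succ P hP (Ideal.IsPrime.ne_top') 1
  have hπ : kwV P π = 1 := by simpa using kwV_eq hπ1 hπ2
  have hpitwo : kwV P (π ^ 2) = 2 := by rw [kwV_pow hP, hπ]; norm_num
  have hπsq : π ^ 2 ∈ P ^ 2 := by rw [← kwV_ge, hpitwo]; norm_num
  have hπcu : π ^ 2 ∉ P ^ (2 + 1) := by
    rw [← kwV_ge, hpitwo]; norm_num
  -- pigeonhole
  have hrep : ∀ σ : Gal(M/ℚ), ∃ a : 𝓞 M, σ • π - π - a * π ^ 2 ∈ P ^ 3 := by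
    intro σ
    have hσ : σ • π - π ∈ P ^ 2 :=
      (hW ▸ Subgroup.mem_top σ : σ ∈ (P ^ 2).inertia Gal(M/ℚ)) π
    obtain ⟨d, e, he, hde⟩ := Ideal.exists_mul_add_mem_pow_succ hP (i := 2) (π ^ 2) (σ • π - π)
      hπsq hπcu hσ
    refine ⟨d, ?_⟩
    rw [← hde]
    convert he using 1
    ring
  choose a ha using hrep
  obtain ⟨τ, hτ1, hτ⟩ : ∃ τ : Gal(M/ℚ), τ ≠ 1 ∧ τ • π - π ∈ P ^ 3 := by
    have hnot : ¬ Function.Injective (fun σ => Ideal.Quotient.mk P (a σ)) := by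
      intro hinj
      have h1 := Nat.card_le_card_of_injective _ hinj
      have h2 := kw_tr5 P hP hp hpP hI
      rw [hcard] at h1
      nlinarith
    rw [Function.Injective] at hnot
    push Not at hnot
    obtain ⟨σ, σ', heq, hne⟩ := hnot
    refine ⟨σ⁻¹ * σ', fun h => hne (inv_mul_eq_one.1 h), ?_⟩
    have h1 : a σ - a σ' ∈ P := Ideal.Quotient.eq.1 heq
    have h2 : (a σ - a σ') * π ^ 2 ∈ P ^ 3 := by
      rw [show (3 : ℕ) = 1 + 2 from rfl, pow_add, pow_one]
      exact Ideal.mul_mem_mul h1 hπsq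
    have h3 : σ' • π - σ • π ∈ P ^ 3 := by
      have := Ideal.sub_mem _ (Ideal.sub_mem _ (ha σ') (ha σ)) h2
      convert this using 1; ring
    have h4 : kwV P (σ⁻¹ • (σ' • π - σ • π)) = kwV P (σ' • π - σ • π) := kw_tr3 P hP hI _ _
    rw [← kwV_ge, ← h4, kwV_ge] at h3
    rwa [smul_sub, inv_smul_smul, smul_smul] at h3
  have hτo : orderOf τ = p := orderOf_eq_prime (hexp τ) hτ1
  have hpp := hp.one_lt
  obtain ⟨h, hh⟩ : ∃ h : Gal(M/ℚ), h ∉ Subgroup.zpowers τ := by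
    by_contra hcon
    push Not at hcon
    have : Subgroup.zpowers τ = ⊤ := by rw [eq_top_iff]; exact fun x _ => hcon x
    have h1 := Nat.card_zpowers τ
    rw [this, Subgroup.card_top, hcard, hτo] at h1
    nlinarith
  have hho : orderOf h = p := by
    refine orderOf_eq_prime (hexp h) ?_
    rintro rfl; exact hh (one_mem _)
  have htop : Subgroup.zpowers τ ⊔ Subgroup.zpowers h = ⊤ := by
    set N := Subgroup.zpowers τ ⊔ Subgroup.zpowers h with hN
    have hd1 : Nat.card N ∣ p ^ 2 := hcard ▸ Subgroup.card_subgroup_dvd_card N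
    obtain ⟨k, hk2, hk⟩ := (Nat.dvd_prime_pow hp).1 hd1
    have hlt : Subgroup.zpowers τ < N := by
      refine lt_of_le_of_ne le_sup_left ?_
      intro he
      apply hh
      rw [he]
      exact (le_sup_right : Subgroup.zpowers h ≤ N) (Subgroup.mem_zpowers h)
    have hk1 : k = 2 := by
      by_contra hne
      have : k ≤ 1 := by omega
      have h2 : Nat.card N ≤ p := by
        rw [hk]
        calc p ^ k ≤ p ^ 1 := Nat.pow_le_pow_right hp.pos this
          _ = p := pow_one p
      have h3 := Subgroup.eq_of_le_of_card_ge hlt.le (by rw [Nat.card_zpowers, hτo]; exact h2)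
      exact hlt.ne h3
    rw [hk1] at hk
    exact Subgroup.eq_top_of_card_eq N (by rw [hk, hcard])
  have hgen : ∀ x : 𝓞 M, h • x = x → τ • x = x → ∀ σ : Gal(M/ℚ), σ • x = x := by
    intro x h1 h2 σ
    have : Subgroup.zpowers τ ⊔ Subgroup.zpowers h ≤ MulAction.stabilizer Gal(M/ℚ) x := by
      rw [sup_le_iff, Subgroup.zpowers_le, Subgroup.zpowers_le]
      exact ⟨h2, h1⟩
    rw [htop] at this
    exact this (Subgroup.mem_top σ)
  have hτi : ∀ i : ℕ, τ ^ i • π - π ∈ P ^ 3 := by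
    intro i
    induction i with
    | zero => simp
    | succ i ih =>
      have h4 : kwV P (τ ^ i • (τ • π - π)) = kwV P (τ • π - π) := kw_tr3 P hP hI _ _
      have h5 : τ ^ i • (τ • π - π) ∈ P ^ 3 := by rw [← kwV_ge, h4, kwV_ge]; exact hτ
      rw [smul_sub, smul_smul, ← pow_succ] at h5
      have := Ideal.add_mem _ h5 ih
      simpa using this
  refine kw_w3 P hP hp hp2 hpP hI hcard hcomm h τ hgen (hexp τ)
    (ϖ := ∏ j ∈ Finset.range p, h ^ j • π) ?_ (kw_prod_range_smul h p (hexp h) π) ?_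
  · rw [kwV_prod hP, Finset.sum_congr rfl (fun j _ => kw_tr3 P hP hI (h ^ j) π), hπ]
    simp
  · intro i
    refine kw_w2 P hP hp hpP hI hcard hcomm h τ hgen (hexp τ) ?_
      (kw_w1 P hP hp hpP hI hW hπ hcomm h (τ ^ i) hho (hτi i))
    rw [smul_sub, smul_smul, hcomm, ← smul_smul, kw_prod_range_smul h p (hexp h) π]

end totram4

open NumberField

section k1
variable {L : Type*} [Field L] [NumberField L] [IsGalois ℚ L]

lemma kw_normal {G : Type*} [Group G] (hcomm : ∀ σ τ : G, σ * τ = τ * σ) (N : Subgroup G) :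
    N.Normal := ⟨fun n hn g => by rwa [hcomm g n, mul_assoc, mul_inv_cancel, mul_one]⟩

lemma kw_restrict_eq_one (F : IntermediateField ℚ L) [IsGalois ℚ F] (σ : Gal(L/ℚ))
    (h : σ ∈ F.fixingSubgroup) : AlgEquiv.restrictNormalHom F σ = 1 := by
  ext x
  have := AlgEquiv.restrictNormal_commutes σ F x
  refine Eq.trans this ?_
  exact (IntermediateField.mem_fixingSubgroup_iff F σ).1 h x x.2

lemma kw_card_gal (F : IntermediateField ℚ L) [IsGalois ℚ F] :
    Nat.card Gal(F/ℚ) = F.fixingSubgroup.index := by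
  have := IntermediateField.finrank_eq_fixingSubgroup_index L F
  rw [← this]
  exact IsGalois.card_aut_eq_finrank ℚ F

theorem kw_W' (hcomm : ∀ σ τ : Gal(L/ℚ), σ * τ = τ * σ) (N : Subgroup Gal(L/ℚ))
    (Q : Ideal (𝓞 L)) [Q.IsPrime] (hQ : Q ≠ ⊥) {p : ℕ} (hp : p.Prime) (hp2 : 2 < p)
    (hpQ : (p : 𝓞 L) ∈ Q) (hI : Q.inertia Gal(L/ℚ) ⊔ N = ⊤) (hidx : N.index = p ^ 2)
    (hexp : ∀ σ : Gal(L/ℚ), σ ^ p ∈ N) : False := by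
  have hN := kw_normal hcomm N
  let F := IntermediateField.fixedField N
  have hF : F.fixingSubgroup = N := IntermediateField.fixingSubgroup_fixedField N
  have hG : IsGalois ℚ F := IsGalois.of_fixedField_normal_subgroup N
  have h0 : Q.under (𝓞 F) ≠ ⊥ := mt Ideal.eq_bot_of_comap_eq_bot hQ
  have hsurj : Function.Surjective (AlgEquiv.restrictNormalHom (F := ℚ) (K₁ := L) F) :=
    AlgEquiv.restrictNormalHom_surjective L
  have hc : Nat.card Gal(F/ℚ) = p ^ 2 := by
    rw [← hidx, kw_card_gal F, hF]
  refine kw_W (M := F) (Q.under (𝓞 F)) h0 hp hp2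
    (by simpa [Ideal.under, Ideal.mem_comap] using hpQ) ?_ hc ?_ ?_
  · refine Subgroup.eq_top_of_card_eq _ ?_
    rw [kw_card_inertia_int _ h0, hc, ← hidx]
    have h1 := kw_card_inertia_tower F Q hQ
    rw [hF] at h1
    have h2 : N.relIndex (Q.inertia Gal(L/ℚ)) = N.index := by
      rw [← Subgroup.relIndex_sup_right, hI, Subgroup.relIndex_top_right]
    have h3 := Subgroup.index_mul_card (N.subgroupOf (Q.inertia Gal(L/ℚ)))
    have h4 : Nat.card (N.subgroupOf (Q.inertia Gal(L/ℚ))) =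
        Nat.card (Q.inertia Gal(L/ℚ) ⊓ N : Subgroup Gal(L/ℚ)) := by
      rw [← Subgroup.inf_subgroupOf_left]
      exact Nat.card_congr (Subgroup.subgroupOfEquivOfLe inf_le_left).toEquiv
    rw [h4] at h3
    have h5 : (N.subgroupOf (Q.inertia Gal(L/ℚ))).index = N.index := h2
    rw [h5, h1] at h3
    have h6 : 0 < Nat.card (Q.inertia Gal(L/ℚ) ⊓ N : Subgroup Gal(L/ℚ)) := Nat.card_pos
    exact (Nat.eq_of_mul_eq_mul_right h6 h3).symm
  · intro σ τ
    obtain ⟨σ, rfl⟩ := hsurj σ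
    obtain ⟨τ, rfl⟩ := hsurj τ
    rw [← map_mul, hcomm, map_mul]
  · intro σ
    obtain ⟨σ, rfl⟩ := hsurj σ
    rw [← map_pow]
    exact kw_restrict_eq_one F _ (hF ▸ hexp σ)

end k1

open NumberField

section abstractcount

lemma kw_elem_card {Γ : Type*} [CommGroup Γ] [Finite Γ] {l : ℕ} (hl : l.Prime)
    (hno : ∀ N : Subgroup Γ, N.index = l ^ 2 → (∀ σ : Γ, σ ^ l ∈ N) → False) :
    Nat.card (powMonoidHom l : Γ →* Γ).ker ≤ l := by
  have hfact : Fact l.Prime := ⟨hl⟩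
  set R := (powMonoidHom l : Γ →* Γ).range with hR
  have h1 : Nat.card (powMonoidHom l : Γ →* Γ).ker = R.index := by
    have h2 := Subgroup.index_mul_card (powMonoidHom l : Γ →* Γ).ker
    have h3 := Subgroup.index_mul_card R
    rw [Subgroup.index_ker, ← h3, ← hR, mul_comm] at h2
    exact Nat.eq_of_mul_eq_mul_right Nat.card_pos h2
  rw [h1, Subgroup.index_eq_card]
  have hexp : ∀ x : Γ ⧸ R, x ^ l = 1 := by
    intro x
    induction x using QuotientGroup.induction_on with
    | H z => 
      rw [← QuotientGroup.mk_pow, QuotientGroup.eq_one_iff]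
      exact ⟨z, rfl⟩
  have hpg : IsPGroup l (Γ ⧸ R) := fun x => ⟨1, by simpa using hexp x⟩
  obtain ⟨d, hd⟩ := IsPGroup.iff_card.1 hpg
  rw [hd]
  by_cases hd2 : d ≤ 1
  · calc l ^ d ≤ l ^ 1 := Nat.pow_le_pow_right hl.pos hd2
      _ = l := pow_one l
  exfalso
  obtain ⟨N, hN⟩ := Sylow.exists_subgroup_card_pow_prime (G := Γ ⧸ R) l (n := d - 2)
    (by rw [hd]; exact pow_dvd_pow _ (by omega))
  refine hno (N.comap (QuotientGroup.mk' R)) ?_ ?_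
  · rw [Subgroup.index_comap_of_surjective _ (QuotientGroup.mk'_surjective R)]
    have := Subgroup.index_mul_card N
    rw [hd, hN, show d = 2 + (d - 2) by omega, pow_add] at this
    simp only [Nat.add_sub_cancel_left] at this
    exact Nat.eq_of_mul_eq_mul_right (pow_pos hl.pos _) this
  · intro σ
    rw [Subgroup.mem_comap, map_pow, hexp]
    exact N.one_mem

lemma kw_elem_card_pow {Γ : Type*} [CommGroup Γ] [Finite Γ] {l : ℕ}
    (h : Nat.card (powMonoidHom l : Γ →* Γ).ker ≤ l) (a : ℕ) :
    Nat.card (powMonoidHom (l ^ a) : Γ →* Γ).ker ≤ l ^ a := by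
  induction a with
  | zero =>
    rw [pow_zero]
    have : (powMonoidHom 1 : Γ →* Γ).ker = ⊥ := by
      ext x; simp [MonoidHom.mem_ker]
    rw [this]; simp
  | succ a ih =>
    set K1 := (powMonoidHom (l ^ (a + 1)) : Γ →* Γ).ker
    set K0 := (powMonoidHom (l ^ a) : Γ →* Γ).ker
    set E := (powMonoidHom l : Γ →* Γ).ker
    let f : K1 →* Γ := (powMonoidHom l : Γ →* Γ).comp K1.subtype
    have h1 := Subgroup.index_mul_card f.ker
    rw [Subgroup.index_ker] at h1
    have h2 : Nat.card f.range ≤ Nat.card K0 := by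
      refine Nat.card_le_card_of_injective (Subgroup.inclusion (H := f.range) (K := K0) ?_)
        (Subgroup.inclusion_injective _)
      rintro _ ⟨x, rfl⟩
      have := x.2
      simp only [K1, MonoidHom.mem_ker, powMonoidHom_apply] at this
      simp only [K0, MonoidHom.mem_ker, powMonoidHom_apply, f, MonoidHom.comp_apply, Subgroup.subtype_apply]
      rw [← pow_mul, mul_comm, ← pow_succ, this]
    have h3 : Nat.card f.ker ≤ Nat.card E := by
      refine Nat.card_le_card_of_injective (fun x : f.ker => (⟨x.1.1, x.2⟩ : E)) ?_
      intro x y hxy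
      exact Subtype.ext (Subtype.ext (congrArg (fun e : E => (e : Γ)) hxy))
    calc Nat.card K1 = Nat.card f.range * Nat.card f.ker := h1.symm
      _ ≤ l ^ a * l := Nat.mul_le_mul (h2.trans ih) (h3.trans h)
      _ = _ := (pow_succ _ _).symm

/-- bound for a finite abelian group with one dimensional `l`-torsion -/
lemma kw_count {Γ : Type*} [Group Γ] [Finite Γ] (hcomm : ∀ σ τ : Γ, σ * τ = τ * σ)
    {l : ℕ} (hl : l.Prime)
    (hno : ∀ N : Subgroup Γ, N.index = l ^ 2 → (∀ σ : Γ, σ ^ l ∈ N) → False)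
    {a b B : ℕ} (hexp : ∀ σ : Γ, σ ^ (l ^ a * b) = 1) (hb : ¬ l ∣ b)
    (htame : ∀ N : Subgroup Γ, ¬ l ∣ N.index → N.index ≤ B) :
    Nat.card Γ ≤ l ^ a * B := by
  let _ : CommGroup Γ := { ‹Group Γ› with mul_comm := hcomm }
  have hfact : Fact l.Prime := ⟨hl⟩
  have h1 := kw_elem_card_pow (kw_elem_card hl hno) a
  set K0 := (powMonoidHom (l ^ a) : Γ →* Γ).ker with hK0
  rw [← Subgroup.index_mul_card K0, mul_comm]
  refine Nat.mul_le_mul h1 (htame K0 ?_)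
  rw [hK0, Subgroup.index_ker]
  intro hd
  obtain ⟨x, hx⟩ := exists_prime_orderOf_dvd_card' l hd
  obtain ⟨x, y, rfl⟩ := x
  apply hb
  rw [← hx]
  apply orderOf_dvd_of_pow_eq_one
  ext
  simp only [powMonoidHom_apply, SubmonoidClass.mk_pow, OneMemClass.coe_one]
  rw [← pow_mul, hexp]

end abstractcount

open NumberField

section k3
variable {L : Type*} [Field L] [NumberField L] [IsGalois ℚ L]

lemma kw_exists_prime_above (L : Type*) [Field L] [NumberField L] {p : ℕ} (hp : p.Prime) :
    ∃ P : Ideal (𝓞 L), P.IsPrime ∧ P ≠ ⊥ ∧ (p : 𝓞 L) ∈ P := by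
  have hpr : (Ideal.span {(p : ℤ)}).IsPrime :=
    (Ideal.span_singleton_prime (by exact_mod_cast hp.ne_zero)).2 (Nat.prime_iff_prime_int.1 hp)
  obtain ⟨P, hP, hPq⟩ := Ideal.exists_ideal_over_prime_of_isIntegral_of_isDomain (S := 𝓞 L)
    (Ideal.span {(p : ℤ)})
    (by rw [(RingHom.injective_iff_ker_eq_bot _).1 (FaithfulSMul.algebraMap_injective ℤ (𝓞 L))]
        exact bot_le)
  have hm : (p : 𝓞 L) ∈ P := by
    have : (p : ℤ) ∈ P.comap (algebraMap ℤ (𝓞 L)) := hPq ▸ Ideal.mem_span_singleton_self _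
    simpa [Ideal.mem_comap] using this
  refine ⟨P, hP, ?_, hm⟩
  rintro rfl
  have : (p : 𝓞 L) = 0 := by simpa using hm
  exact hp.ne_zero (by exact_mod_cast this)

/-- a rational that is a positive square in `L` etc: normalise to squarefree -/
lemma kw_rat_squarefree (q : ℚ) (hq : 0 < q) : ∃ (t : ℚ) (d : ℕ), t ≠ 0 ∧ Squarefree d ∧
    t ^ 2 * q = d := by
  obtain ⟨a, b, hab, hsq⟩ := Nat.sq_mul_squarefree (q.num.toNat * q.den)
  have hnum : 0 < q.num := Rat.num_pos.2 hq
  have hnn : ((q.num.toNat : ℕ) : ℚ) = q.num := by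
    have : ((q.num.toNat : ℕ) : ℤ) = q.num := Int.toNat_of_nonneg hnum.le
    exact_mod_cast this
  have h1 : (b : ℚ) ^ 2 * a = q.num * q.den := by
    rw [← hnn]; exact_mod_cast hab
  have hden : (q.den : ℚ) ≠ 0 := by exact_mod_cast q.den_nz
  have hb : (b : ℚ) ≠ 0 := by
    rintro hb
    rw [hb] at h1
    have : (q.num : ℚ) ≠ 0 := by exact_mod_cast hnum.ne'
    have := mul_ne_zero this hden
    apply this; rw [← h1]; ring
  refine ⟨q.den / b, a, div_ne_zero hden hb, hsq, ?_⟩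
  have h2 : q * q.den = q.num := Rat.mul_den_eq_num q
  field_simp
  rw [show (q.den : ℚ) ^ 2 * q = (q * q.den) * q.den by ring, h2, ← h1]
  

/-- If `F/ℚ` is unramified at `p`, `z ∈ F`, `z ^ 2 = d`, `d` squarefree then `p ∤ d`. -/
lemma kw_unram_sq (F : IntermediateField ℚ L) [IsGalois ℚ F] (P : Ideal (𝓞 L)) [P.IsPrime] (hP : P ≠ ⊥)
    {p : ℕ} (hp : p.Prime) (hpP : (p : 𝓞 L) ∈ P)
    (h : P.inertia Gal(L/ℚ) ≤ F.fixingSubgroup)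
    {d : ℕ} (hd : Squarefree d) (z : F) (hz : z ^ 2 = d) : ¬ p ∣ d := by
  intro hpd
  have h1 := kw_ramIdx_one F P hP h
  have h0 : P.under (𝓞 F) ≠ ⊥ := mt Ideal.eq_bot_of_comap_eq_bot hP
  set q := P.under (𝓞 F)
  have hpq : (p : 𝓞 F) ∈ q := by simpa [q, Ideal.mem_comap] using hpP
  have hintg : IsIntegral ℤ z := by
    refine IsIntegral.of_pow (n := 2) (by norm_num) ?_
    rw [hz]
    exact isIntegral_algebraMap (R := ℤ) (x := (d : ℤ)) |> fun h => by simpa using h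
  let w : 𝓞 F := ⟨z, hintg⟩
  have hw : w ^ 2 = d := by
    apply RingOfIntegers.ext
    change algebraMap (𝓞 F) F (w ^ 2) = algebraMap (𝓞 F) F d
    rw [map_pow, map_natCast]
    exact hz
  obtain ⟨e, rfl⟩ := hpd
  have hpe : ¬ p ∣ e := by
    intro hpe
    obtain ⟨f, rfl⟩ := hpe
    have := hd p ⟨f, by ring⟩
    exact hp.one_lt.ne' (by simpa using this)
  have hwq : w ∈ q := by
    have : w ^ 2 ∈ q := by
      rw [hw]; push_cast
      exact q.mul_mem_right _ hpq
    exact Ideal.IsPrime.mem_of_pow_mem inferInstance _ this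
  have hw2 : (p : 𝓞 F) * e ∈ q ^ 2 := by
    have := Ideal.pow_mem_pow hwq 2
    rw [hw] at this; push_cast at this; exact this
  have heq : (e : 𝓞 F) ∉ q := by
    have := (kw_int_mem q hp hpq (e : ℤ)).not.2 (by exact_mod_cast hpe)
    simpa using this
  have hp2 : (p : 𝓞 F) ∈ q ^ 2 := by
    rw [mul_comm] at hw2
    exact (Ideal.IsPrime.mul_mem_pow q hw2).resolve_left heq
  have hmap : Ideal.map (algebraMap ℤ (𝓞 F)) (Ideal.span {(p : ℤ)}) = Ideal.span {(p : 𝓞 F)} := by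
    rw [Ideal.map_span]; simp
  have hp0 : (p : 𝓞 F) ≠ 0 := by exact_mod_cast hp.ne_zero
  have : q.LiesOver (Ideal.span {(p : ℤ)}) := ⟨(kw_under_eq q hp hpq).symm⟩
  rw [Ideal.IsDedekindDomain.ramificationIdx_eq_multiplicity (Ideal.span {(p : ℤ)}) q
    (by rw [hmap]; simpa using hp0), hmap] at h1
  have hfin : FiniteMultiplicity q (Ideal.span {(p : 𝓞 F)}) :=
    FiniteMultiplicity.of_prime_left (Ideal.prime_of_isPrime h0 inferInstance) (by simpa using hp0)
  have h3 : q ^ 2 ∣ Ideal.span {(p : 𝓞 F)} := by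
    rw [Ideal.dvd_iff_le, Ideal.span_singleton_le_iff_mem]; exact hp2
  have := hfin.le_multiplicity_of_pow_dvd h3
  omega


/-- An index 2 subgroup containing complex conjugation and odd inertia fixes `√2`. -/
lemma kw_index_two (ι : L →+* ℂ) (c : Gal(L/ℚ)) (hc : ∀ x, ι (c x) = star (ι x))
    (N : Subgroup Gal(L/ℚ)) (hcomm : ∀ σ τ : Gal(L/ℚ), σ * τ = τ * σ) (hN : N.index = 2)
    (hcN : c ∈ N)
    (hram : ∀ (p : ℕ) (P : Ideal (𝓞 L)), p.Prime → p ≠ 2 → P.IsPrime → P ≠ ⊥ → (p : 𝓞 L) ∈ P →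
      P.inertia Gal(L/ℚ) ≤ N) (s : L) (hs : s ^ 2 = 2) (τ : Gal(L/ℚ)) (hτ : τ ∈ N) : τ s = s := by
  have hNn := kw_normal hcomm N
  let F := IntermediateField.fixedField N
  have hF : F.fixingSubgroup = N := IntermediateField.fixingSubgroup_fixedField N
  have hG : IsGalois ℚ F := IsGalois.of_fixedField_normal_subgroup N
  have hmemF : ∀ x, x ∈ F ↔ ∀ τ ∈ N, τ x = x := by
    intro x
    simp only [F, IntermediateField.mem_fixedField_iff]
  obtain ⟨σ, hσ⟩ : ∃ σ, σ ∉ N := by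
    by_contra! h
    have : N = ⊤ := by ext; simp [h]
    rw [this] at hN; simp at hN
  have hnotin : ∃ x ∈ F, σ x ≠ x := by
    by_contra! h
    apply hσ
    rw [← hF, IntermediateField.mem_fixingSubgroup_iff]
    exact h
  obtain ⟨x, hxF, hx⟩ := hnotin
  have hσσ : ∀ τ, τ ∉ N → σ⁻¹ * τ ∈ N := by
    intro τ hτ
    rw [Subgroup.mul_mem_iff_of_index_two hN]
    simp [hσ, hτ]
  have hσ2 : σ (σ x) = x := by
    have : σ * σ ∈ N := Subgroup.mul_self_mem_of_index_two hN σ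
    exact (hmemF x).1 hxF _ this
  set y := x - σ x with hy
  have hy0 : y ≠ 0 := sub_ne_zero.2 (Ne.symm hx)
  have hσy : σ y = - y := by rw [hy, map_sub, hσ2]; ring
  have hyF : ∀ τ ∈ N, τ y = y := by
    intro τ hτ
    have h1 := (hmemF x).1 hxF τ hτ
    have h2 : τ (σ x) = σ x := by
      change (τ * σ) x = σ x
      rw [hcomm, AlgEquiv.mul_apply, h1]
    rw [hy, map_sub, h1, h2]
  have hall : ∀ τ : Gal(L/ℚ), τ (y ^ 2) = y ^ 2 := by
    intro τ
    by_cases hτ : τ ∈ N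
    · rw [map_pow, hyF τ hτ]
    · have h1 := hyF _ (hσσ τ hτ)
      have h2 : τ y = σ y := by
        conv_rhs => rw [← h1]
        rw [← AlgEquiv.mul_apply]; simp
      rw [map_pow, h2, hσy]; ring
  obtain ⟨q, hq⟩ : ∃ q : ℚ, algebraMap ℚ L q = y ^ 2 := by
    have := (IsGalois.mem_bot_iff_fixed (F := ℚ) (E := L) (y ^ 2)).2 hall
    exact IntermediateField.mem_bot.1 this
  have hq' : (q : ℂ) = ι y ^ 2 := by
    rw [← map_pow, ← hq]; simp
  have hreal : star (ι y) = ι y := by rw [← hc, hyF c hcN]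
  have hqpos : 0 < q := by
    obtain ⟨r, hr⟩ := Complex.conj_eq_iff_real.1 hreal
    have hr0 : r ≠ 0 := by
      rintro rfl
      apply hy0
      apply ι.injective
      rw [hr]; simp
    have : (q : ℝ) = r ^ 2 := by
      rw [hr] at hq'
      exact_mod_cast hq'
    have h3 : (0 : ℝ) < q := by rw [this]; positivity
    exact_mod_cast h3
  obtain ⟨t, d, ht, hd, htd⟩ := kw_rat_squarefree q hqpos
  have ht0 : (algebraMap ℚ L t) ≠ 0 := by simpa using ht
  set z := algebraMap ℚ L t * y with hz
  have hzd : z ^ 2 = d := by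
    rw [hz, mul_pow, ← hq, ← map_pow, ← map_mul, htd]; simp
  have hσz : σ z = - z := by rw [hz, map_mul, hσy, AlgEquiv.commutes]; ring
  have hz0 : z ≠ 0 := mul_ne_zero ht0 hy0
  have hzF : ∀ τ ∈ N, τ z = z := by
    intro τ hτ
    rw [hz, map_mul, hyF τ hτ, AlgEquiv.commutes]
  have hprime : ∀ p : ℕ, p.Prime → p ≠ 2 → ¬ p ∣ d := by
    intro p hp hp2
    obtain ⟨P, hP1, hP2, hP3⟩ := kw_exists_prime_above L hp
    refine kw_unram_sq F P hP2 hp hP3 (hF ▸ hram p P hp hp2 hP1 hP2 hP3) hd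
      ⟨z, (hmemF z).2 hzF⟩ ?_
    apply Subtype.ext
    simpa using hzd
  have hd2 : d = 1 ∨ d = 2 := by
    have h1 : d ∣ 2 := by
      have hsub : d.primeFactors ⊆ {2} := by
        intro p hp
        by_contra h
        exact hprime p (Nat.prime_of_mem_primeFactors hp) (by simpa using h)
          (Nat.dvd_of_mem_primeFactors hp)
      have := Finset.prod_dvd_prod_of_subset _ _ (fun p : ℕ => p) hsub
      rw [Nat.prod_primeFactors_of_squarefree hd] at this
      simpa using this
    exact (Nat.dvd_prime Nat.prime_two).1 h1
  rcases hd2 with rfl | rfl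
  · exfalso
    have : z = 1 ∨ z = -1 := by
      rw [← sq_eq_one_iff, hzd]; simp
    rcases this with h | h
    · rw [h] at hσz; simp at hσz; norm_num at hσz
    · rw [h] at hσz; simp at hσz; norm_num at hσz
  · have : (s - z) * (s + z) = 0 := by
      have : s ^ 2 = z ^ 2 := by rw [hs, hzd]; norm_num
      linear_combination this
    rcases mul_eq_zero.1 this with h | h
    · rw [sub_eq_zero.1 h]; exact hzF τ hτ
    · rw [eq_neg_of_add_eq_zero_left h, map_neg, hzF τ hτ]

end k3

open NumberField

section k4
variable {L : Type*} [Field L] [NumberField L] [IsGalois ℚ L]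

lemma kw_W2' (ι : L →+* ℂ) (c : Gal(L/ℚ)) (hc : ∀ x, ι (c x) = star (ι x))
    (N : Subgroup Gal(L/ℚ)) (hcomm : ∀ σ τ : Gal(L/ℚ), σ * τ = τ * σ) (hN : N.index = 2 ^ 2)
    (hexp : ∀ σ : Gal(L/ℚ), σ ^ 2 ∈ N) (hcN : c ∈ N)
    (hram : ∀ (p : ℕ) (P : Ideal (𝓞 L)), p.Prime → p ≠ 2 → P.IsPrime → P ≠ ⊥ → (p : 𝓞 L) ∈ P →
      P.inertia Gal(L/ℚ) ≤ N) (s : L) (hs : s ^ 2 = 2) : False := by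
  have hNn := kw_normal hcomm N
  have key : ∀ σ, σ ∉ N → ∀ τ, (τ ∈ N ∨ τ = σ) → τ s = s := by
    intro σ hσ τ hτ
    let Z : Subgroup (Gal(L/ℚ) ⧸ N) := Subgroup.zpowers (QuotientGroup.mk' N σ)
    have hle : N ≤ Z.comap (QuotientGroup.mk' N) := by
      intro x hx
      rw [Subgroup.mem_comap]
      have : QuotientGroup.mk' N x = 1 := (QuotientGroup.eq_one_iff x).2 hx
      rw [this]; exact Z.one_mem
    have hord : orderOf (QuotientGroup.mk' N σ) = 2 := by
      apply orderOf_eq_prime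
      · rw [← map_pow]; exact (QuotientGroup.eq_one_iff _).2 (hexp σ)
      · intro h; exact hσ ((QuotientGroup.eq_one_iff _).1 h)
    have hidx : (Z.comap (QuotientGroup.mk' N)).index = 2 := by
      rw [Subgroup.index_comap_of_surjective _ (QuotientGroup.mk'_surjective N)]
      have h1 := Subgroup.index_mul_card Z
      rw [Nat.card_zpowers, hord, ← Subgroup.index_eq_card, hN] at h1
      omega
    refine kw_index_two ι c hc _ hcomm hidx (hle hcN)
      (fun p P h1 h2 h3 h4 h5 => (hram p P h1 h2 h3 h4 h5).trans hle) s hs τ ?_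
    rcases hτ with h | rfl
    · exact hle h
    · exact Subgroup.mem_zpowers _
  obtain ⟨σ, hσ⟩ : ∃ σ, σ ∉ N := by
    by_contra! h
    have : N = ⊤ := by ext; simp [h]
    rw [this] at hN; simp at hN
  have hall : ∀ τ : Gal(L/ℚ), τ s = s := by
    intro τ
    by_cases hτ : τ ∈ N
    · exact key σ hσ τ (Or.inl hτ)
    · exact key τ hτ τ (Or.inr rfl)
  obtain ⟨q, hq⟩ : ∃ q : ℚ, algebraMap ℚ L q = s := by
    have := (IsGalois.mem_bot_iff_fixed (F := ℚ) (E := L) s).2 hall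
    exact IntermediateField.mem_bot.1 this
  have hq2 : q ^ 2 = 2 := by
    apply (algebraMap ℚ L).injective
    rw [map_pow, hq, hs]; simp
  apply irrational_sqrt_two
  refine ⟨|q|, ?_⟩
  have : ((|q| : ℚ) : ℝ) ^ 2 = 2 := by
    rw [← Rat.cast_pow, sq_abs, hq2]; norm_num
  rw [← this, Real.sqrt_sq]
  positivity

lemma kw_root_smul {η : 𝓞 L} {r : ℕ} (hr : 0 < r) (hη : IsPrimitiveRoot η r) (σ : Gal(L/ℚ)) :
    ∃ u : ℕ, u.Coprime r ∧ ∀ e : ℕ, σ ^ e • η = η ^ (u ^ e) := by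
  have h1 : IsPrimitiveRoot (σ • η) r := hη.map_of_injective
    (f := MulSemiringAction.toRingHom Gal(L/ℚ) (𝓞 L) σ) (MulAction.injective σ)
  have : NeZero r := ⟨hr.ne'⟩
  obtain ⟨u, hu, hur, hue⟩ := (hη.isPrimitiveRoot_iff).1 h1
  refine ⟨u, hur, fun e => ?_⟩
  induction e with
  | zero => simp
  | succ e ih =>
    rw [pow_succ', mul_smul, ih, smul_pow', ← hue, ← pow_mul, pow_succ']

lemma kw_pow_fix {η : 𝓞 L} {r : ℕ} (hr : 0 < r) (hη : IsPrimitiveRoot η r) (e : ℕ)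
    (he : ∀ u : ℕ, u.Coprime r → u ^ e ≡ 1 [MOD r]) (σ : Gal(L/ℚ)) : σ ^ e • η = η := by
  obtain ⟨u, hu, h⟩ := kw_root_smul hr hη σ
  rw [h]
  conv_rhs => rw [← pow_one η]
  rw [pow_eq_pow_mod _ hη.pow_eq_one, he u hu, ← pow_eq_pow_mod _ hη.pow_eq_one]

lemma kw_two_pow_exp (k : ℕ) (u : ℕ) (hu : Odd u) : u ^ (2 ^ (k + 1)) ≡ 1 [MOD 2 ^ (k + 3)] := by
  have key : ∀ k : ℕ, (2 : ℤ) ^ (k + 3) ∣ (u : ℤ) ^ (2 ^ (k + 1)) - 1 := by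
    intro k
    have hu' : Odd (u : ℤ) := by exact_mod_cast hu
    induction k with
    | zero => simpa using Int.eight_dvd_sq_sub_one_of_odd hu'
    | succ k ih =>
      have h1 : (u : ℤ) ^ (2 ^ (k + 1 + 1)) - 1 =
          ((u : ℤ) ^ (2 ^ (k + 1)) - 1) * ((u : ℤ) ^ (2 ^ (k + 1)) + 1) := by
        rw [pow_succ 2 (k + 1), pow_mul]; ring
      rw [h1, show k + 1 + 3 = (k + 3) + 1 by ring, pow_succ]
      exact mul_dvd_mul ih (hu'.pow.add_one).two_dvd
  refine (Nat.ModEq.symm ?_)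
  rw [Nat.modEq_iff_dvd]
  exact_mod_cast key k

lemma kw_fix_of_coprime {ζ : 𝓞 L} {a b : ℕ} (hab : a.Coprime b) (h0 : ζ ≠ 0)
    (τ : Gal(L/ℚ)) (ha : τ • ζ ^ a = ζ ^ a) (hb : τ • ζ ^ b = ζ ^ b) : τ • ζ = ζ := by
  have hz : (ζ : L) ≠ 0 := by simpa using h0
  set ω : L := ((τ • ζ : 𝓞 L) : L) / ζ with hω
  have h : ∀ n : ℕ, τ • ζ ^ n = ζ ^ n → ω ^ n = 1 := by
    intro n hn
    rw [hω, div_pow, ← map_pow, ← map_pow, ← smul_pow', hn, div_self]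
    rw [map_pow]; exact pow_ne_zero _ hz
  have h1 : ω = 1 := by
    have := pow_gcd_eq_one.2 ⟨h a ha, h b hb⟩
    rwa [hab, pow_one] at this
  apply RingOfIntegers.ext
  rw [hω, div_eq_one_iff_eq hz] at h1
  exact h1

lemma kw_card_sup_le {G : Type*} [Group G] [Finite G] (hcomm : ∀ σ τ : G, σ * τ = τ * σ)
    (A B : Subgroup G) : Nat.card (A ⊔ B : Subgroup G) ≤ Nat.card A * Nat.card B := by
  have hB := kw_normal hcomm B
  have := Set.natCard_mul_le (s := (A : Set G)) (t := (B : Set G))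
  rw [← Subgroup.mul_normal] at this
  exact this

lemma kw_card_iSup_le {G : Type*} [Group G] [Finite G] (hcomm : ∀ σ τ : G, σ * τ = τ * σ)
    (S : Finset ℕ) (f : ℕ → Subgroup G) (b : ℕ → ℕ) (h : ∀ p ∈ S, Nat.card (f p) ≤ b p) :
    Nat.card (S.sup f : Subgroup G) ≤ ∏ p ∈ S, b p := by
  classical
  induction S using Finset.induction_on with
  | empty => simp
  | insert p S hp ih =>
    rw [Finset.sup_insert, Finset.prod_insert hp]
    refine (kw_card_sup_le hcomm _ _).trans (Nat.mul_le_mul (h p (by simp)) (ih ?_))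
    intro q hq; exact h q (by simp [hq])

end k4

open NumberField

section k5
variable {L : Type*} [Field L] [NumberField L] [IsGalois ℚ L]

lemma kw_pow_smul {G X : Type*} [Group G] [MulAction G X] {σ : G} {x : X} (h : σ • x = x) (n : ℕ) :
    σ ^ n • x = x :=
  (MulAction.stabilizer G x).pow_mem (MulAction.mem_stabilizer_iff.2 h) n

lemma kw_not_dvd {S : Finset ℕ} {l k : ℕ} (hl : l.Prime) (hS : ∀ p ∈ S, p.Prime ∧ p ≠ l)
    {p : ℕ} (hp : p.Prime) (hpl : p ≠ l) (hpS : p ∉ S) : ¬ p ∣ (∏ q ∈ S, q) * l ^ k := by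
  intro h
  rcases (hp.dvd_mul).1 h with h | h
  · obtain ⟨q, hq, hpq⟩ := (Prime.dvd_finsetProd_iff hp.prime _).1 h
    rw [(Nat.prime_dvd_prime_iff_eq hp (hS q hq).1).1 hpq] at hpS
    exact hpS hq
  · exact hpl ((Nat.prime_dvd_prime_iff_eq hp hl).1 (hp.dvd_of_dvd_pow h))

lemma kw_not_dvd' {S : Finset ℕ} {l : ℕ} (hl : l.Prime) (hS : ∀ p ∈ S, p.Prime ∧ p ≠ l) :
    ¬ l ∣ (∏ q ∈ S, q) := by
  intro h
  obtain ⟨q, hq, hpq⟩ := (Prime.dvd_finsetProd_iff hl.prime _).1 h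
  exact (hS q hq).2 ((Nat.prime_dvd_prime_iff_eq hl (hS q hq).1).1 hpq).symm

lemma kw_prod_pos {S : Finset ℕ} {l : ℕ} (hS : ∀ p ∈ S, p.Prime ∧ p ≠ l) : 0 < ∏ q ∈ S, q :=
  Finset.prod_pos fun q hq => (hS q hq).1.pos

lemma kw_natCast_notMem (P : Ideal (𝓞 L)) [P.IsPrime] {p : ℕ} (hp : p.Prime)
    (hpP : (p : 𝓞 L) ∈ P) {r : ℕ} (h : ¬ p ∣ r) : (r : 𝓞 L) ∉ P := by
  have := (kw_int_mem P hp hpP (r : ℤ)).not.2 (by exact_mod_cast h)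
  simpa using this

lemma kw_core_S (hcomm : ∀ σ τ : Gal(L/ℚ), σ * τ = τ * σ) (K : IntermediateField ℚ L)
    {l a k : ℕ} (hl : l.Prime) {S : Finset ℕ} (hS : ∀ p ∈ S, p.Prime ∧ p ≠ l)
    (hK : ∀ σ : Gal(L/ℚ), σ ^ (l ^ a) ∈ K.fixingSubgroup)
    {ζ : 𝓞 L} (hζ : IsPrimitiveRoot ζ ((∏ p ∈ S, p) * l ^ k))
    (hgen : ∀ σ ∈ K.fixingSubgroup, σ • ζ = ζ → σ = 1) {p : ℕ} (hpS : p ∈ S)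
    (P : Ideal (𝓞 L)) [P.IsPrime] (hP : P ≠ ⊥) (hpP : (p : 𝓞 L) ∈ P) :
    Nat.card (P.inertia Gal(L/ℚ)) ≤ p - 1 := by
  classical
  obtain ⟨hp, hpl⟩ := hS p hpS
  set r := (∏ q ∈ S.erase p, q) * l ^ k with hr
  have hm : (∏ p ∈ S, p) * l ^ k = p * r := by
    rw [hr, ← Finset.mul_prod_erase S (fun q => q) hpS, mul_assoc]
  rw [hm] at hζ
  have hpr : ¬ p ∣ r := kw_not_dvd hl (fun q hq => hS q (Finset.mem_of_mem_erase hq)) hp hpl (by simp)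
  have hr0 : 0 < r := Nat.pos_of_ne_zero (by rintro h; rw [h] at hpr; simp at hpr)
  have hm0 : 0 < p * r := Nat.mul_pos hp.pos hr0
  have hcop : p.Coprime r := (Nat.Prime.coprime_iff_not_dvd hp).2 hpr
  have hz0 : ζ ≠ 0 := hζ.ne_zero hm0.ne'
  have hW : (P ^ 2).inertia Gal(L/ℚ) = ⊥ := by
    rw [eq_bot_iff]
    intro σ hσ
    have hσI : σ ∈ P.inertia Gal(L/ℚ) := fun x => Ideal.pow_le_self (by norm_num) (hσ x)
    rw [Subgroup.mem_bot]
    refine kw_wild_trivial_nf P hP hp hpP hσ (n := l ^ a * (p - 1)) ?_ ?_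
    · refine Nat.Coprime.mul_left (Nat.Coprime.pow_left _ ?_) ?_
      · exact (Nat.coprime_primes hl hp).2 (Ne.symm hpl)
      · refine Nat.Coprime.symm ((Nat.Prime.coprime_iff_not_dvd hp).2 ?_)
        intro h
        have := Nat.le_of_dvd (by have := hp.two_le; omega) h
        have := hp.pos
        omega
    · apply hgen
      · rw [pow_mul]; exact Subgroup.pow_mem _ (hK σ) _
      · refine kw_fix_of_coprime hcop hz0 _ ?_ ?_
        · apply kw_pow_smul
          refine kw_inertia_fix_root hσI (r := r) ?_ (kw_natCast_notMem P hp hpP hpr)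
          rw [← pow_mul]; exact hζ.pow_eq_one
        · refine kw_pow_fix hp.pos (hζ.pow hm0 (mul_comm p r)) _ ?_ σ
          intro u hu
          have := Nat.ModEq.pow_totient hu
          rw [Nat.totient_prime hp] at this
          rw [mul_comm, pow_mul]
          simpa using this.pow (l ^ a)
  have := kw_tame_index_nf hcomm P hP hp hpP
  rwa [hW, Subgroup.relIndex_bot_left] at this

lemma kw_core_unram (K : IntermediateField ℚ L)
    {l k : ℕ} (hl : l.Prime) {S : Finset ℕ} (hS : ∀ p ∈ S, p.Prime ∧ p ≠ l)
    (hdisc : ∀ p : ℕ, p.Prime → p ≠ l → p ∉ S → ¬ (p : ℤ) ∣ NumberField.discr K)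
    {ζ : 𝓞 L} (hζ : IsPrimitiveRoot ζ ((∏ p ∈ S, p) * l ^ k))
    (hgen : ∀ σ ∈ K.fixingSubgroup, σ • ζ = ζ → σ = 1) {p : ℕ} (hp : p.Prime) (hpl : p ≠ l)
    (hpS : p ∉ S)
    (P : Ideal (𝓞 L)) [P.IsPrime] (hP : P ≠ ⊥) (hpP : (p : 𝓞 L) ∈ P) :
    P.inertia Gal(L/ℚ) ≤ ⊥ := by
  intro σ hσ
  rw [Subgroup.mem_bot]
  apply hgen
  · exact kw_inertia_le_of_not_dvd_discr K P hP hp hpP (hdisc p hp hpl hpS) hσ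
  · exact kw_inertia_fix_root hσ hζ.pow_eq_one
      (kw_natCast_notMem P hp hpP (kw_not_dvd hl hS hp hpl hpS))

lemma kw_core_l (K : IntermediateField ℚ L)
    {l a k : ℕ} (hl : l.Prime) {S : Finset ℕ} (hS : ∀ p ∈ S, p.Prime ∧ p ≠ l)
    (hK : ∀ σ : Gal(L/ℚ), σ ^ (l ^ a) ∈ K.fixingSubgroup)
    {ζ : 𝓞 L} (hζ : IsPrimitiveRoot ζ ((∏ p ∈ S, p) * l ^ k))
    (hgen : ∀ σ ∈ K.fixingSubgroup, σ • ζ = ζ → σ = 1)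
    (Q : Ideal (𝓞 L)) [Q.IsPrime] (hlQ : (l : 𝓞 L) ∈ Q) {e : ℕ} (hae : l ^ a ∣ e)
    (he : ∀ u : ℕ, u.Coprime (l ^ k) → u ^ e ≡ 1 [MOD l ^ k])
    {σ : Gal(L/ℚ)} (hσ : σ ∈ Q.inertia Gal(L/ℚ)) : σ ^ e = 1 := by
  have hpr := kw_not_dvd' hl hS
  have hr0 := kw_prod_pos hS
  set r := ∏ q ∈ S, q
  have hm0 : 0 < r * l ^ k := Nat.mul_pos hr0 (pow_pos hl.pos _)
  have hcop : (l ^ k).Coprime r :=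
    Nat.Coprime.pow_left _ ((Nat.Prime.coprime_iff_not_dvd hl).2 hpr)
  have hz0 : ζ ≠ 0 := hζ.ne_zero hm0.ne'
  apply hgen
  · obtain ⟨f, rfl⟩ := hae
    rw [pow_mul]; exact Subgroup.pow_mem _ (hK σ) _
  · refine kw_fix_of_coprime hcop hz0 _ ?_ ?_
    · apply kw_pow_smul
      refine kw_inertia_fix_root hσ (r := r) ?_ (kw_natCast_notMem Q hl hlQ hpr)
      rw [← pow_mul, mul_comm]; exact hζ.pow_eq_one
    · exact kw_pow_fix (pow_pos hl.pos _) (hζ.pow hm0 rfl) _ he σ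

open Classical in
/-- inertia group at some prime above `p` -/
noncomputable def kwI (L : Type*) [Field L] [NumberField L] (p : ℕ) : Subgroup Gal(L/ℚ) :=
  if h : p.Prime then ((kw_exists_prime_above L h).choose).inertia Gal(L/ℚ) else ⊥

lemma kwI_spec {p : ℕ} (hp : p.Prime) : ∃ P : Ideal (𝓞 L), P.IsPrime ∧ P ≠ ⊥ ∧ (p : 𝓞 L) ∈ P ∧
    kwI L p = P.inertia Gal(L/ℚ) := by
  obtain ⟨h1, h2, h3⟩ := (kw_exists_prime_above L hp).choose_spec
  exact ⟨_, h1, h2, h3, by simp [kwI, hp]⟩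

lemma kwI_le (hcomm : ∀ σ τ : Gal(L/ℚ), σ * τ = τ * σ) {p : ℕ} (hp : p.Prime)
    (P : Ideal (𝓞 L)) [P.IsPrime] (hP : P ≠ ⊥) (hpP : (p : 𝓞 L) ∈ P) :
    P.inertia Gal(L/ℚ) ≤ kwI L p := by
  obtain ⟨Q, h1, h2, h3, h4⟩ := kwI_spec (L := L) hp
  rw [h4]
  exact kw_inertia_eq hcomm P Q hP h2 hp hpP h3

lemma kw_prime_below (P : Ideal (𝓞 L)) [P.IsPrime] (hP : P ≠ ⊥) :
    ∃ p : ℕ, p.Prime ∧ (p : 𝓞 L) ∈ P := by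
  have h1 : P.under ℤ ≠ ⊥ := mt Ideal.eq_bot_of_comap_eq_bot hP
  have hpr : (P.under ℤ).IsPrime := inferInstance
  obtain ⟨n, hn⟩ := (IsPrincipalIdealRing.principal (P.under ℤ)).principal
  have hn0 : n ≠ 0 := by rintro rfl; apply h1; rw [hn]; simp
  have hn' : P.under ℤ = Ideal.span {n} := hn
  have hprime : Prime n := by
    rw [hn'] at hpr
    exact (Ideal.span_singleton_prime hn0).1 hpr
  refine ⟨n.natAbs, Int.prime_iff_natAbs_prime.1 hprime, ?_⟩
  have : ((n.natAbs : ℤ)) ∈ P.under ℤ := by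
    rw [hn', Ideal.mem_span_singleton]
    exact Int.dvd_natAbs.2 dvd_rfl
  have := Ideal.mem_comap.1 this
  rwa [eq_intCast, Int.cast_natCast] at this

end k5

open NumberField

section k6
variable {L : Type*} [Field L] [NumberField L] [IsGalois ℚ L]

lemma kw_core_gen (hcomm : ∀ σ τ : Gal(L/ℚ), σ * τ = τ * σ) (K : IntermediateField ℚ L)
    {l k : ℕ} (hl : l.Prime) {S : Finset ℕ} (hS : ∀ p ∈ S, p.Prime ∧ p ≠ l)
    (hdisc : ∀ p : ℕ, p.Prime → p ≠ l → p ∉ S → ¬ (p : ℤ) ∣ NumberField.discr K)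
    {ζ : 𝓞 L} (hζ : IsPrimitiveRoot ζ ((∏ p ∈ S, p) * l ^ k))
    (hgen : ∀ σ ∈ K.fixingSubgroup, σ • ζ = ζ → σ = 1)
    (Q : Ideal (𝓞 L)) [Q.IsPrime] (hQ : Q ≠ ⊥) (hlQ : (l : 𝓞 L) ∈ Q) :
    Q.inertia Gal(L/ℚ) ⊔ S.sup (kwI L) = ⊤ := by
  apply kw_inertia_generate
  intro P hP1 hP2
  obtain ⟨p, hp, hpP⟩ := kw_prime_below P hP2
  by_cases hpl : p = l
  · subst hpl
    exact le_sup_of_le_left (kw_inertia_eq hcomm P Q hP2 hQ hp hpP hlQ)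
  by_cases hpS : p ∈ S
  · exact le_sup_of_le_right ((kwI_le hcomm hp P hP2 hpP).trans (Finset.le_sup hpS))
  · exact (kw_core_unram K hl hS hdisc hζ hgen hp hpl hpS P hP2 hpP).trans bot_le

lemma kw_core_cardJ (hcomm : ∀ σ τ : Gal(L/ℚ), σ * τ = τ * σ) (K : IntermediateField ℚ L)
    {l a k : ℕ} (hl : l.Prime) {S : Finset ℕ} (hS : ∀ p ∈ S, p.Prime ∧ p ≠ l)
    (hK : ∀ σ : Gal(L/ℚ), σ ^ (l ^ a) ∈ K.fixingSubgroup)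
    {ζ : 𝓞 L} (hζ : IsPrimitiveRoot ζ ((∏ p ∈ S, p) * l ^ k))
    (hgen : ∀ σ ∈ K.fixingSubgroup, σ • ζ = ζ → σ = 1) :
    Nat.card (S.sup (kwI L) : Subgroup Gal(L/ℚ)) ≤ ∏ p ∈ S, (p - 1) := by
  refine kw_card_iSup_le hcomm S _ _ ?_
  intro p hp
  obtain ⟨P, h1, h2, h3, h4⟩ := kwI_spec (L := L) (hS p hp).1
  rw [h4]
  exact kw_core_S hcomm K hl hS hK hζ hgen hp P h2 h3

/-- tame quotients -/
lemma kw_core_tame (hcomm : ∀ σ τ : Gal(L/ℚ), σ * τ = τ * σ) (N : Subgroup Gal(L/ℚ))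
    {l : ℕ} (hl : l.Prime) (Q : Ideal (𝓞 L)) [Q.IsPrime] (hQ : Q ≠ ⊥) (hlQ : (l : 𝓞 L) ∈ Q)
    (hI : Q.inertia Gal(L/ℚ) ⊔ N = ⊤) (hidx : ¬ l ∣ N.index) : N.index ≤ l - 1 := by
  have hNn := kw_normal hcomm N
  have hW : (Q ^ 2).inertia Gal(L/ℚ) ≤ N := by
    intro w hw
    obtain ⟨i, n, hn, hor⟩ := Nat.exists_eq_pow_mul_and_not_dvd (orderOf_pos w).ne' l hl.ne_one
    have h1 : w ^ (l ^ i) = 1 := by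
      refine kw_wild_trivial_nf Q hQ hl hlQ (Subgroup.pow_mem _ hw _) (n := n)
        ((Nat.Prime.coprime_iff_not_dvd hl).2 hn).symm ?_
      rw [← pow_mul, ← hor, pow_orderOf_eq_one]
    have h2 : w ^ N.index ∈ N := Subgroup.pow_index_mem N w
    have h3 : (l ^ i).Coprime N.index :=
      Nat.Coprime.pow_left _ ((Nat.Prime.coprime_iff_not_dvd hl).2 hidx)
    have h4 : (QuotientGroup.mk' N w) = 1 := by
      have ha : (QuotientGroup.mk' N w) ^ (l ^ i) = 1 := by rw [← map_pow, h1, map_one]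
      have hb : (QuotientGroup.mk' N w) ^ N.index = 1 := by
        rw [← map_pow]; exact (QuotientGroup.eq_one_iff _).2 h2
      have := pow_gcd_eq_one.2 ⟨ha, hb⟩
      rwa [h3, pow_one] at this
    exact (QuotientGroup.eq_one_iff _).1 h4
  have h1 := kw_tame_index_nf hcomm Q hQ hl hlQ
  have h2 : N.relIndex (Q.inertia Gal(L/ℚ)) = N.index := by
    rw [← Subgroup.relIndex_sup_right, hI, Subgroup.relIndex_top_right]
  rw [← h2]
  refine le_trans (Nat.le_of_dvd (Nat.pos_of_ne_zero ?_) (Subgroup.relIndex_dvd_of_le_left _ hW)) h1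
  exact Subgroup.index_ne_zero_of_finite

/-- Counting in the quotient by `J`. -/
lemma kw_core_quot (hcomm : ∀ σ τ : Gal(L/ℚ), σ * τ = τ * σ) (J : Subgroup Gal(L/ℚ))
    {l : ℕ} (hl : l.Prime) (Q : Ideal (𝓞 L)) [Q.IsPrime] (hQ : Q ≠ ⊥) (hlQ : (l : 𝓞 L) ∈ Q)
    (hI : Q.inertia Gal(L/ℚ) ⊔ J = ⊤) {a b : ℕ} (hb : ¬ l ∣ b)
    (hexp : ∀ σ ∈ Q.inertia Gal(L/ℚ), σ ^ (l ^ a * b) = 1)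
    (hno : ∀ N : Subgroup Gal(L/ℚ), J ≤ N → N.index = l ^ 2 → (∀ σ, σ ^ l ∈ N) → False) :
    Nat.card Gal(L/ℚ) ≤ l ^ a * (l - 1) * Nat.card J := by
  have hJn := kw_normal hcomm J
  have hle : ∀ N : Subgroup (Gal(L/ℚ) ⧸ J), J ≤ N.comap (QuotientGroup.mk' J) := by
    intro N x hx
    rw [Subgroup.mem_comap]
    have : QuotientGroup.mk' J x = 1 := (QuotientGroup.eq_one_iff x).2 hx
    rw [this]; exact N.one_mem
  have hidx : ∀ N : Subgroup (Gal(L/ℚ) ⧸ J), (N.comap (QuotientGroup.mk' J)).index = N.index :=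
    fun N => Subgroup.index_comap_of_surjective _ (QuotientGroup.mk'_surjective J)
  rw [← Subgroup.index_mul_card J, Subgroup.index_eq_card]
  refine Nat.mul_le_mul_right _ ?_
  refine kw_count (Γ := Gal(L/ℚ) ⧸ J) (b := b) ?_ hl ?_ ?_ hb ?_
  · intro σ τ
    obtain ⟨σ, rfl⟩ := QuotientGroup.mk'_surjective J σ
    obtain ⟨τ, rfl⟩ := QuotientGroup.mk'_surjective J τ
    rw [← map_mul, hcomm, map_mul]
  · intro N hN hex
    refine hno _ (hle N) ((hidx N).trans hN) ?_
    intro σ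
    rw [Subgroup.mem_comap, map_pow]
    exact hex _
  · intro σ
    obtain ⟨σ, rfl⟩ := QuotientGroup.mk'_surjective J σ
    have : σ ∈ Q.inertia Gal(L/ℚ) ⊔ J := hI ▸ Subgroup.mem_top _
    rw [Subgroup.mem_sup_of_normal_right] at this
    obtain ⟨x, hx, y, hy, rfl⟩ := this
    have hy1 : QuotientGroup.mk' J y = 1 := (QuotientGroup.eq_one_iff y).2 hy
    rw [map_mul, hy1, mul_one, ← map_pow, hexp x hx, map_one]
  · intro N hN
    rw [← hidx] at hN ⊢
    refine kw_core_tame hcomm _ hl Q hQ hlQ ?_ hN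
    exact top_le_iff.1 (hI ▸ sup_le_sup_left (hle N) _)

theorem kw_core_odd (hcomm : ∀ σ τ : Gal(L/ℚ), σ * τ = τ * σ) (K : IntermediateField ℚ L)
    {l k : ℕ} (hl : l.Prime) (hl2 : 2 < l) {S : Finset ℕ} (hS : ∀ p ∈ S, p.Prime ∧ p ≠ l)
    (hdisc : ∀ p : ℕ, p.Prime → p ≠ l → p ∉ S → ¬ (p : ℤ) ∣ NumberField.discr K)
    (hK : ∀ σ : Gal(L/ℚ), σ ^ (l ^ k) ∈ K.fixingSubgroup)
    {ζ : 𝓞 L} (hζ : IsPrimitiveRoot ζ ((∏ p ∈ S, p) * l ^ (k + 1)))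
    (hgen : ∀ σ ∈ K.fixingSubgroup, σ • ζ = ζ → σ = 1) :
    Nat.card Gal(L/ℚ) ≤ l ^ k * (l - 1) * ∏ p ∈ S, (p - 1) := by
  obtain ⟨Q, hQ1, hQ, hlQ⟩ := kw_exists_prime_above L hl
  have hI := kw_core_gen hcomm K hl hS hdisc hζ hgen Q hQ hlQ
  refine (kw_core_quot hcomm (S.sup (kwI L)) hl Q hQ hlQ hI (a := k) (b := l - 1) ?_ ?_ ?_).trans
    (Nat.mul_le_mul_left _ (kw_core_cardJ hcomm K hl hS hK hζ hgen))
  · intro h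
    have := Nat.le_of_dvd (by omega) h
    omega
  · intro σ hσ
    refine kw_core_l K hl hS hK hζ hgen Q hlQ (dvd_mul_right _ _) ?_ hσ
    intro u hu
    have := Nat.ModEq.pow_totient hu
    rwa [Nat.totient_prime_pow_succ hl] at this
  · intro N hJN hN hex
    exact kw_W' hcomm N Q hQ hl hl2 hlQ (top_le_iff.1 (hI ▸ sup_le_sup_left hJN _)) hN hex

theorem kw_core_two (hcomm : ∀ σ τ : Gal(L/ℚ), σ * τ = τ * σ) (K : IntermediateField ℚ L)
    (ι : L →+* ℂ) (c : Gal(L/ℚ)) (hc : ∀ x, ι (c x) = star (ι x)) (s : L) (hs : s ^ 2 = 2)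
    {k : ℕ} {S : Finset ℕ} (hS : ∀ p ∈ S, p.Prime ∧ p ≠ 2)
    (hdisc : ∀ p : ℕ, p.Prime → p ≠ 2 → p ∉ S → ¬ (p : ℤ) ∣ NumberField.discr K)
    (hK : ∀ σ : Gal(L/ℚ), σ ^ (2 ^ (k + 1)) ∈ K.fixingSubgroup)
    {ζ : 𝓞 L} (hζ : IsPrimitiveRoot ζ ((∏ p ∈ S, p) * 2 ^ (k + 3)))
    (hgen : ∀ σ ∈ K.fixingSubgroup, σ • ζ = ζ → σ = 1) :
    Nat.card Gal(L/ℚ) ≤ 2 ^ (k + 2) * ∏ p ∈ S, (p - 1) := by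
  have hl := Nat.prime_two
  obtain ⟨Q, hQ1, hQ, hlQ⟩ := kw_exists_prime_above L hl
  have hI := kw_core_gen hcomm K hl hS hdisc hζ hgen Q hQ hlQ
  have hJ := kw_core_cardJ hcomm K hl hS hK hζ hgen
  have hc2 : c ^ 2 = 1 := by
    ext x
    apply ι.injective
    rw [pow_two, AlgEquiv.mul_apply, hc, hc, star_star]; rfl
  have hcc : Nat.card (Subgroup.zpowers c) ≤ 2 := by
    rw [Nat.card_zpowers]
    exact Nat.le_of_dvd (by norm_num) (orderOf_dvd_of_pow_eq_one hc2)
  have hJ' : Nat.card (S.sup (kwI L) ⊔ Subgroup.zpowers c : Subgroup Gal(L/ℚ)) ≤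
      (∏ p ∈ S, (p - 1)) * 2 :=
    (kw_card_sup_le hcomm _ _).trans (Nat.mul_le_mul hJ hcc)
  have hI' : Q.inertia Gal(L/ℚ) ⊔ (S.sup (kwI L) ⊔ Subgroup.zpowers c) = ⊤ :=
    top_le_iff.1 (hI ▸ sup_le_sup_left le_sup_left _)
  refine (kw_core_quot hcomm (S.sup (kwI L) ⊔ Subgroup.zpowers c) hl Q hQ hlQ hI'
    (a := k + 1) (b := 1) (by norm_num) ?_ ?_).trans ?_
  · intro σ hσ
    refine kw_core_l K hl hS hK hζ hgen Q hlQ (dvd_mul_right _ _) ?_ hσ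
    intro u hu
    rw [mul_one]
    apply kw_two_pow_exp
    rw [Nat.coprime_pow_right_iff (by omega)] at hu
    exact (Nat.coprime_two_right).1 hu
  · intro N hJN hN hex
    refine kw_W2' ι c hc N hcomm hN hex ?_ ?_ s hs
    · exact hJN (le_sup_right (a := S.sup (kwI L)) (Subgroup.mem_zpowers c))
    · intro p P hp hp2 hP1 hP2 hP3
      by_cases hpS : p ∈ S
      · exact (kwI_le hcomm hp P hP2 hP3).trans
          ((Finset.le_sup hpS).trans (le_sup_left.trans hJN))
      · exact (kw_core_unram K hl hS hdisc hζ hgen hp hp2 hpS P hP2 hP3).trans bot_le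
  · refine (Nat.mul_le_mul_left _ hJ').trans ?_
    rw [pow_succ 2 (k + 1)]
    apply le_of_eq
    ring

end k6

open NumberField

section k7
set_option linter.unusedSectionVars false

lemma kw_exists_conj (L : Type*) [Field L] [NumberField L] [IsGalois ℚ L] (ι : L →+* ℂ) :
    ∃ c : Gal(L/ℚ), ∀ x, ι (c x) = star (ι x) := by
  let _ : Algebra L ℂ := ι.toAlgebra
  let cc : ℂ ≃ₐ[ℚ] ℂ := Complex.conjAe.restrictScalars ℚ
  exact ⟨cc.restrictNormal L, fun x => AlgEquiv.restrictNormal_commutes cc L x⟩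

lemma kw_sqrt_two {L : Type*} [Field L] [CharZero L] {η : L} (h : IsPrimitiveRoot η 8) :
    (η + η ^ 7) ^ 2 = 2 := by
  have h8 : η ^ 8 = 1 := h.pow_eq_one
  have h4 : η ^ 4 = -1 := by
    have h1 : (η ^ 4 - 1) * (η ^ 4 + 1) = 0 := by ring_nf; rw [h8]; ring
    rcases mul_eq_zero.1 h1 with h2 | h2
    · exfalso
      exact h.pow_ne_one_of_pos_of_lt (by norm_num) (show 4 < 8 by norm_num) (sub_eq_zero.1 h2)
    · exact eq_neg_of_add_eq_zero_left h2
  have : (η + η ^ 7) ^ 2 = η ^ 2 + 2 * η ^ 8 + η ^ 8 * η ^ 4 * η ^ 2 := by ring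
  rw [this, h8, h4]; ring

lemma kw_finrank_adjoin {L : Type*} [Field L] [NumberField L] {ζ : L} {m : ℕ} (hm : 0 < m)
    (hζ : IsPrimitiveRoot ζ m) :
    Module.finrank ℚ (IntermediateField.adjoin ℚ {ζ}) = m.totient := by
  rw [IntermediateField.adjoin.finrank (Algebra.IsIntegral.isIntegral ζ),
    ← Polynomial.cyclotomic_eq_minpoly_rat hζ hm, Polynomial.natDegree_cyclotomic]

variable {K L : Type*} [Field K] [NumberField K] [IsGalois ℚ K]
  [Field L] [NumberField L] [IsGalois ℚ L] [Algebra K L]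

/-- the order of the roots of unity needed -/
noncomputable def kwM (K : Type*) [Field K] [NumberField K] (l a : ℕ) : ℕ :=
  (∏ p ∈ (NumberField.discr K).natAbs.primeFactors.erase l, p) * l ^ (a + 3)

lemma kwM_pos (l a : ℕ) (hl : l.Prime) : 0 < kwM K l a := by
  refine Nat.mul_pos (Finset.prod_pos fun q hq => ?_) (pow_pos hl.pos _)
  exact (Nat.prime_of_mem_primeFactors (Finset.mem_of_mem_erase hq)).pos

lemma kwM_totient (l a : ℕ) (hl : l.Prime) : (kwM K l a).totient =
    l ^ (a + 2) * (l - 1) * ∏ p ∈ (NumberField.discr K).natAbs.primeFactors.erase l, (p - 1) := by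
  have key : ∀ S : Finset ℕ, (∀ p ∈ S, p.Prime ∧ p ≠ l) →
      (∏ p ∈ S, p).totient = ∏ p ∈ S, (p - 1) := by
    intro S hS
    induction S using Finset.induction_on with
    | empty => simp
    | insert p S hp ih =>
      rw [Finset.prod_insert hp, Finset.prod_insert hp, Nat.totient_mul, ih,
        Nat.totient_prime (hS p (by simp)).1]
      · intro q hq; exact hS q (by simp [hq])
      · refine Nat.Coprime.prod_right fun q hq => ?_
        rw [Nat.coprime_primes (hS p (by simp)).1 (hS q (by simp [hq])).1]
        rintro rfl; exact hp hq
  have hS : ∀ p ∈ (NumberField.discr K).natAbs.primeFactors.erase l, p.Prime ∧ p ≠ l := by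
    intro p hp
    exact ⟨Nat.prime_of_mem_primeFactors (Finset.mem_of_mem_erase hp), Finset.ne_of_mem_erase hp⟩
  rw [kwM, Nat.totient_mul, key _ hS, Nat.totient_prime_pow_succ hl]
  · ring
  · exact (Nat.Coprime.pow_left _ ((Nat.Prime.coprime_iff_not_dvd hl).2 (kw_not_dvd' hl hS))).symm

lemma kw_restrict_comm (hK : ∀ σ τ : Gal(K/ℚ), σ * τ = τ * σ) (σ τ : Gal(L/ℚ)) (x : K) :
    σ (τ (algebraMap K L x)) = τ (σ (algebraMap K L x)) := by
  have h : ∀ (σ : Gal(L/ℚ)) (y : K), σ (algebraMap K L y) =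
      algebraMap K L (σ.restrictNormal K y) := fun σ y =>
    (AlgEquiv.restrictNormal_commutes σ K y).symm
  rw [h, h, h, h, ← AlgEquiv.mul_apply, hK, AlgEquiv.mul_apply]

lemma kw_restrict_pow {n : ℕ} (hK : ∀ σ : Gal(K/ℚ), σ ^ n = 1) (σ : Gal(L/ℚ)) (x : K) :
    (σ ^ n) (algebraMap K L x) = algebraMap K L x := by
  have h := AlgEquiv.restrictNormal_commutes (σ ^ n) K x
  have h2 : AlgEquiv.restrictNormalHom K (σ ^ n) = 1 := by rw [map_pow, hK]
  have h3 : (σ ^ n).restrictNormal K = 1 := h2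
  rw [← h, h3]; rfl

theorem kw_prime_abs (hK : ∀ σ τ : Gal(K/ℚ), σ * τ = τ * σ) {l a : ℕ} (hl : l.Prime)
    (hexp : ∀ σ : Gal(K/ℚ), σ ^ (l ^ a) = 1) {ζ : L} (hζ : IsPrimitiveRoot ζ (kwM K l a))
    (hgen : ∀ σ : Gal(L/ℚ), (∀ x : K, σ (algebraMap K L x) = algebraMap K L x) → σ ζ = ζ → σ = 1) :
    IntermediateField.adjoin ℚ {ζ} = ⊤ := by
  have hm := kwM_pos (K := K) l a hl
  let f : K →ₐ[ℚ] L := IsScalarTower.toAlgHom ℚ K L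
  let F := f.fieldRange
  have hdF : NumberField.discr F = NumberField.discr K :=
    (NumberField.discr_eq_discr_of_algEquiv K (AlgEquiv.ofInjectiveField f)).symm
  set S := (NumberField.discr K).natAbs.primeFactors.erase l with hSdef
  have hS : ∀ p ∈ S, p.Prime ∧ p ≠ l := by
    intro p hp
    exact ⟨Nat.prime_of_mem_primeFactors (Finset.mem_of_mem_erase hp), Finset.ne_of_mem_erase hp⟩
  have hdisc : ∀ p : ℕ, p.Prime → p ≠ l → p ∉ S → ¬ (p : ℤ) ∣ NumberField.discr F := by
    intro p hp hpl hpS hd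
    apply hpS
    rw [hdF] at hd
    rw [hSdef, Finset.mem_erase, Nat.mem_primeFactors]
    refine ⟨hpl, hp, Int.natCast_dvd.1 hd, ?_⟩
    simpa using NumberField.discr_ne_zero K
  have hfix : ∀ σ : Gal(L/ℚ), σ ∈ F.fixingSubgroup ↔
      ∀ x : K, σ (algebraMap K L x) = algebraMap K L x := by
    intro σ
    rw [IntermediateField.mem_fixingSubgroup_iff]
    constructor
    · intro h x; exact h _ ⟨x, rfl⟩
    · rintro h _ ⟨x, rfl⟩; exact h x
  have hcomm : ∀ σ τ : Gal(L/ℚ), σ * τ = τ * σ := by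
    intro σ τ
    have hne : NeZero (kwM K l a) := ⟨hm.ne'⟩
    have hroot : ∀ σ : Gal(L/ℚ), ∃ u : ℕ, σ ζ = ζ ^ u := by
      intro σ
      obtain ⟨u, _, _, hu⟩ := (hζ.isPrimitiveRoot_iff).1
        (hζ.map_of_injective (f := (σ : L →ₐ[ℚ] L)) σ.injective)
      exact ⟨u, hu.symm⟩
    have h1 : (τ * σ)⁻¹ * (σ * τ) = 1 := by
      have hinv : ∀ x, σ (τ x) = τ (σ x) → ((τ * σ)⁻¹ * (σ * τ)) x = x := by
        intro x hx
        rw [AlgEquiv.mul_apply, AlgEquiv.mul_apply, hx, ← AlgEquiv.mul_apply τ σ,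
          ← AlgEquiv.mul_apply, inv_mul_cancel]
        rfl
      refine hgen _ (fun x => hinv _ (kw_restrict_comm hK σ τ x)) (hinv _ ?_)
      obtain ⟨u, hu⟩ := hroot σ
      obtain ⟨v, hv⟩ := hroot τ
      rw [hu, hv, map_pow, map_pow, hu, hv, ← pow_mul, ← pow_mul, mul_comm]
    exact (inv_mul_eq_one.1 h1).symm
  have hKf : ∀ (e : ℕ), a ≤ e → ∀ σ : Gal(L/ℚ), σ ^ (l ^ e) ∈ F.fixingSubgroup := by
    intro e he σ
    rw [hfix]
    obtain ⟨d, rfl⟩ := Nat.exists_eq_add_of_le he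
    rw [pow_add, mul_comm, pow_mul]
    exact kw_restrict_pow hexp _
  have hintg : IsIntegral ℤ ζ := hζ.isIntegral hm
  let z : 𝓞 L := ⟨ζ, hintg⟩
  have hz : IsPrimitiveRoot z (kwM K l a) := by
    refine IsPrimitiveRoot.of_map_of_injective (f := algebraMap (𝓞 L) L) hζ ?_
    exact RingOfIntegers.coe_injective
  have hgen' : ∀ σ ∈ F.fixingSubgroup, σ • z = z → σ = 1 := by
    intro σ h1 h2
    refine hgen σ ((hfix σ).1 h1) ?_
    exact congrArg (algebraMap (𝓞 L) L) h2
  have hcard : Nat.card Gal(L/ℚ) ≤ (kwM K l a).totient := by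
    rw [kwM_totient l a hl]
    rcases hl.two_le.eq_or_lt with h2 | h2
    · subst h2
      obtain ⟨ι⟩ : Nonempty (L →+* ℂ) := inferInstance
      obtain ⟨c, hc⟩ := kw_exists_conj L ι
      have h8 : (kwM K 2 a) = (∏ p ∈ S, p) * 2 ^ a * 8 := by
        rw [kwM, ← hSdef, pow_add]; ring
      have := kw_core_two hcomm F ι c hc _ (kw_sqrt_two (hζ.pow hm h8)) hS hdisc
        (hKf (a + 1) (by omega)) (k := a) hz hgen'
      simpa using this
    · exact kw_core_odd hcomm F hl h2 hS hdisc (hKf (a + 2) (by omega)) hz hgen'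
  symm
  refine (IntermediateField.eq_of_le_of_finrank_le le_top ?_).symm
  rw [IntermediateField.finrank_top', ← IsGalois.card_aut_eq_finrank]
  exact hcard.trans (kw_finrank_adjoin hm hζ).ge

end k7

open NumberField

section k8

lemma kw_exists_type {E : Type} [Field E] [CharZero E] (M : IntermediateField ℚ E)
    (hf : FiniteDimensional ℚ M) (hg : IsGalois ℚ M) :
    ∃ (L : Type) (_ : Field L) (_ : NumberField L) (_ : IsGalois ℚ L) (φ : L →ₐ[ℚ] E),
      φ.fieldRange = M ∧ Nonempty (Gal(L/ℚ) ≃* Gal(M/ℚ)) := by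
  refine ⟨M, inferInstance, @NumberField.mk _ _ inferInstance hf, hg, M.val, ?_, ⟨MulEquiv.refl _⟩⟩
  exact IntermediateField.fieldRange_val M

lemma kw_cyc (K L : Type*) [Field K] [Field L] [Algebra K L] {n : ℕ} [NeZero n] {ζ : L}
    (hζ : IsPrimitiveRoot ζ n) : IsCyclotomicExtension {n} K (IntermediateField.adjoin K {ζ}) := by
  change IsCyclotomicExtension {n} K (IntermediateField.adjoin K {ζ}).toSubalgebra
  rw [IntermediateField.adjoin_simple_toSubalgebra_of_isAlgebraic
    (hζ.isIntegral (NeZero.pos n)).tower_top.isAlgebraic]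
  exact hζ.adjoin_isCyclotomicExtension K

lemma kw_galois_adjoin_gen (K L : Type*) [Field K] [Field L] [Algebra K L] {n : ℕ} [NeZero n]
    {ζ : L} (hζ : IsPrimitiveRoot ζ n) : IsGalois K (IntermediateField.adjoin K {ζ}) ∧
    FiniteDimensional K (IntermediateField.adjoin K {ζ}) := by
  have := kw_cyc K L hζ
  exact ⟨IsCyclotomicExtension.isGalois {n} K _, IsCyclotomicExtension.finiteDimensional {n} K _⟩

lemma kw_galois_adjoin {m : ℕ} (hm : 0 < m) {ζ : ℂ} (hζ : IsPrimitiveRoot ζ m) :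
    IsGalois ℚ (IntermediateField.adjoin ℚ {ζ}) ∧
    FiniteDimensional ℚ (IntermediateField.adjoin ℚ {ζ}) := by
  have : NeZero m := ⟨hm.ne'⟩
  exact kw_galois_adjoin_gen ℚ ℂ hζ

/-- an automorphism of the source fixing preimages of generators is trivial -/
lemma kw_gen_fix {L : Type} [Field L] [NumberField L] (φ : L →ₐ[ℚ] ℂ) (M N : IntermediateField ℚ ℂ)
    (hφ : φ.fieldRange = M ⊔ N) (σ : Gal(L/ℚ)) (h1 : ∀ x, φ x ∈ M → σ x = x)
    (h2 : ∀ x, φ x ∈ N → σ x = x) : σ = 1 := by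
  let T : IntermediateField ℚ L := IntermediateField.fixedField (Subgroup.zpowers σ)
  have hT : ∀ x, σ x = x → x ∈ T := by
    intro x hx
    rw [IntermediateField.mem_fixedField_iff]
    intro τ hτ
    have : Subgroup.zpowers σ ≤ MulAction.stabilizer Gal(L/ℚ) x := by
      rw [Subgroup.zpowers_le]; exact hx
    exact this hτ
  have hM : M ⊔ N ≤ T.map φ := by
    refine sup_le ?_ ?_
    · intro y hy
      have : y ∈ φ.fieldRange := by rw [hφ]; exact (le_sup_left : M ≤ M ⊔ N) hy
      obtain ⟨x, rfl⟩ := this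
      exact ⟨x, hT x (h1 x hy), rfl⟩
    · intro y hy
      have : y ∈ φ.fieldRange := by rw [hφ]; exact (le_sup_right : N ≤ M ⊔ N) hy
      obtain ⟨x, rfl⟩ := this
      exact ⟨x, hT x (h2 x hy), rfl⟩
  ext x
  have hx : φ x ∈ T.map φ := hM (by rw [← hφ]; exact ⟨x, rfl⟩)
  obtain ⟨y, hy, hyx⟩ := hx
  have : y = x := φ.injective hyx
  subst this
  exact (IntermediateField.mem_fixedField_iff _ _).1 hy σ (Subgroup.mem_zpowers σ)

lemma kw_fix_adjoin {L : Type} [Field L] [NumberField L] (φ : L →ₐ[ℚ] ℂ) (z : L) (σ : Gal(L/ℚ))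
    (hz : σ z = z) (x : L) (hx : φ x ∈ IntermediateField.adjoin ℚ {φ z}) : σ x = x := by
  have h : (IntermediateField.adjoin ℚ {z}).map φ = IntermediateField.adjoin ℚ {φ z} := by
    rw [IntermediateField.adjoin_map]; simp
  rw [← h] at hx
  obtain ⟨y, hy, hyx⟩ := hx
  have : y = x := φ.injective hyx
  subst this
  let T : IntermediateField ℚ L := IntermediateField.fixedField (Subgroup.zpowers σ)
  have h1 : IntermediateField.adjoin ℚ {z} ≤ T := by
    rw [IntermediateField.adjoin_simple_le_iff]
    rw [IntermediateField.mem_fixedField_iff]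
    intro τ hτ
    have : Subgroup.zpowers σ ≤ MulAction.stabilizer Gal(L/ℚ) z := by
      rw [Subgroup.zpowers_le]; exact hz
    exact this hτ
  exact (IntermediateField.mem_fixedField_iff _ _).1 (h1 hy) σ (Subgroup.mem_zpowers σ)

lemma kw_comp_type {K : Type} [Field K] [NumberField K] [IsGalois ℚ K] (j : K →ₐ[ℚ] ℂ)
    {m : ℕ} (hm : 0 < m) {ζ : ℂ} (hζ : IsPrimitiveRoot ζ m) :
    ∃ (L : Type) (_ : Field L) (_ : NumberField L) (_ : IsGalois ℚ L) (φ : L →ₐ[ℚ] ℂ)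
      (jj : K →ₐ[ℚ] L) (z : L), φ.fieldRange = j.fieldRange ⊔ IntermediateField.adjoin ℚ {ζ} ∧
      (∀ x, φ (jj x) = j x) ∧ φ z = ζ := by
  obtain ⟨hg, hf⟩ := kw_galois_adjoin hm hζ
  set A := IntermediateField.adjoin ℚ {ζ} with hA
  have hB : IsGalois ℚ j.fieldRange := IsGalois.of_algEquiv (AlgEquiv.ofInjectiveField j)
  have hBf : FiniteDimensional ℚ j.fieldRange :=
    (AlgEquiv.ofInjectiveField j).toLinearEquiv.finiteDimensional
  have hLf : FiniteDimensional ℚ (j.fieldRange ⊔ A : IntermediateField ℚ ℂ) :=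
    IntermediateField.finiteDimensional_sup _ _
  have hLg : IsGalois ℚ (j.fieldRange ⊔ A : IntermediateField ℚ ℂ) := by
    have : Normal ℚ (j.fieldRange ⊔ A : IntermediateField ℚ ℂ) :=
      @IntermediateField.normal_sup _ _ _ _ _ _ _ hB.to_normal hg.to_normal
    exact @IsGalois.mk _ _ _ _ _ inferInstance this
  obtain ⟨L, i1, i2, i3, φ, hφ, -⟩ := kw_exists_type (j.fieldRange ⊔ A) hLf hLg
  have hjL : ∀ x, j x ∈ φ.fieldRange := fun x => by
    rw [hφ]; exact (le_sup_left : j.fieldRange ≤ j.fieldRange ⊔ A) ⟨x, rfl⟩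
  have hζL : ζ ∈ φ.fieldRange := by
    rw [hφ]; exact (le_sup_right : A ≤ j.fieldRange ⊔ A)
      (IntermediateField.mem_adjoin_simple_self ℚ ζ)
  obtain ⟨z, hz⟩ := hζL
  choose g hg using hjL
  have hgφ : ∀ x, φ (g x) = j x := hg
  have hinj : ∀ x y, φ x = φ y → x = y := fun x y h => φ.injective h
  refine ⟨L, i1, i2, i3, φ, RingHom.toRatAlgHom
    { toFun := g
      map_one' := hinj _ _ (by rw [hgφ, map_one, map_one])
      map_zero' := hinj _ _ (by rw [hgφ, map_zero, map_zero])
      map_mul' := fun x y => hinj _ _ (by rw [map_mul, hgφ, hgφ, hgφ, map_mul])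
      map_add' := fun x y => hinj _ _ (by rw [map_add, hgφ, hgφ, hgφ, map_add]) },
    z, hφ, hgφ, hz⟩

theorem kw_prime_type (K : Type) [Field K] [NumberField K] [IsGalois ℚ K]
    (hK : ∀ σ τ : Gal(K/ℚ), σ * τ = τ * σ) {l a : ℕ} (hl : l.Prime)
    (hexp : ∀ σ : Gal(K/ℚ), σ ^ (l ^ a) = 1) (j : K →ₐ[ℚ] ℂ) (ζ : ℂ)
    (hζ : IsPrimitiveRoot ζ (kwM K l a)) (x : K) : j x ∈ IntermediateField.adjoin ℚ {ζ} := by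
  have hm := kwM_pos (K := K) l a hl
  obtain ⟨L, i1, i2, i3, φ, jj, z, hφ, hj, rfl⟩ := kw_comp_type j hm hζ
  let _ : Algebra K L := jj.toRingHom.toAlgebra
  have hz : IsPrimitiveRoot z (kwM K l a) :=
    IsPrimitiveRoot.of_map_of_injective (f := φ) hζ φ.injective
  have key := kw_prime_abs (K := K) (L := L) hK hl hexp hz (by
    intro σ h1 h2
    refine kw_gen_fix φ _ _ hφ σ ?_ (fun y hy => kw_fix_adjoin φ z σ h2 y hy)
    rintro y ⟨w, hw⟩
    have : y = jj w := φ.injective (hw.symm.trans (hj w).symm)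
    rw [this]; exact h1 w)
  have hx : jj x ∈ IntermediateField.adjoin ℚ {z} := by rw [key]; trivial
  have h3 : (IntermediateField.adjoin ℚ {z}).map φ = IntermediateField.adjoin ℚ {φ z} := by
    rw [IntermediateField.adjoin_map]; simp
  rw [← h3]
  exact ⟨_, hx, hj x⟩

end k8

open NumberField

section k9

variable {K : Type} [Field K] [NumberField K] [IsGalois ℚ K]

/-- torsion subgroup of a commutative Galois group -/
def kwTors (hK : ∀ σ τ : Gal(K/ℚ), σ * τ = τ * σ) (n : ℕ) : Subgroup Gal(K/ℚ) where
  carrier := {σ | σ ^ n = 1}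
  one_mem' := one_pow n
  mul_mem' := by
    intro a b ha hb
    change (a * b) ^ n = 1
    rw [(show Commute a b from hK a b).mul_pow]
    rw [show a ^ n = 1 from ha, show b ^ n = 1 from hb, one_mul]
  inv_mem' := by
    intro a ha
    change (a⁻¹) ^ n = 1
    rw [inv_pow, show a ^ n = 1 from ha, inv_one]

lemma kw_prime_part (hK : ∀ σ τ : Gal(K/ℚ), σ * τ = τ * σ) {l a n' : ℕ} (hl : l.Prime)
    (hn : Nat.card Gal(K/ℚ) = l ^ a * n') :
    ∃ m : ℕ, 0 < m ∧ ∀ (j : K →ₐ[ℚ] ℂ) (ζ : ℂ), IsPrimitiveRoot ζ m →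
      ∀ x ∈ IntermediateField.fixedField (kwTors hK n'), j x ∈ IntermediateField.adjoin ℚ {ζ} := by
  have hN := kw_normal hK (kwTors hK n')
  obtain ⟨F, i1, i2, i3, φ, hφ, -⟩ := kw_exists_type
    (IntermediateField.fixedField (kwTors hK n')) (inferInstance)
    (IsGalois.of_fixedField_normal_subgroup (kwTors hK n'))
  let _ : Algebra F K := φ.toRingHom.toAlgebra
  have hsurj : Function.Surjective (AlgEquiv.restrictNormalHom F : Gal(K/ℚ) →* Gal(F/ℚ)) :=
    AlgEquiv.restrictNormalHom_surjective K
  have hF : ∀ σ τ : Gal(F/ℚ), σ * τ = τ * σ := by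
    intro σ τ
    obtain ⟨σ, rfl⟩ := hsurj σ
    obtain ⟨τ, rfl⟩ := hsurj τ
    rw [← map_mul, hK, map_mul]
  have hexp : ∀ σ : Gal(F/ℚ), σ ^ (l ^ a) = 1 := by
    intro σ
    obtain ⟨σ, rfl⟩ := hsurj σ
    rw [← map_pow]
    ext x
    have h := AlgEquiv.restrictNormal_commutes (σ ^ l ^ a) F x
    refine (algebraMap F K).injective (h.trans ?_)
    have hx : φ x ∈ IntermediateField.fixedField (kwTors hK n') := by rw [← hφ]; exact ⟨x, rfl⟩
    refine (IntermediateField.mem_fixedField_iff _ _).1 hx _ ?_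
    change (σ ^ l ^ a) ^ n' = 1
    rw [← pow_mul, ← hn, pow_card_eq_one']
  refine ⟨kwM F l a, kwM_pos l a hl, fun j ζ hζ x hx => ?_⟩
  rw [← hφ] at hx
  obtain ⟨y, rfl⟩ := hx
  exact kw_prime_type F hF hl hexp (j.comp φ) ζ hζ y

theorem kw_complex (K : Type) [Field K] [NumberField K] [IsGalois ℚ K]
    (hK : ∀ σ τ : Gal(K/ℚ), σ * τ = τ * σ) :
    ∃ m : ℕ, 0 < m ∧ ∀ (j : K →ₐ[ℚ] ℂ) (ζ : ℂ), IsPrimitiveRoot ζ m →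
      ∀ x, j x ∈ IntermediateField.adjoin ℚ {ζ} := by
  set n := Nat.card Gal(K/ℚ) with hn
  have hn0 : n ≠ 0 := Nat.card_pos.ne'
  have H : ∀ l : ℕ, ∃ m : ℕ, 0 < m ∧ (l.Prime → ∀ (j : K →ₐ[ℚ] ℂ) (ζ : ℂ), IsPrimitiveRoot ζ m →
      ∀ x ∈ IntermediateField.fixedField (kwTors hK (n / l ^ n.factorization l)),
        j x ∈ IntermediateField.adjoin ℚ {ζ}) := by
    intro l
    by_cases hl : l.Prime
    · obtain ⟨m, hm, h⟩ := kw_prime_part hK (l := l) (a := n.factorization l)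
        (n' := n / l ^ n.factorization l) hl (Nat.ordProj_mul_ordCompl_eq_self n l).symm
      exact ⟨m, hm, fun _ => h⟩
    · exact ⟨1, one_pos, fun h => absurd h hl⟩
  choose m hm h using H
  have hM : 0 < ∏ l ∈ n.primeFactors, m l := Finset.prod_pos fun l _ => hm l
  refine ⟨∏ l ∈ n.primeFactors, m l, hM, fun j ζ hζ x => ?_⟩
  set T : IntermediateField ℚ K := (IntermediateField.adjoin ℚ {ζ}).comap j with hT
  suffices hTt : T = ⊤ by
    have : x ∈ T := by rw [hTt]; trivial
    exact this
  have hle : ∀ l ∈ n.primeFactors, T.fixingSubgroup ≤ kwTors hK (n / l ^ n.factorization l) := by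
    intro l hl
    rw [← IntermediateField.fixingSubgroup_fixedField (kwTors hK (n / l ^ n.factorization l))]
    apply IntermediateField.fixingSubgroup_antitone
    intro y hy
    obtain ⟨d, hd⟩ := Finset.dvd_prod_of_mem m hl
    have h1 := h l (Nat.prime_of_mem_primeFactors hl) j (ζ ^ d)
      (hζ.pow hM (by rw [hd, mul_comm])) y hy
    have h2 : IntermediateField.adjoin ℚ {ζ ^ d} ≤ IntermediateField.adjoin ℚ {ζ} := by
      rw [IntermediateField.adjoin_simple_le_iff]
      exact pow_mem (IntermediateField.mem_adjoin_simple_self ℚ ζ) d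
    exact h2 h1
  have hbot : T.fixingSubgroup = ⊥ := by
    rw [eq_bot_iff]
    intro σ hσ
    rw [Subgroup.mem_bot, ← orderOf_eq_one_iff]
    by_contra hne
    obtain ⟨l, hl, hlo⟩ := Nat.exists_prime_and_dvd hne
    have hln : l ∣ n := hlo.trans (orderOf_dvd_natCard σ)
    have h1 : σ ^ (n / l ^ n.factorization l) = 1 :=
      hle l (Nat.mem_primeFactors.2 ⟨hl, hln, hn0⟩) hσ
    exact Nat.not_dvd_ordCompl hl hn0 (hlo.trans (orderOf_dvd_of_pow_eq_one h1))
  rw [← IsGalois.fixedField_fixingSubgroup T, hbot, IntermediateField.fixedField_bot]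

end k9

open NumberField

section d1
set_option linter.unusedSectionVars false
open Polynomial
open scoped Classical

lemma kd_deriv (K L : Type*) [Field K] [Field L] [Algebra K L] [FiniteDimensional K L]
    [IsGalois K L] {ζ : L} (hζ : Algebra.adjoin K {ζ} = ⊤) :
    aeval ζ (derivative (minpoly K ζ)) =
      ∏ σ ∈ (Finset.univ : Finset (L ≃ₐ[K] L)).erase 1, (ζ - σ ζ) := by
  have hintg : IsIntegral K ζ := Algebra.IsIntegral.isIntegral ζ
  have hinj : Function.Injective (fun σ : L ≃ₐ[K] L => σ ζ) := by
    intro σ τ h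
    have : (σ : L →ₐ[K] L) = τ := by
      apply AlgHom.ext_of_adjoin_eq_top hζ
      rintro x rfl
      exact h
    ext x
    exact congrArg (fun f : L →ₐ[K] L => f x) this
  have hQ : (∏ σ : L ≃ₐ[K] L, (X - C (σ ζ))) = (minpoly K ζ).map (algebraMap K L) := by
    have hm1 : (∏ σ : L ≃ₐ[K] L, (X - C (σ ζ))).Monic := monic_prod_X_sub_C _ _
    have hm2 : ((minpoly K ζ).map (algebraMap K L)).Monic := (minpoly.monic hintg).map _
    refine Polynomial.eq_of_dvd_of_natDegree_le_of_leadingCoeff ?_ ?_ (by rw [hm1, hm2])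
    · refine Finset.prod_dvd_of_coprime ?_ ?_
      · intro σ _ τ _ hst
        exact pairwise_coprime_X_sub_C hinj hst
      · intro σ _
        rw [dvd_iff_isRoot, IsRoot, eval_map_algebraMap]
        have := aeval_algHom_apply (σ : L →ₐ[K] L) ζ (minpoly K ζ)
        rw [minpoly.aeval, map_zero] at this
        exact this
    · rw [natDegree_map, natDegree_prod_of_monic _ _ (fun σ _ => monic_X_sub_C _)]
      simp only [natDegree_X_sub_C, Finset.sum_const, smul_eq_mul, mul_one, Finset.card_univ]
      rw [← Nat.card_eq_fintype_card, IsGalois.card_aut_eq_finrank]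
      exact minpoly.natDegree_le ζ
  rw [← eval_map_algebraMap, ← derivative_map, ← hQ,
    ← Finset.mul_prod_erase Finset.univ _ (Finset.mem_univ (1 : L ≃ₐ[K] L)), derivative_mul]
  simp [eval_prod]

variable {K L : Type*} [Field K] [NumberField K] [Field L] [NumberField L] [Algebra K L]

lemma kd_rel [IsGalois K L] (z : 𝓞 L) (hz : Algebra.adjoin K {(z : L)} = ⊤) :
    ((Ideal.absNorm (differentIdeal (𝓞 K) (𝓞 L)) : ℕ) : ℚ) ≤
      ∏ σ ∈ (Finset.univ : Finset (L ≃ₐ[K] L)).erase 1, |Algebra.norm ℚ ((z : L) - σ z)| := by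
  have h1 := aeval_derivative_mem_differentIdeal (𝓞 K) K L z hz
  set y := aeval z (derivative (minpoly (𝓞 K) z)) with hy
  have hyL : (y : L) = ∏ σ ∈ (Finset.univ : Finset (L ≃ₐ[K] L)).erase 1, ((z : L) - σ z) := by
    rw [← kd_deriv K L hz, minpoly.isIntegrallyClosed_eq_field_fractions K L
      (IsIntegralClosure.isIntegral (𝓞 K) L z), derivative_map, aeval_map_algebraMap,
      aeval_algebraMap_apply]
  have hy0 : y ≠ 0 := by
    intro h0
    have : (y : L) ≠ 0 := by
      rw [hyL, ← kd_deriv K L hz]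
      exact (Algebra.IsSeparable.isSeparable K (z : L)).aeval_derivative_ne_zero (minpoly.aeval _ _)
    exact this (by rw [h0]; rfl)
  have h2 : Ideal.absNorm (differentIdeal (𝓞 K) (𝓞 L)) ∣ (Algebra.norm ℤ y).natAbs := by
    rw [← Ideal.absNorm_span_singleton]
    exact Ideal.absNorm_dvd_absNorm_of_le (by rwa [Ideal.span_singleton_le_iff_mem])
  have h3 : (Algebra.norm ℤ y).natAbs ≠ 0 := by
    simpa [Algebra.norm_eq_zero_iff] using hy0
  have h4 := Nat.le_of_dvd (Nat.pos_of_ne_zero h3) h2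
  have h5 : (((Algebra.norm ℤ y).natAbs : ℕ) : ℚ) = |Algebra.norm ℚ (y : L)| := by
    rw [← Algebra.coe_norm_int, Nat.cast_natAbs, Int.cast_abs]
  rw [← Finset.abs_prod, ← map_prod, ← hyL, ← h5]
  exact_mod_cast h4

lemma kd_abs [IsGalois ℚ L] {m : ℕ} [NeZero m] [IsCyclotomicExtension {m} ℚ L]
    {ζ : L} (hζ : IsPrimitiveRoot ζ m) (hz : Algebra.adjoin ℚ {ζ} = ⊤) :
    (((discr L).natAbs : ℕ) : ℚ) =
      ∏ σ ∈ (Finset.univ : Finset (L ≃ₐ[ℚ] L)).erase 1, |Algebra.norm ℚ (ζ - σ ζ)| := by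
  have h1 := conductor_mul_differentIdeal ℤ ℚ L hζ.toInteger hz
  have hc : conductor ℤ hζ.toInteger = ⊤ := by
    rw [conductor_eq_top_iff_adjoin_eq_top]
    exact IsCyclotomicExtension.Rat.adjoin_singleton_eq_top hζ
  rw [hc, Ideal.top_mul] at h1
  set y := aeval hζ.toInteger (derivative (minpoly ℤ hζ.toInteger)) with hy
  have hyL : (y : L) = ∏ σ ∈ (Finset.univ : Finset (L ≃ₐ[ℚ] L)).erase 1, (ζ - σ ζ) := by
    rw [← kd_deriv ℚ L hz]
    have := minpoly.isIntegrallyClosed_eq_field_fractions ℚ L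
      (IsIntegralClosure.isIntegral ℤ L hζ.toInteger)
    change minpoly ℚ ζ = _ at this
    rw [this, derivative_map, aeval_map_algebraMap]
    exact (aeval_algebraMap_apply L hζ.toInteger _).symm
  rw [← absNorm_differentIdeal L (𝒪 := 𝓞 L), h1, Ideal.absNorm_span_singleton]
  have h5 : (((Algebra.norm ℤ y).natAbs : ℕ) : ℚ) = |Algebra.norm ℚ (y : L)| := by
    rw [← Algebra.coe_norm_int, Nat.cast_natAbs, Int.cast_abs]
  rw [h5, ← Finset.abs_prod, ← map_prod, ← hyL]

lemma kd_main [IsGalois ℚ L] {m : ℕ} [NeZero m] [IsCyclotomicExtension {m} ℚ L]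
    {ζ : L} (hζ : IsPrimitiveRoot ζ m) (hz : Algebra.adjoin ℚ {ζ} = ⊤) (H : Subgroup (L ≃ₐ[ℚ] L))
    (hH : ∀ σ, σ ∈ H ↔ ∀ x : K, σ (algebraMap K L x) = algebraMap K L x) :
    ∏ σ : L ≃ₐ[ℚ] L with σ ∉ H, |Algebra.norm ℚ (ζ - σ ζ)| ≤
      (((discr K).natAbs : ℕ) : ℚ) ^ Nat.card H := by
  have hgal : IsGalois K L := IsGalois.tower_top_of_isGalois ℚ K L
  have hzK : Algebra.adjoin K {ζ} = ⊤ := by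
    rw [eq_top_iff]
    intro x _
    have hx : x ∈ Algebra.adjoin ℚ {ζ} := by rw [hz]; trivial
    have h1 : Algebra.adjoin ℚ {ζ} ≤ (Algebra.adjoin K {ζ}).restrictScalars ℚ :=
      Algebra.adjoin_le (Set.singleton_subset_iff.2
        ((Subalgebra.mem_restrictScalars ℚ).2 (Algebra.self_mem_adjoin_singleton K ζ)))
    exact (Subalgebra.mem_restrictScalars ℚ).1 (h1 hx)
  have h1 := kd_rel (K := K) hζ.toInteger hzK
  have h2 := kd_abs hζ hz
  have h3 := natAbs_discr_eq_absNorm_differentIdeal_mul_natAbs_discr_pow K (𝓞 K) L (𝓞 L)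
  let e : (L ≃ₐ[K] L) ≃ H :=
    { toFun := fun σ => ⟨σ.restrictScalars ℚ, (hH _).2 fun x => σ.commutes x⟩
      invFun := fun σ => AlgEquiv.ofRingEquiv (f := (σ : L ≃ₐ[ℚ] L).toRingEquiv)
        (fun x => (hH _).1 σ.2 x)
      left_inv := fun σ => by ext; rfl
      right_inv := fun σ => by ext; rfl }
  have hcard : Nat.card H = Module.finrank K L := by
    rw [← IsGalois.card_aut_eq_finrank K L]
    exact Nat.card_congr e.symm
  have h4 : ∏ σ ∈ (Finset.univ : Finset (L ≃ₐ[K] L)).erase 1, |Algebra.norm ℚ (ζ - σ ζ)| =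
      ∏ σ ∈ (Finset.univ : Finset (L ≃ₐ[ℚ] L)).erase 1 with σ ∈ H, |Algebra.norm ℚ (ζ - σ ζ)| := by
    refine Finset.prod_bij (fun σ _ => (e σ : L ≃ₐ[ℚ] L)) ?_ ?_ ?_ ?_
    · intro σ hσ
      rw [Finset.mem_filter, Finset.mem_erase]
      refine ⟨⟨fun h => (Finset.ne_of_mem_erase hσ) ?_, Finset.mem_univ _⟩, (e σ).2⟩
      ext x
      exact congrArg (fun f : L ≃ₐ[ℚ] L => f x) h
    · intro σ _ τ _ h
      exact e.injective (Subtype.ext h)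
    · intro τ hτ
      rw [Finset.mem_filter, Finset.mem_erase] at hτ
      refine ⟨e.symm ⟨τ, hτ.2⟩, ?_, by simp⟩
      rw [Finset.mem_erase]
      refine ⟨fun h => hτ.1.1 ?_, Finset.mem_univ _⟩
      ext x
      exact congrArg (fun f : L ≃ₐ[K] L => f x) h
    · intro σ _; rfl
  rw [← Finset.prod_filter_mul_prod_filter_not _ (fun σ => σ ∈ H), h3] at h2
  have h5 : ((Finset.univ : Finset (L ≃ₐ[ℚ] L)).erase 1).filter (fun σ => σ ∉ H) =
      Finset.univ.filter (fun σ => σ ∉ H) := by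
    ext σ
    simp only [Finset.mem_filter, Finset.mem_erase, Finset.mem_univ, true_and, and_true]
    exact ⟨fun h => h.2, fun h => ⟨fun h1 => h (h1 ▸ H.one_mem), h⟩⟩
  rw [h5, ← h4] at h2
  rw [hcard]
  have hpos : 0 < ∏ σ ∈ (Finset.univ : Finset (L ≃ₐ[K] L)).erase 1,
      |Algebra.norm ℚ (ζ - σ ζ)| := by
    refine lt_of_lt_of_le ?_ h1
    have : Ideal.absNorm (differentIdeal (𝓞 K) (𝓞 L)) ≠ 0 := by
      intro h0
      rw [h0, zero_mul] at h3
      exact discr_ne_zero L (Int.natAbs_eq_zero.1 h3)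
    exact_mod_cast Nat.pos_of_ne_zero this
  refine le_of_mul_le_mul_left ?_ hpos
  rw [← h2]
  push_cast
  exact mul_le_mul_of_nonneg_right h1 (by positivity)

end d1

open NumberField

section d2
set_option linter.unusedSectionVars false
open scoped Classical
variable {L : Type*} [Field L] [NumberField L] [IsGalois ℚ L]

lemma kd_norm {q j : ℕ} (hq : q.Prime) (hj : 0 < j) {ω : L} (hω : IsPrimitiveRoot ω (q ^ j)) :
    Real.log ((|Algebra.norm ℚ (ω - 1)| : ℚ) : ℝ) =
      Module.finrank ℚ L * Real.log q * (1 / ((q ^ j).totient : ℝ)) := by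
  have hqj : 0 < q ^ j := pow_pos hq.pos j
  have hintg : IsIntegral ℚ (ω - 1) := Algebra.IsIntegral.isIntegral _
  have hmin : minpoly ℚ (ω - 1) = (Polynomial.cyclotomic (q ^ j) ℚ).comp (Polynomial.X + 1) := by
    have := minpoly.sub_algebraMap (A := ℚ) (B := L) ω 1
    rw [map_one, ← Polynomial.cyclotomic_eq_minpoly_rat hω hqj, map_one] at this
    exact this
  have hc : (minpoly ℚ (ω - 1)).coeff 0 = q := by
    have : Fact q.Prime := ⟨hq⟩
    obtain ⟨i, rfl⟩ : ∃ i, j = i + 1 := ⟨j - 1, by omega⟩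
    rw [hmin, Polynomial.coeff_zero_eq_eval_zero, Polynomial.eval_comp]
    simp [Polynomial.eval_one_cyclotomic_prime_pow]
  have hd : (minpoly ℚ (ω - 1)).natDegree = (q ^ j).totient := by
    rw [hmin, Polynomial.natDegree_comp, Polynomial.natDegree_cyclotomic]
    have : (Polynomial.X + 1 : Polynomial ℚ).natDegree = 1 := by
      simpa using Polynomial.natDegree_X_add_C (1 : ℚ)
    rw [this, mul_one]
  have h1 := Algebra.norm_eq_norm_adjoin ℚ (ω - 1)
  have h2 := Algebra.PowerBasis.norm_gen_eq_coeff_zero_minpoly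
    (IntermediateField.adjoin.powerBasis hintg)
  rw [IntermediateField.adjoin.powerBasis_gen, IntermediateField.minpoly_gen, hc] at h2
  have h3 : Module.finrank ℚ (IntermediateField.adjoin ℚ {ω - 1}) *
      Module.finrank (IntermediateField.adjoin ℚ {ω - 1}) L = Module.finrank ℚ L :=
    Module.finrank_mul_finrank _ _ _
  have h4 : Module.finrank ℚ (IntermediateField.adjoin ℚ {ω - 1}) = (q ^ j).totient := by
    rw [← hd]; exact IntermediateField.adjoin.finrank hintg
  rw [h4] at h3
  have h5 : |Algebra.norm ℚ (ω - 1)| =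
      (q : ℚ) ^ Module.finrank (IntermediateField.adjoin ℚ {ω - 1}) L := by
    rw [h1, abs_pow]
    congr 1
    refine (congrArg abs h2).trans ?_
    rw [abs_mul, abs_pow, abs_neg, abs_one, one_pow, one_mul, Nat.abs_cast]
  have h6 : ((q ^ j).totient : ℝ) ≠ 0 := by
    exact_mod_cast (Nat.totient_pos.2 hqj).ne'
  rw [h5, ← h3]
  push_cast
  rw [Real.log_pow]
  field_simp

/-- the stabilizer of a power of a root of unity -/
def kdFix (ζ : L) (d : ℕ) : Subgroup Gal(L/ℚ) := MulAction.stabilizer Gal(L/ℚ) (ζ ^ d)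

lemma kdFix_mem {ζ : L} {d : ℕ} {σ : Gal(L/ℚ)} : σ ∈ kdFix ζ d ↔ σ (ζ ^ d) = ζ ^ d := Iff.rfl

lemma kdFix_eq (ζ : L) (d : ℕ) :
    kdFix ζ d = (IntermediateField.adjoin ℚ {ζ ^ d}).fixingSubgroup := by
  ext σ
  rw [kdFix_mem, IntermediateField.mem_fixingSubgroup_iff]
  constructor
  · intro h x hx
    have hle : IntermediateField.adjoin ℚ {ζ ^ d} ≤
        IntermediateField.fixedField (Subgroup.zpowers σ) := by
      rw [IntermediateField.adjoin_simple_le_iff, IntermediateField.mem_fixedField_iff]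
      intro τ hτ
      have : Subgroup.zpowers σ ≤ MulAction.stabilizer Gal(L/ℚ) (ζ ^ d) := by
        rw [Subgroup.zpowers_le]; exact h
      exact this hτ
    exact (IntermediateField.mem_fixedField_iff _ _).1 (hle hx) σ (Subgroup.mem_zpowers σ)
  · intro h
    exact h _ (IntermediateField.mem_adjoin_simple_self ℚ _)

lemma kd_card {ζ : L} {m d : ℕ} (hm : 0 < m) (hζ : IsPrimitiveRoot ζ m)
    (htop : IntermediateField.adjoin ℚ {ζ} = ⊤) (hd : d ∣ m) :
    Nat.card (kdFix ζ d) * (m / d).totient = m.totient := by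
  have hG : Nat.card Gal(L/ℚ) = m.totient := by
    rw [← kw_finrank_adjoin hm hζ, htop, IntermediateField.finrank_top',
      IsGalois.card_aut_eq_finrank]
  obtain ⟨e, rfl⟩ := hd
  have hd0 : 0 < d := Nat.pos_of_mul_pos_right hm
  have he0 : 0 < e := Nat.pos_of_mul_pos_left hm
  have h1 := Subgroup.index_mul_card (kdFix ζ d)
  rw [kdFix_eq, ← IntermediateField.finrank_eq_fixingSubgroup_index L] at h1
  have h2 := kw_finrank_adjoin he0 (hζ.pow hm rfl)
  rw [kdFix_eq, ← hG, Nat.mul_div_cancel_left _ hd0, ← h1, mul_comm, ← h2]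

end d2

open NumberField

section d3
set_option linter.unusedSectionVars false
open scoped Classical

lemma kd_sum_tot {q : ℕ} (hq : q.Prime) (t : ℕ) :
    ∑ s ∈ Finset.range (t + 1), (q ^ s).totient = q ^ t := by
  induction t with
  | zero => simp
  | succ t ih =>
    rw [Finset.sum_range_succ, ih, Nat.totient_prime_pow_succ hq, pow_succ]
    have := hq.pos
    obtain ⟨p, rfl⟩ : ∃ p, q = p + 1 := ⟨q - 1, by omega⟩
    simp; ring

lemma kd_tot_mul {q : ℕ} (hq : q.Prime) {j k : ℕ} (hj : 0 < j) (hjk : j ≤ k) :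
    (q ^ k).totient = (q ^ j).totient * q ^ (k - j) := by
  obtain ⟨d, rfl⟩ := Nat.exists_eq_add_of_le hjk
  obtain ⟨i, rfl⟩ : ∃ i, j = i + 1 := ⟨j - 1, by omega⟩
  rw [show i + 1 + d = (i + d) + 1 by ring, Nat.totient_prime_pow_succ hq,
    Nat.totient_prime_pow_succ hq, show i + d + 1 - (i + 1) = d by omega, pow_add]
  ring

variable {L : Type*} [Field L] [NumberField L] [IsGalois ℚ L]

lemma kd_card_pow {ζ : L} {q k m' s : ℕ} (hq : q.Prime) (hm' : ¬ q ∣ m')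
    (hζ : IsPrimitiveRoot ζ (q ^ k * m'))
    (htop : IntermediateField.adjoin ℚ {ζ} = ⊤) (hs : s ≤ k) :
    Nat.card (kdFix ζ (q ^ (k - s))) * (q ^ s).totient = (q ^ k).totient := by
  have hm0 : 0 < m' := Nat.pos_of_ne_zero (by rintro rfl; exact hm' (dvd_zero _))
  have hq0 := hq.pos
  have hsplit : q ^ k * m' = q ^ (k - s) * (q ^ s * m') := by
    rw [← mul_assoc, ← pow_add]; congr 2; omega
  have h := kd_card (d := q ^ (k - s)) (by positivity) hζ htop ⟨_, hsplit⟩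
  have hcop : ∀ s, Nat.Coprime (q ^ s) m' := fun s =>
    Nat.Coprime.pow_left _ ((Nat.Prime.coprime_iff_not_dvd hq).2 hm')
  rw [hsplit, Nat.mul_div_cancel_left _ (by positivity), ← hsplit, Nat.totient_mul (hcop s),
    Nat.totient_mul (hcop k), ← mul_assoc] at h
  exact Nat.eq_of_mul_eq_mul_right (Nat.totient_pos.2 hm0) h

lemma kd_fix_one {ζ : L} (htop : IntermediateField.adjoin ℚ {ζ} = ⊤) {σ : Gal(L/ℚ)}
    (h : σ ζ = ζ) : σ = 1 := by
  have h1 : σ ∈ kdFix ζ 1 := by rw [kdFix_mem, pow_one]; exact h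
  rw [kdFix_eq, pow_one, htop, IntermediateField.fixingSubgroup_top] at h1
  exact h1

lemma kd_weight {ζ : L} {q k m' : ℕ} (hq : q.Prime) (hm' : ¬ q ∣ m')
    (hζ : IsPrimitiveRoot ζ (q ^ k * m'))
    (htop : IntermediateField.adjoin ℚ {ζ} = ⊤) {σ : Gal(L/ℚ)} (hσ : σ ∈ kdFix ζ (q ^ k))
    (h1 : σ ≠ 1) :
    Real.log ((|Algebra.norm ℚ (ζ - σ ζ)| : ℚ) : ℝ) =
      Module.finrank ℚ L * Real.log q * ∑ s ∈ Finset.range k,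
        if σ ∈ kdFix ζ (q ^ (k - s)) then 1 / (Nat.card (kdFix ζ (q ^ (k - s))) : ℝ) else 0 := by
  have hm0 : 0 < m' := Nat.pos_of_ne_zero (by rintro rfl; exact hm' (dvd_zero _))
  have hq0 := hq.pos
  have hM : q ^ k * m' ≠ 0 := by positivity
  have hζ0 : ζ ≠ 0 := hζ.ne_zero hM
  set ω := σ ζ / ζ with hω
  have hmem : ∀ d, σ ∈ kdFix ζ d ↔ ω ^ d = 1 := by
    intro d
    rw [kdFix_mem, hω, div_pow, map_pow, div_eq_one_iff_eq (pow_ne_zero _ hζ0)]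
  have hω1 : ω ≠ 1 := by
    intro h
    apply h1
    apply kd_fix_one htop
    rwa [hω, div_eq_one_iff_eq hζ0] at h
  obtain ⟨j, hjk, hj⟩ := (Nat.dvd_prime_pow hq).1 (orderOf_dvd_of_pow_eq_one ((hmem _).1 hσ))
  have hj0 : 0 < j := by
    rcases Nat.eq_zero_or_pos j with h | h
    · rw [h, pow_zero, orderOf_eq_one_iff] at hj; exact absurd hj hω1
    · exact h
  have hprim : IsPrimitiveRoot ω (q ^ j) := hj ▸ IsPrimitiveRoot.orderOf ω
  have hnorm : |Algebra.norm ℚ (ζ - σ ζ)| = |Algebra.norm ℚ (ω - 1)| := by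
    have : ζ - σ ζ = (-ζ) * (ω - 1) := by rw [hω]; field_simp; ring
    rw [this, map_mul, abs_mul]
    have h2 : |Algebra.norm ℚ (-ζ)| = 1 := by
      have h3 : (-ζ) ^ (2 * (q ^ k * m')) = 1 := by
        rw [pow_mul, neg_sq, ← pow_mul, mul_comm, pow_mul, hζ.pow_eq_one, one_pow]
      have h4 : |Algebra.norm ℚ (-ζ)| ^ (2 * (q ^ k * m')) = 1 := by
        rw [← abs_pow, ← map_pow, h3, map_one, abs_one]
      exact (pow_eq_one_iff_of_nonneg (abs_nonneg _) (by positivity)).1 h4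
    rw [h2, one_mul]
  rw [hnorm, kd_norm hq hj0 hprim]
  congr 1
  have hiff : ∀ s ∈ Finset.range k, σ ∈ kdFix ζ (q ^ (k - s)) ↔ s ∈ Finset.range (k - j + 1) := by
    intro s hs
    rw [Finset.mem_range] at hs
    rw [hmem, ← orderOf_dvd_iff_pow_eq_one, hj, Nat.pow_dvd_pow_iff_le_right hq.one_lt,
      Finset.mem_range]
    omega
  have hqk : 0 < (q ^ k).totient := Nat.totient_pos.2 (by positivity)
  rw [← Finset.sum_filter]
  have hset : (Finset.range k).filter (fun s => σ ∈ kdFix ζ (q ^ (k - s))) =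
      Finset.range (k - j + 1) := by
    ext s
    rw [Finset.mem_filter]
    constructor
    · rintro ⟨h2, h3⟩; exact (hiff s h2).1 h3
    · intro h2
      have h3 : s ∈ Finset.range k := by
        rw [Finset.mem_range] at h2 ⊢; omega
      exact ⟨h3, (hiff s h3).2 h2⟩
  rw [hset]
  have hterm : ∀ s ∈ Finset.range (k - j + 1), 1 / (Nat.card (kdFix ζ (q ^ (k - s))) : ℝ) =
      ((q ^ s).totient : ℝ) / ((q ^ k).totient : ℝ) := by
    intro s hs
    rw [Finset.mem_range] at hs
    have h2 := kd_card_pow hq hm' hζ htop (s := s) (by omega)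
    have h3 : (Nat.card (kdFix ζ (q ^ (k - s))) : ℝ) ≠ 0 := by
      exact_mod_cast (Nat.card_pos).ne'
    have h4 : ((q ^ k).totient : ℝ) ≠ 0 := by exact_mod_cast hqk.ne'
    rw [div_eq_div_iff h3 h4, one_mul, mul_comm, ← h2]
    push_cast; ring
  rw [Finset.sum_congr rfl hterm, ← Finset.sum_div, ← Nat.cast_sum, kd_sum_tot hq,
    kd_tot_mul hq hj0 hjk]
  have h5 : ((q ^ j).totient : ℝ) ≠ 0 := by
    exact_mod_cast (Nat.totient_pos.2 (by positivity : 0 < q ^ j)).ne'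
  have h6 : (q : ℝ) ≠ 0 := by exact_mod_cast hq0.ne'
  push_cast
  field_simp

end d3

open NumberField

section d4
set_option linter.unusedSectionVars false
open scoped Classical

lemma kd_card_relIndex {G : Type*} [Group G] {A B : Subgroup G} (h : A ≤ B) :
    Nat.card A * A.relIndex B = Nat.card B := by
  have := Subgroup.relIndex_mul_relIndex ⊥ A B bot_le h
  rwa [Subgroup.relIndex_bot_left, Subgroup.relIndex_bot_left] at this

lemma kd_frac {G : Type*} [Group G] [Fintype G] (H A : Subgroup G) :
    ∑ σ : G with σ ∈ A ∧ σ ∉ H, 1 / (Nat.card A : ℝ) = 1 - 1 / (H.relIndex A : ℝ) := by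
  have h1 : H.relIndex A * Nat.card (H ⊓ A : Subgroup G) = Nat.card A := by
    rw [← Subgroup.inf_relIndex_right, mul_comm]
    exact kd_card_relIndex inf_le_right
  have h2 : ((Finset.univ.filter fun σ : G => σ ∈ A ∧ σ ∉ H).card : ℝ) =
      Nat.card A - Nat.card (H ⊓ A : Subgroup G) := by
    have ha : Nat.card A = (Finset.univ.filter fun σ : G => σ ∈ A).card := by
      rw [Nat.card_eq_fintype_card]; exact Fintype.card_subtype _
    have hb : Nat.card (H ⊓ A : Subgroup G) =
        ((Finset.univ.filter fun σ : G => σ ∈ A).filter fun σ => σ ∈ H).card := by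
      rw [Nat.card_eq_fintype_card, Finset.filter_filter]
      refine (Fintype.card_subtype _).trans ?_
      congr 1
      ext σ
      simp only [Finset.mem_filter, Subgroup.mem_inf, Finset.mem_univ, true_and]
      exact and_comm
    have hc := Finset.card_filter_add_card_filter_not (s := Finset.univ.filter fun σ : G => σ ∈ A)
      (fun σ => σ ∈ H)
    rw [← ha, ← hb, Finset.filter_filter] at hc
    rw [← hc]; push_cast; ring
  rw [Finset.sum_const, nsmul_eq_mul, h2]
  have h3 : (Nat.card A : ℝ) ≠ 0 := by exact_mod_cast (Nat.card_pos).ne'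
  have h4 : (H.relIndex A : ℝ) ≠ 0 := by
    intro h
    have : H.relIndex A = 0 := by exact_mod_cast h
    rw [this, zero_mul] at h1
    exact Nat.card_pos.ne h1
  rw [← h1] at h3 ⊢
  push_cast at h3 ⊢
  have h5 : (Nat.card (H ⊓ A : Subgroup G) : ℝ) ≠ 0 := right_ne_zero_of_mul h3
  field_simp

lemma kd_numeric {q r e : ℕ} (hq : 2 ≤ q) (he : 2 ≤ e) (her : e + 1 ≤ q ^ r) :
    Real.log (4 / 3 * e) ≤ Real.log q * (r + 1 - 2 / e) := by
  have hq' : (2 : ℝ) ≤ q := by exact_mod_cast hq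
  have he' : (2 : ℝ) ≤ e := by exact_mod_cast he
  have her' : (e : ℝ) + 1 ≤ (q : ℝ) ^ r := by exact_mod_cast her
  have hlq : Real.log 2 ≤ Real.log q := Real.log_le_log (by norm_num) hq'
  have hl2 : 0 < Real.log 2 := Real.log_pos (by norm_num)
  have hr : Real.log (e + 1) ≤ r * Real.log q := by
    rw [← Real.log_pow]; exact Real.log_le_log (by linarith) her'
  have hdiv : (2 : ℝ) / e ≤ 1 := by rw [div_le_one (by linarith)]; exact he'
  by_cases h4 : e ≤ 3
  · have h4' : (e : ℝ) ≤ 3 := by exact_mod_cast h4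
    have h5 : Real.log (4 / 3 * e) ≤ Real.log (e + 1) :=
      Real.log_le_log (by linarith) (by linarith)
    have h6 : 0 ≤ Real.log q * (1 - 2 / e) := mul_nonneg (by linarith) (by linarith)
    nlinarith
  · have h4' : (4 : ℝ) ≤ e := by exact_mod_cast (show 4 ≤ e by omega)
    have h5 : Real.log e ≤ Real.log (e + 1) := Real.log_le_log (by linarith) (by linarith)
    have h6 : Real.log (4 / 3) ≤ Real.log 2 / 2 := by
      have : 2 * Real.log (4 / 3) ≤ Real.log 2 := by
        have : Real.log ((4 / 3 : ℝ) ^ 2) = 2 * Real.log (4 / 3) := by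
          rw [Real.log_pow]; norm_num
        rw [← this]
        exact Real.log_le_log (by norm_num) (by norm_num)
      linarith
    have h7 : (2 : ℝ) / e ≤ 1 / 2 := by rw [div_le_div_iff₀ (by linarith) (by norm_num)]; linarith
    have h8 : Real.log 2 / 2 ≤ Real.log q * (1 - 2 / e) := by nlinarith
    rw [Real.log_mul (by norm_num) (by linarith)]
    nlinarith

variable {L : Type*} [Field L] [NumberField L] [IsGalois ℚ L]

lemma kd_mono {ζ : L} {d e : ℕ} (h : d ∣ e) : kdFix ζ d ≤ kdFix ζ e := by
  intro σ hσ
  obtain ⟨c, rfl⟩ := h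
  rw [kdFix_mem] at hσ ⊢
  rw [pow_mul, map_pow, hσ]

/-- Contribution of the prime `q`. -/
lemma kd_prime_sum {ζ : L} {q k m' : ℕ} (hq : q.Prime) (hm' : ¬ q ∣ m')
    (hζ : IsPrimitiveRoot ζ (q ^ k * m'))
    (htop : IntermediateField.adjoin ℚ {ζ} = ⊤) (H : Subgroup Gal(L/ℚ)) :
    ∑ σ : Gal(L/ℚ) with σ ∈ kdFix ζ (q ^ k) ∧ σ ∉ H,
      Real.log ((|Algebra.norm ℚ (ζ - σ ζ)| : ℚ) : ℝ) =
    Module.finrank ℚ L * Real.log q * ∑ s ∈ Finset.range k,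
      (1 - 1 / (H.relIndex (kdFix ζ (q ^ (k - s))) : ℝ)) := by
  have h1 : ∀ σ ∈ Finset.univ.filter (fun σ : Gal(L/ℚ) => σ ∈ kdFix ζ (q ^ k) ∧ σ ∉ H),
      Real.log ((|Algebra.norm ℚ (ζ - σ ζ)| : ℚ) : ℝ) =
      Module.finrank ℚ L * Real.log q * ∑ s ∈ Finset.range k,
        if σ ∈ kdFix ζ (q ^ (k - s)) then 1 / (Nat.card (kdFix ζ (q ^ (k - s))) : ℝ) else 0 := by
    intro σ hσ
    rw [Finset.mem_filter] at hσ
    refine kd_weight hq hm' hζ htop hσ.2.1 ?_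
    rintro rfl; exact hσ.2.2 H.one_mem
  rw [Finset.sum_congr rfl h1, ← Finset.mul_sum, Finset.sum_comm]
  congr 1
  refine Finset.sum_congr rfl fun s _ => ?_
  rw [← kd_frac, ← Finset.sum_filter, Finset.filter_filter]
  refine Finset.sum_congr ?_ fun _ _ => rfl
  ext σ
  simp only [Finset.mem_filter, Finset.mem_univ, true_and]
  have : kdFix ζ (q ^ (k - s)) ≤ kdFix ζ (q ^ k) := kd_mono (pow_dvd_pow _ (Nat.sub_le _ _))
  constructor
  · rintro ⟨⟨_, h2⟩, h3⟩; exact ⟨h3, h2⟩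
  · rintro ⟨h3, h2⟩; exact ⟨⟨this h3, h2⟩, h3⟩

lemma kd_prime_bound {ζ : L} {q k m' : ℕ} (hq : q.Prime) (hm' : ¬ q ∣ m')
    (hζ : IsPrimitiveRoot ζ (q ^ k * m'))
    (htop : IntermediateField.adjoin ℚ {ζ} = ⊤) (H : Subgroup Gal(L/ℚ))
    (he : 2 ≤ H.relIndex (kdFix ζ (q ^ k))) :
    Real.log (4 / 3 * H.relIndex (kdFix ζ (q ^ k))) ≤ 2 * (Real.log q * ∑ s ∈ Finset.range k,
      (1 - 1 / (H.relIndex (kdFix ζ (q ^ (k - s))) : ℝ))) := by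
  set e := H.relIndex (kdFix ζ (q ^ k)) with hedef
  have hpos : ∀ A : Subgroup Gal(L/ℚ), 0 < H.relIndex A := fun A =>
    Nat.pos_of_ne_zero Subgroup.FiniteIndex.index_ne_zero
  -- the first index where the filtration is inside `H`
  have hex : ∃ r, r ≤ k ∧ kdFix ζ (q ^ (k - r)) ≤ H := by
    refine ⟨k, le_rfl, fun σ hσ => ?_⟩
    rw [Nat.sub_self, pow_zero, kdFix_mem, pow_one] at hσ
    rw [kd_fix_one htop hσ]; exact H.one_mem
  set r := Nat.find hex with hr
  obtain ⟨hrk, hrH⟩ := Nat.find_spec hex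
  have hlt : ∀ s < r, ¬ kdFix ζ (q ^ (k - s)) ≤ H := by
    intro s hs h
    exact Nat.find_min hex hs ⟨by omega, h⟩
  have hr0 : r ≠ 0 := by
    intro h0
    rw [← hr, h0, Nat.sub_zero] at hrH
    have : e = 1 := Subgroup.relIndex_eq_one.2 hrH
    omega
  have her : e + 1 ≤ q ^ r := by
    have h1 : e ≤ (kdFix ζ (q ^ (k - r))).relIndex (kdFix ζ (q ^ k)) :=
      Subgroup.relIndex_le_of_le_left hrH (Subgroup.FiniteIndex.index_ne_zero)
    have h2 : (kdFix ζ (q ^ (k - r))).relIndex (kdFix ζ (q ^ k)) = (q ^ r).totient := by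
      have h3 := kd_card_relIndex
        (kd_mono (ζ := ζ) (pow_dvd_pow q (Nat.sub_le k r)))
      have h4 := kd_card_pow hq hm' hζ htop hrk
      have h5 := kd_card_pow hq hm' hζ htop (Nat.zero_le k)
      rw [Nat.sub_zero, pow_zero, Nat.totient_one, mul_one] at h5
      rw [h5, ← h4] at h3
      exact Nat.eq_of_mul_eq_mul_left Nat.card_pos h3
    have h6 : (q ^ r).totient < q ^ r := Nat.totient_lt _ (Nat.one_lt_pow hr0 hq.one_lt)
    omega
  refine (kd_numeric hq.two_le he her).trans ?_
  have hlq : 0 ≤ Real.log q := Real.log_natCast_nonneg q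
  have hsum : ((r : ℝ) + 1 - 2 / e) / 2 ≤ ∑ s ∈ Finset.range k,
      (1 - 1 / (H.relIndex (kdFix ζ (q ^ (k - s))) : ℝ)) := by
    have hnn : ∀ A : Subgroup Gal(L/ℚ), 0 ≤ 1 - 1 / (H.relIndex A : ℝ) := by
      intro A
      have : (1 : ℝ) ≤ H.relIndex A := by exact_mod_cast hpos A
      rw [sub_nonneg, div_le_one (by linarith)]; exact this
    have h1 : ∑ s ∈ Finset.range r, (1 - 1 / (H.relIndex (kdFix ζ (q ^ (k - s))) : ℝ)) ≤
        ∑ s ∈ Finset.range k, (1 - 1 / (H.relIndex (kdFix ζ (q ^ (k - s))) : ℝ)) :=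
      Finset.sum_le_sum_of_subset_of_nonneg (Finset.range_mono hrk) fun s _ _ => hnn _
    refine le_trans ?_ h1
    obtain ⟨t, ht⟩ : ∃ t, r = t + 1 := ⟨r - 1, by omega⟩
    rw [ht, Finset.sum_range_succ', Nat.sub_zero, ← hedef]
    have h2 : ∑ s ∈ Finset.range t, (1 / 2 : ℝ) ≤
        ∑ s ∈ Finset.range t, (1 - 1 / (H.relIndex (kdFix ζ (q ^ (k - (s + 1)))) : ℝ)) := by
      refine Finset.sum_le_sum fun s hs => ?_
      rw [Finset.mem_range] at hs
      have h3 := hlt (s + 1) (by omega)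
      rw [← Subgroup.relIndex_eq_one] at h3
      have h4 := hpos (kdFix ζ (q ^ (k - (s + 1))))
      have h5 : (2 : ℝ) ≤ H.relIndex (kdFix ζ (q ^ (k - (s + 1)))) := by
        exact_mod_cast (show 2 ≤ _ by omega)
      have h6 : (1 : ℝ) / H.relIndex (kdFix ζ (q ^ (k - (s + 1)))) ≤ 1 / 2 :=
        one_div_le_one_div_of_le (by norm_num) h5
      linarith
    rw [Finset.sum_const, Finset.card_range, nsmul_eq_mul] at h2
    push_cast
    have h7 : (2 : ℝ) / e = 2 * (1 / e) := by ring
    rw [h7]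
    linarith
  nlinarith

end d4

open NumberField

section d5
set_option linter.unusedSectionVars false
open scoped Classical

lemma kd_relIndex_pos {G : Type*} [Group G] [Finite G] (H A : Subgroup G) : 0 < H.relIndex A :=
  Nat.pos_of_ne_zero Subgroup.FiniteIndex.index_ne_zero

lemma kd_relIndex_le {G : Type*} [Group G] [Finite G] (H A B C : Subgroup G) (hA : A ≤ C)
    (hB : B ≤ C) (hd : Disjoint A B) (hc : Nat.card C = Nat.card A * Nat.card B) :
    H.relIndex C ≤ H.relIndex A * H.relIndex B := by
  have h1 : ∀ A : Subgroup G, Nat.card (H ⊓ A : Subgroup G) * H.relIndex A = Nat.card A := by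
    intro A
    rw [← Subgroup.inf_relIndex_right]
    exact kd_card_relIndex inf_le_right
  have h2 : Nat.card (H ⊓ A : Subgroup G) * Nat.card (H ⊓ B : Subgroup G) ≤
      Nat.card (H ⊓ C : Subgroup G) := by
    rw [← Nat.card_prod]
    have hd' : Disjoint (H ⊓ A) (H ⊓ B) := hd.mono inf_le_right inf_le_right
    let f : (H ⊓ A : Subgroup G) × (H ⊓ B : Subgroup G) → (H ⊓ C : Subgroup G) := fun g =>
      ⟨(g.1 : G) * (g.2 : G), mul_mem g.1.2.1 g.2.2.1, mul_mem (hA g.1.2.2) (hB g.2.2.2)⟩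
    refine Nat.card_le_card_of_injective f ?_
    intro x y hxy
    exact Subgroup.mul_injective_of_disjoint hd' (congrArg Subtype.val hxy)
  have hpos : 0 < Nat.card (H ⊓ A : Subgroup G) * Nat.card (H ⊓ B : Subgroup G) :=
    Nat.mul_pos Nat.card_pos Nat.card_pos
  refine Nat.le_of_mul_le_mul_left ?_ hpos
  calc _ ≤ Nat.card (H ⊓ C : Subgroup G) * H.relIndex C := Nat.mul_le_mul_right _ h2
    _ = Nat.card A * Nat.card B := by rw [h1, hc]
    _ = _ := by rw [← h1 A, ← h1 B]; ring

variable {L : Type*} [Field L] [NumberField L] [IsGalois ℚ L]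

lemma kd_card_full {ζ : L} {d e : ℕ} (hm : 0 < d * e) (hζ : IsPrimitiveRoot ζ (d * e))
    (htop : IntermediateField.adjoin ℚ {ζ} = ⊤) (hc : d.Coprime e) :
    Nat.card (kdFix ζ d) = d.totient := by
  have h := kd_card hm hζ htop (Dvd.intro _ rfl)
  have hd0 : 0 < d := Nat.pos_of_mul_pos_right hm
  have he0 : 0 < e := Nat.pos_of_mul_pos_left hm
  rw [Nat.mul_div_cancel_left _ hd0, Nat.totient_mul hc] at h
  exact Nat.eq_of_mul_eq_mul_right (Nat.totient_pos.2 he0) h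

lemma kd_disjoint {ζ : L} (hζ0 : ζ ≠ 0) (htop : IntermediateField.adjoin ℚ {ζ} = ⊤) {d e : ℕ}
    (hc : d.Coprime e) : Disjoint (kdFix ζ d) (kdFix ζ e) := by
  rw [Subgroup.disjoint_def]
  intro σ h1 h2
  have hmem : ∀ d, σ ∈ kdFix ζ d ↔ (σ ζ / ζ) ^ d = 1 := by
    intro d
    rw [kdFix_mem, div_pow, map_pow, div_eq_one_iff_eq (pow_ne_zero _ hζ0)]
  rw [hmem] at h1 h2
  apply kd_fix_one htop
  have h3 : orderOf (σ ζ / ζ) ∣ 1 := by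
    rw [← hc.gcd_eq_one]
    exact Nat.dvd_gcd (orderOf_dvd_of_pow_eq_one h1) (orderOf_dvd_of_pow_eq_one h2)
  rwa [Nat.dvd_one, orderOf_eq_one_iff, div_eq_one_iff_eq hζ0] at h3

lemma kd_prod_relIndex {ζ : L} {m : ℕ} (hm : 0 < m) (hζ : IsPrimitiveRoot ζ m)
    (htop : IntermediateField.adjoin ℚ {ζ} = ⊤) (H : Subgroup Gal(L/ℚ)) :
    H.index ≤ ∏ q ∈ m.primeFactors, H.relIndex (kdFix ζ (q ^ m.factorization q)) := by
  have hζ0 : ζ ≠ 0 := hζ.ne_zero hm.ne'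
  have hprod : ∏ q ∈ m.primeFactors, q ^ m.factorization q = m :=
    Nat.prod_factorization_pow_eq_self hm.ne'
  have hcop : ∀ S T : Finset ℕ, S ⊆ m.primeFactors → T ⊆ m.primeFactors → Disjoint S T →
      (∏ q ∈ S, q ^ m.factorization q).Coprime (∏ q ∈ T, q ^ m.factorization q) := by
    intro S T hS hT hST
    refine Nat.Coprime.prod_left fun p hp => Nat.Coprime.prod_right fun q hq => ?_
    refine Nat.Coprime.pow _ _ ?_
    rw [Nat.coprime_primes (Nat.prime_of_mem_primeFactors (hS hp))
      (Nat.prime_of_mem_primeFactors (hT hq))]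
    rintro rfl
    exact Finset.disjoint_left.1 hST hp hq
  have hcard : ∀ S ⊆ m.primeFactors, Nat.card (kdFix ζ (∏ q ∈ S, q ^ m.factorization q)) =
      (∏ q ∈ S, q ^ m.factorization q).totient := by
    intro S hS
    have h1 : (∏ q ∈ S, q ^ m.factorization q) *
        (∏ q ∈ m.primeFactors \ S, q ^ m.factorization q) = m := by
      rw [mul_comm, Finset.prod_sdiff hS, hprod]
    refine kd_card_full (by rw [h1]; exact hm) (by rw [h1]; exact hζ) htop
      (hcop _ _ hS Finset.sdiff_subset Finset.disjoint_sdiff)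
  have key : ∀ S : Finset ℕ, S ⊆ m.primeFactors →
      H.relIndex (kdFix ζ (∏ q ∈ S, q ^ m.factorization q)) ≤
      ∏ q ∈ S, H.relIndex (kdFix ζ (q ^ m.factorization q)) := by
    intro S
    induction S using Finset.induction_on with
    | empty =>
      intro _
      rw [Finset.prod_empty, Finset.prod_empty]
      refine le_of_eq (Subgroup.relIndex_eq_one.2 fun σ hσ => ?_)
      rw [kdFix_mem, pow_one] at hσ
      rw [kd_fix_one htop hσ]; exact H.one_mem
    | insert p S hp ih =>
      intro hS
      have hS' : S ⊆ m.primeFactors := (Finset.subset_insert _ _).trans hS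
      have hp' : ({p} : Finset ℕ) ⊆ m.primeFactors :=
        Finset.singleton_subset_iff.2 (hS (Finset.mem_insert_self _ _))
      have hc := hcop _ _ hp' hS' (Finset.disjoint_singleton_left.2 hp)
      have hcp := hcard _ hp'
      have hci := hcard _ hS
      rw [Finset.prod_singleton] at hc hcp
      rw [Finset.prod_insert hp] at hci
      rw [Finset.prod_insert hp, Finset.prod_insert hp]
      refine (kd_relIndex_le H _ _ _ (kd_mono (Dvd.intro _ rfl)) (kd_mono (Dvd.intro_left _ rfl))
        (kd_disjoint hζ0 htop hc) ?_).trans (Nat.mul_le_mul_left _ (ih hS'))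
      rw [hci, hcp, hcard _ hS', Nat.totient_mul hc]
  have h := key _ subset_rfl
  rw [hprod] at h
  have htop' : kdFix ζ m = ⊤ := by
    rw [eq_top_iff]
    intro σ _
    rw [kdFix_mem, hζ.pow_eq_one, map_one]
  rwa [htop', Subgroup.relIndex_top_right] at h

/-- sum of all contributions -/
lemma kd_total {ζ : L} {m : ℕ} (hm : 0 < m) (hζ : IsPrimitiveRoot ζ m)
    (htop : IntermediateField.adjoin ℚ {ζ} = ⊤) (H : Subgroup Gal(L/ℚ)) (hH : 2 ≤ H.index) :
    Module.finrank ℚ L * Real.log (4 / 3 * H.index) ≤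
      2 * ∑ σ : Gal(L/ℚ) with σ ∉ H, Real.log ((|Algebra.norm ℚ (ζ - σ ζ)| : ℚ) : ℝ) := by
  have hζ0 : ζ ≠ 0 := hζ.ne_zero hm.ne'
  set A : ℕ → Subgroup Gal(L/ℚ) := fun q => kdFix ζ (q ^ m.factorization q) with hA
  set w : Gal(L/ℚ) → ℝ := fun σ => Real.log ((|Algebra.norm ℚ (ζ - σ ζ)| : ℚ) : ℝ) with hw
  have hw0 : ∀ σ, 0 ≤ w σ := by
    intro σ
    by_cases h0 : ζ - σ ζ = 0
    · simp [hw, h0]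
    have hintg : IsIntegral ℤ (ζ - σ ζ) := by
      have h1 : IsIntegral ℤ ζ := hζ.isIntegral hm
      exact h1.sub (h1.map (σ : L →ₐ[ℚ] L))
    obtain ⟨z, hz⟩ := IsIntegrallyClosed.isIntegral_iff.1 (Algebra.isIntegral_norm ℚ hintg)
    have hz0 : z ≠ 0 := by
      rintro rfl
      rw [map_zero] at hz
      exact h0 (Algebra.norm_eq_zero_iff.1 hz.symm)
    apply Real.log_nonneg
    rw [← hz]
    have : (1 : ℤ) ≤ |z| := Int.one_le_abs hz0
    simp only [eq_intCast]
    exact_mod_cast this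
  have hsub : ∑ q ∈ m.primeFactors, ∑ σ : Gal(L/ℚ) with σ ∈ A q ∧ σ ∉ H, w σ ≤
      ∑ σ : Gal(L/ℚ) with σ ∉ H, w σ := by
    rw [← Finset.sum_biUnion]
    · refine Finset.sum_le_sum_of_subset_of_nonneg ?_ fun σ _ _ => hw0 σ
      intro σ hσ
      rw [Finset.mem_biUnion] at hσ
      obtain ⟨q, _, hq⟩ := hσ
      rw [Finset.mem_filter] at hq ⊢
      exact ⟨hq.1, hq.2.2⟩
    · intro p hp q hq hpq
      rw [Function.onFun, Finset.disjoint_left]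
      intro σ h1 h2
      rw [Finset.mem_filter] at h1 h2
      have hc : (p ^ m.factorization p).Coprime (q ^ m.factorization q) :=
        Nat.Coprime.pow _ _ ((Nat.coprime_primes (Nat.prime_of_mem_primeFactors hp)
          (Nat.prime_of_mem_primeFactors hq)).2 hpq)
      have := Subgroup.disjoint_def.1 (kd_disjoint hζ0 htop hc) h1.2.1 h2.2.1
      rw [this] at h1
      exact h1.2.2 H.one_mem
  have hn : 0 < Module.finrank ℚ L := Module.finrank_pos
  -- each prime
  have hprime : ∀ q ∈ m.primeFactors, 2 ≤ H.relIndex (A q) →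
      Module.finrank ℚ L * Real.log (4 / 3 * H.relIndex (A q)) ≤
      2 * ∑ σ : Gal(L/ℚ) with σ ∈ A q ∧ σ ∉ H, w σ := by
    intro q hq h2
    have hqp := Nat.prime_of_mem_primeFactors hq
    have hm' : ¬ q ∣ m / q ^ m.factorization q := Nat.not_dvd_ordCompl hqp hm.ne'
    have hζ' : IsPrimitiveRoot ζ (q ^ m.factorization q * (m / q ^ m.factorization q)) := by
      rw [Nat.ordProj_mul_ordCompl_eq_self]; exact hζ
    have h3 := kd_prime_bound hqp hm' hζ' htop H h2
    rw [show ∑ σ : Gal(L/ℚ) with σ ∈ A q ∧ σ ∉ H, w σ = _ from kd_prime_sum hqp hm' hζ' htop H]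
    calc _ ≤ _ := mul_le_mul_of_nonneg_left h3 (Nat.cast_nonneg _)
      _ = _ := by ring
  have hle := kd_prod_relIndex hm hζ htop H
  set T := m.primeFactors.filter fun q => 2 ≤ H.relIndex (A q) with hT
  have hT1 : ∏ q ∈ m.primeFactors, H.relIndex (A q) = ∏ q ∈ T, H.relIndex (A q) := by
    symm
    refine Finset.prod_subset (Finset.filter_subset _ _) fun q hq h => ?_
    rw [hT, Finset.mem_filter] at h
    have := kd_relIndex_pos H (A q)
    by_contra h1
    exact h ⟨hq, by omega⟩
  have hTne : T.Nonempty := by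
    rw [Finset.nonempty_iff_ne_empty]
    intro h
    rw [h, Finset.prod_empty] at hT1
    have : H.index ≤ 1 := hle.trans hT1.le
    omega
  obtain ⟨p, hp⟩ := hTne
  have hlog : Real.log (4 / 3 * H.index) ≤ ∑ q ∈ T, Real.log (4 / 3 * H.relIndex (A q)) := by
    have hpos : ∀ q, (0 : ℝ) < H.relIndex (A q) := fun q => by
      exact_mod_cast kd_relIndex_pos H (A q)
    rw [← Real.log_prod (fun q _ => (mul_pos (by norm_num) (hpos q)).ne'), Finset.prod_mul_distrib]
    refine Real.log_le_log (by have : (2 : ℝ) ≤ H.index := by exact_mod_cast hH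
                               linarith) ?_
    have h1 : (H.index : ℝ) ≤ ∏ q ∈ T, (H.relIndex (A q) : ℝ) := by
      have := hle.trans hT1.le
      exact_mod_cast this
    have h2 : (4 / 3 : ℝ) ≤ ∏ q ∈ T, (4 / 3 : ℝ) := by
      rw [Finset.prod_const]
      exact le_self_pow₀ (by norm_num) (Finset.card_ne_zero_of_mem hp)
    exact mul_le_mul h2 h1 (Nat.cast_nonneg _) (by linarith)
  calc _ ≤ Module.finrank ℚ L * ∑ q ∈ T, Real.log (4 / 3 * H.relIndex (A q)) :=
        mul_le_mul_of_nonneg_left hlog (Nat.cast_nonneg _)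
    _ = ∑ q ∈ T, Module.finrank ℚ L * Real.log (4 / 3 * H.relIndex (A q)) := Finset.mul_sum _ _ _
    _ ≤ ∑ q ∈ T, 2 * ∑ σ : Gal(L/ℚ) with σ ∈ A q ∧ σ ∉ H, w σ := by
        refine Finset.sum_le_sum fun q hq => ?_
        rw [hT, Finset.mem_filter] at hq
        exact hprime q hq.1 hq.2
    _ = 2 * ∑ q ∈ T, ∑ σ : Gal(L/ℚ) with σ ∈ A q ∧ σ ∉ H, w σ := (Finset.mul_sum _ _ _).symm
    _ ≤ 2 * ∑ q ∈ m.primeFactors, ∑ σ : Gal(L/ℚ) with σ ∈ A q ∧ σ ∉ H, w σ := by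
        refine mul_le_mul_of_nonneg_left ?_ (by norm_num)
        exact Finset.sum_le_sum_of_subset_of_nonneg (Finset.filter_subset _ _)
          fun q _ _ => Finset.sum_nonneg fun σ _ => hw0 σ
    _ ≤ _ := mul_le_mul_of_nonneg_left hsub (by norm_num)

end d5

open NumberField

section d6
set_option linter.unusedSectionVars false
open scoped Classical

lemma kd_bound_of {K L : Type} [Field K] [NumberField K] [Field L] [NumberField L] [Algebra K L]
    [IsGalois ℚ L] {m : ℕ} (hm : 0 < m) {ζ : L} (hζ : IsPrimitiveRoot ζ m)
    (htop : IntermediateField.adjoin ℚ {ζ} = ⊤) (hn : 2 ≤ Module.finrank ℚ K) :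
    Module.finrank ℚ K * Real.log (4 / 3 * Module.finrank ℚ K) ≤
      2 * Real.log |(discr K : ℝ)| := by
  have : NeZero m := ⟨hm.ne'⟩
  have hz : Algebra.adjoin ℚ {ζ} = ⊤ := by
    rw [← IntermediateField.adjoin_simple_toSubalgebra_of_isAlgebraic
      (Algebra.IsAlgebraic.isAlgebraic ζ), htop, IntermediateField.top_toSubalgebra]
  have hcyc : IsCyclotomicExtension {m} ℚ L := by
    rw [IsCyclotomicExtension.iff_singleton]
    refine ⟨⟨ζ, hζ⟩, fun x => ?_⟩
    have hx : x ∈ Algebra.adjoin ℚ {ζ} := by rw [hz]; exact Algebra.mem_top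
    refine Algebra.adjoin_mono ?_ hx
    rintro _ rfl
    exact hζ.pow_eq_one
  let F : IntermediateField ℚ L := (IsScalarTower.toAlgHom ℚ K L).fieldRange
  let H : Subgroup Gal(L/ℚ) := F.fixingSubgroup
  have hH : ∀ σ, σ ∈ H ↔ ∀ x : K, σ (algebraMap K L x) = algebraMap K L x := by
    intro σ
    change σ ∈ F.fixingSubgroup ↔ _
    rw [IntermediateField.mem_fixingSubgroup_iff]
    constructor
    · intro h x
      exact h _ ⟨x, rfl⟩
    · rintro h _ ⟨x, rfl⟩
      exact h x
  have hidx : H.index = Module.finrank ℚ K := by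
    have h1 : Module.finrank ℚ F = H.index := IntermediateField.finrank_eq_fixingSubgroup_index L F
    rw [← h1]
    exact ((AlgEquiv.ofInjectiveField (IsScalarTower.toAlgHom ℚ K L)).toLinearEquiv.finrank_eq).symm
  have hcard : Module.finrank ℚ K * Nat.card H = Module.finrank ℚ L := by
    rw [← hidx, Subgroup.index_mul_card, IsGalois.card_aut_eq_finrank]
  have h1 := kd_main hζ hz H hH
  have h2 := kd_total hm hζ htop H (by rw [hidx]; exact hn)
  have hne : ∀ σ ∈ Finset.univ.filter (fun σ : Gal(L/ℚ) => σ ∉ H),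
      ((|Algebra.norm ℚ (ζ - σ ζ)| : ℚ) : ℝ) ≠ 0 := by
    intro σ hσ h0
    rw [Finset.mem_filter] at hσ
    have h3 : |Algebra.norm ℚ (ζ - σ ζ)| = 0 := by exact_mod_cast h0
    rw [abs_eq_zero, Algebra.norm_eq_zero_iff, sub_eq_zero] at h3
    have h4 := kd_fix_one htop h3.symm
    rw [h4] at hσ
    exact hσ.2 H.one_mem
  rw [← Real.log_prod hne] at h2
  have h1' : ∏ σ : Gal(L/ℚ) with σ ∉ H, ((|Algebra.norm ℚ (ζ - σ ζ)| : ℚ) : ℝ) ≤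
      |(discr K : ℝ)| ^ Nat.card H := by
    have h5 : (((∏ σ : Gal(L/ℚ) with σ ∉ H, |Algebra.norm ℚ (ζ - σ ζ)| : ℚ)) : ℝ) ≤
      (((((discr K).natAbs : ℕ) : ℚ) ^ Nat.card H : ℚ) : ℝ) := Rat.cast_le.2 h1
    rw [Rat.cast_prod] at h5
    refine h5.trans (le_of_eq ?_)
    push_cast
    rw [Nat.cast_natAbs, Int.cast_abs]
  have hpos : 0 < ∏ σ : Gal(L/ℚ) with σ ∉ H, ((|Algebra.norm ℚ (ζ - σ ζ)| : ℚ) : ℝ) := by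
    refine Finset.prod_pos fun σ hσ => lt_of_le_of_ne ?_ (hne σ hσ).symm
    exact_mod_cast abs_nonneg _
  have h6 := Real.log_le_log hpos h1'
  rw [Real.log_pow] at h6
  have hcpos : (0 : ℝ) < Nat.card H := by exact_mod_cast Nat.card_pos
  rw [hidx, ← hcard] at h2
  rw [Nat.cast_mul] at h2
  have h7 : (Nat.card H : ℝ) * (Module.finrank ℚ K * Real.log (4 / 3 * Module.finrank ℚ K)) ≤
      Nat.card H * (2 * Real.log |(discr K : ℝ)|) := by linarith
  exact le_of_mul_le_mul_left h7 hcpos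

/-- Discriminant lower bound for abelian fields. -/
lemma kd_abelian (K : Type) [Field K] [NumberField K] [IsGalois ℚ K]
    (hK : ∀ σ τ : Gal(K/ℚ), σ * τ = τ * σ) (hn : 2 ≤ Module.finrank ℚ K) :
    Module.finrank ℚ K * Real.log (4 / 3 * Module.finrank ℚ K) ≤
      2 * Real.log |(discr K : ℝ)| := by
  obtain ⟨m, hm, h⟩ := kw_complex K hK
  let j : K →ₐ[ℚ] ℂ := IsAlgClosed.lift
  have hζ := Complex.isPrimitiveRoot_exp m hm.ne'
  set ζ := Complex.exp (2 * Real.pi * Complex.I / m) with hζdef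
  have hj := h j ζ hζ
  obtain ⟨L, _, _, _, φ, jj, z, h1, h2, h3⟩ := kw_comp_type j hm hζ
  have hr : φ.fieldRange = IntermediateField.adjoin ℚ {ζ} := by
    rw [h1, sup_eq_right]
    rintro _ ⟨x, rfl⟩
    exact hj x
  have hz : IsPrimitiveRoot z m := by
    rw [← h3] at hζ
    exact hζ.of_map_of_injective (f := φ) φ.injective
  have htop : IntermediateField.adjoin ℚ {z} = ⊤ := by
    apply IntermediateField.map_injective φ
    rw [IntermediateField.adjoin_map, Set.image_singleton, h3, ← hr,
      AlgHom.fieldRange_eq_map]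
  letI : Algebra K L := jj.toRingHom.toAlgebra
  exact kd_bound_of hm hz htop hn

lemma kd_const : 2 * (Real.pi / 2 + (Real.log (8 * Real.pi) + 2 / 3)) <
    Real.log (4 / 3 * 46369) := by
  have h1 : Real.pi < 3.15 := Real.pi_lt_d2
  have hp := Real.pi_pos
  have h2 : Real.log (8 * Real.pi) ≤ Real.log 25.2 :=
    Real.log_le_log (by linarith) (by linarith)
  have h3 : (9 / 2 : ℝ) ≤ Real.log 91 := by
    rw [Real.le_log_iff_exp_le (by norm_num)]
    have h4 : Real.exp (9 / 2) ^ 2 = Real.exp 1 ^ 9 := by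
      rw [← Real.exp_nat_mul, ← Real.exp_nat_mul]; norm_num
    have h5 : Real.exp 1 ^ 9 ≤ (2.7182818286 : ℝ) ^ 9 :=
      pow_le_pow_left₀ (Real.exp_pos 1).le Real.exp_one_lt_d9.le 9
    have h6 : (2.7182818286 : ℝ) ^ 9 ≤ 91 ^ 2 := by norm_num
    exact (sq_le_sq₀ (Real.exp_pos _).le (by norm_num)).1 (by linarith)
  have h7 : Real.log 91 + 2 * Real.log 25.2 < Real.log (4 / 3 * 46369) := by
    have : 2 * Real.log (25.2 : ℝ) = Real.log (25.2 ^ 2) := by rw [Real.log_pow]; norm_num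
    rw [this, ← Real.log_mul (by norm_num) (by norm_num)]
    exact Real.log_lt_log (by norm_num) (by norm_num)
  linarith

/-- Both consequences of criticality, for abstract fields. -/
lemma kd_critical (K : Type) [Field K] [NumberField K] [IsGalois ℚ K]
    (hK : ∀ σ τ : Gal(K/ℚ), σ * τ = τ * σ)
    (hc : Real.log |(discr K : ℝ)| = (InfinitePlace.nrRealPlaces K : ℝ) * (Real.pi / 2) +
      (Module.finrank ℚ K : ℝ) * (Real.log (8 * Real.pi) + Real.eulerMascheroniConstant)) :
    Module.finrank ℚ K < 46369 ∧ |(discr K : ℝ)| ≤ Real.exp (46369 * (Real.log (4 / 3 * 46369))) := by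
  have hr : InfinitePlace.nrRealPlaces K ≤ Module.finrank ℚ K := by
    rw [← InfinitePlace.card_add_two_mul_card_eq_rank]; exact Nat.le_add_right _ _
  have hr' : (InfinitePlace.nrRealPlaces K : ℝ) ≤ Module.finrank ℚ K := by exact_mod_cast hr
  have hγ := Real.eulerMascheroniConstant_lt_two_thirds
  have hpi := Real.pi_pos
  have hconst := kd_const
  have hn0 : (0 : ℝ) < Module.finrank ℚ K := by exact_mod_cast (Module.finrank_pos (R := ℚ) (M := K))
  have hle : 2 * Real.log |(discr K : ℝ)| < Module.finrank ℚ K * Real.log (4 / 3 * 46369) := by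
    rw [hc]
    have h1 := mul_le_mul_of_nonneg_right hr' (by positivity : 0 ≤ Real.pi / 2)
    have h2 := mul_lt_mul_of_pos_left hconst hn0
    have h3 := mul_lt_mul_of_pos_left hγ hn0
    nlinarith
  have hlt : Module.finrank ℚ K < 46369 := by
    by_contra h
    have h46 : 46369 ≤ Module.finrank ℚ K := by omega
    have h1 := kd_abelian K hK (by omega)
    have h2 : Real.log (4 / 3 * 46369) ≤ Real.log (4 / 3 * Module.finrank ℚ K) := by
      refine Real.log_le_log (by norm_num) ?_
      have : (46369 : ℝ) ≤ Module.finrank ℚ K := by exact_mod_cast h46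
      linarith
    have h3 := mul_le_mul_of_nonneg_left h2 hn0.le
    linarith
  refine ⟨hlt, ?_⟩
  have hd : 0 < |(discr K : ℝ)| := abs_pos.2 (by exact_mod_cast discr_ne_zero K)
  rw [← Real.log_le_iff_le_exp hd]
  have h46 : (Module.finrank ℚ K : ℝ) ≤ 46369 := by exact_mod_cast hlt.le
  have hlog : 0 ≤ Real.log (4 / 3 * 46369) := Real.log_nonneg (by norm_num)
  have h1 := mul_le_mul_of_nonneg_right h46 hlog
  have hd1 : 0 ≤ Real.log |(discr K : ℝ)| := by
    apply Real.log_nonneg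
    exact_mod_cast Int.one_le_abs (discr_ne_zero K)
  linarith

end d6

lemma kd_apply (K : IntermediateField ℚ ℂ) (h : FiniteDimensional ℚ K) (hg : IsGalois ℚ K)
    (hc : ∀ σ τ : K ≃ₐ[ℚ] K, σ * τ = τ * σ) (hcr : @CriticalDiscr K h) :
    letI : NumberField K := ⟨⟩
    Module.finrank ℚ K < 46369 ∧
      |(discr K : ℝ)| ≤ Real.exp (46369 * (Real.log (4 / 3 * 46369))) := by
  letI : NumberField K := ⟨⟩
  exact @kd_critical K _ _ hg hc hcr

/-- **Second part of Theorem 5.** The set of abelian number fields `K ⊆ ℂ` satisfying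
`log|d_K| = r₁(K)·π/2 + n·(log(8π)+γ)` is finite, and every such field has degree
`n < 46369`. -/
theorem finite_abelian_with_critical_discr :
    {K : IntermediateField ℚ ℂ | ∃ h : FiniteDimensional ℚ K, IsGalois ℚ K ∧
      (∀ σ τ : K ≃ₐ[ℚ] K, σ * τ = τ * σ) ∧ @CriticalDiscr K h}.Finite ∧
    ∀ K : IntermediateField ℚ ℂ, ∀ h : FiniteDimensional ℚ K, IsGalois ℚ K →
      (∀ σ τ : K ≃ₐ[ℚ] K, σ * τ = τ * σ) → @CriticalDiscr K h →
        Module.finrank ℚ K < 46369 := by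
  refine ⟨?_, fun K h hg hc hcr => (kd_apply K h hg hc hcr).1⟩
  obtain ⟨N, hN⟩ := exists_nat_ge (Real.exp (46369 * (Real.log (4 / 3 * 46369))))
  refine ((NumberField.finite_of_discr_bdd ℂ N).image Subtype.val).subset ?_
  rintro K ⟨h, hg, hc, hcr⟩
  refine ⟨⟨K, h⟩, ?_, rfl⟩
  have h1 := (kd_apply K h hg hc hcr).2.trans hN
  rw [Set.mem_ofPred_eq]
  exact_mod_cast h1
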